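/- arXiv:2205.04218 — 3 statements merged into one kernel-verified Lean document; each statement's English description precedes it below -/
import Mathlib

section
/- Let V be a finite-dimensional complex vector space carrying two Lie algebra structures g = (V, [·,·]) and n = (V, {·,·}), where g is a semisimple Lie algebra and n is arbitrary. If there exists a post-Lie algebra structure on the pair (g, n), then n is isomorphic to g as a Lie algebra. -/
namespace PostLie

open Module

/-- A (plain) representation of a Lie algebra on a vector space. -/
def IsRep {g E : Type*} [LieRing g] [LieAlgebra ℂ g] [AddCommGroup E] [Module ℂ E]
    (ρ : g →ₗ[ℂ] E →ₗ[ℂ] E) : Prop :=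
  ∀ x y v, ρ ⁅x, y⁆ v = ρ x (ρ y v) - ρ y (ρ x v)

/-- The Lie ring module attached to a representation. -/
abbrev IsRep.ringModule {g E : Type*} [LieRing g] [LieAlgebra ℂ g] [AddCommGroup E] [Module ℂ E]
    {ρ : g →ₗ[ℂ] E →ₗ[ℂ] E} (h : IsRep ρ) : LieRingModule g E where
  bracket x v := ρ x v
  add_lie x y v := by simp
  lie_add x v w := by simp
  leibniz_lie x y v := by simp [h x y v]

lemma IsRep.lieModule {g E : Type*} [LieRing g] [LieAlgebra ℂ g] [AddCommGroup E] [Module ℂ E]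
    {ρ : g →ₗ[ℂ] E →ₗ[ℂ] E} (h : IsRep ρ) :
    letI := h.ringModule; LieModule ℂ g E :=
  let := h.ringModule
  { smul_lie := fun t x v => by change ρ (t • x) v = t • ρ x v; simp
    lie_smul := fun t x v => by change ρ x (t • v) = t • ρ x v; simp }

lemma perfect_lie (g : Type*) [LieRing g] [LieAlgebra ℂ g] [Module.Finite ℂ g]
    [LieAlgebra.IsKilling ℂ g] : ⁅(⊤ : LieIdeal ℂ g), (⊤ : LieIdeal ℂ g)⁆ = ⊤ := by
  set D : LieIdeal ℂ g := ⁅(⊤ : LieIdeal ℂ g), (⊤ : LieIdeal ℂ g)⁆ with hD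
  have hc := (LieIdeal.isCompl_killingCompl (K := ℂ) (L := g) D)
  have hb : D.killingCompl = ⊥ := by
    rw [eq_bot_iff]
    intro x hx
    rw [LieIdeal.mem_killingCompl] at hx
    have hz : ∀ y : g, ⁅x, y⁆ = 0 := by
      intro y
      apply (LieAlgebra.IsKilling.killingForm_nondegenerate ℂ g).1
      intro z
      rw [LieModule.traceForm_apply_lie_apply, LieModule.traceForm_comm]
      apply hx
      exact LieSubmodule.lie_mem_lie (LieSubmodule.mem_top _) (LieSubmodule.mem_top _)
    have : x ∈ LieAlgebra.center ℂ g := by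
      rw [LieModule.mem_maxTrivSubmodule]
      intro y
      rw [← lie_skew, hz, neg_zero]
    rwa [LieAlgebra.center_eq_bot] at this
  have := hc.sup_eq_top
  rwa [hb, sup_bot_eq] at this

lemma perfect (g : Type*) [LieRing g] [LieAlgebra ℂ g] [Module.Finite ℂ g]
    [LieAlgebra.IsKilling ℂ g] : LieAlgebra.derivedSeries ℂ g 1 = ⊤ := by
  simpa [LieAlgebra.derivedSeries_def] using perfect_lie g

/-- every linear map vanishing on brackets vanishes -/
lemma perfect_induction {g F : Type*} [LieRing g] [LieAlgebra ℂ g] [Module.Finite ℂ g]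
    [LieAlgebra.IsKilling ℂ g] [AddCommGroup F] [Module ℂ F] (f : g →ₗ[ℂ] F)
    (h : ∀ x y : g, f ⁅x, y⁆ = 0) : f = 0 := by
  ext x
  have hx : x ∈ (⁅(⊤ : LieIdeal ℂ g), (⊤ : LieIdeal ℂ g)⁆ : LieIdeal ℂ g).toSubmodule := by
    rw [perfect_lie]; trivial
  rw [LieSubmodule.lieIdeal_oper_eq_linear_span'] at hx
  have : Submodule.span ℂ {x | ∃ y ∈ (⊤ : LieIdeal ℂ g), ∃ z ∈ (⊤ : LieIdeal ℂ g), ⁅y, z⁆ = x}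
      ≤ LinearMap.ker f := by
    rw [Submodule.span_le]
    rintro _ ⟨y, -, z, -, rfl⟩
    exact h y z
  exact this hx

lemma rep_trace_zero {g E : Type*} [LieRing g] [LieAlgebra ℂ g] [Module.Finite ℂ g]
    [LieAlgebra.IsKilling ℂ g] [AddCommGroup E] [Module ℂ E]
    {ρ : g →ₗ[ℂ] E →ₗ[ℂ] E} (h : IsRep ρ) (x : g) : LinearMap.trace ℂ E (ρ x) = 0 := by
  have := perfect_induction ((LinearMap.trace ℂ E).comp ρ) (fun x y => by
    have : ρ ⁅x, y⁆ = ρ x * ρ y - ρ y * ρ x := by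
      ext v; simp [h x y v]
    simp only [LinearMap.comp_apply, this, map_sub]
    rw [LinearMap.trace_mul_comm, sub_self])
  exact LinearMap.congr_fun this x

/-- restriction of a representation to a stable subspace -/
noncomputable def restr {g E : Type*} [LieRing g] [LieAlgebra ℂ g] [AddCommGroup E] [Module ℂ E]
    (ρ : g →ₗ[ℂ] E →ₗ[ℂ] E) (M : Submodule ℂ E) (hM : ∀ x, ∀ m ∈ M, ρ x m ∈ M) :
    g →ₗ[ℂ] M →ₗ[ℂ] M where
  toFun x := (ρ x).restrict (hM x)
  map_add' x y := by ext; simp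
  map_smul' t x := by ext; simp

@[simp] lemma restr_coe {g E : Type*} [LieRing g] [LieAlgebra ℂ g] [AddCommGroup E] [Module ℂ E]
    (ρ : g →ₗ[ℂ] E →ₗ[ℂ] E) (M : Submodule ℂ E) (hM : ∀ x, ∀ m ∈ M, ρ x m ∈ M) (x : g) (m : M) :
    (restr ρ M hM x m : E) = ρ x m := rfl

lemma IsRep.restr {g E : Type*} [LieRing g] [LieAlgebra ℂ g] [AddCommGroup E] [Module ℂ E]
    {ρ : g →ₗ[ℂ] E →ₗ[ℂ] E} (h : IsRep ρ) (M : Submodule ℂ E) (hM : ∀ x, ∀ m ∈ M, ρ x m ∈ M) :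
    IsRep (restr ρ M hM) := by
  intro x y v
  ext
  simp [h x y]

/-- If the trace form vanishes, the representation is trivial. -/
lemma rep_trivial_of_trace {g E : Type*} [LieRing g] [LieAlgebra ℂ g] [Module.Finite ℂ g]
    [LieAlgebra.IsKilling ℂ g] [AddCommGroup E] [Module ℂ E] [Module.Finite ℂ E]
    {ρ : g →ₗ[ℂ] E →ₗ[ℂ] E} (h : IsRep ρ)
    (ht : ∀ x y, LinearMap.trace ℂ E (ρ x * ρ y) = 0) : ρ = 0 := by
  let := h.ringModule
  have := h.lieModule
  have h0 : LieModule.traceForm ℂ g E = 0 := by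
    ext x y
    exact ht x y
  have hn := LieModule.isNilpotent_derivedSeries_of_traceForm_eq_zero h0
  have hb : ∀ x y : g, ∀ v : E, ⁅⁅x, y⁆, v⁆ = ⁅x, ⁅y, v⁆⁆ - ⁅y, ⁅x, v⁆⁆ := fun x y v => lie_lie x y v
  -- the lower central series of the module
  have hnil : LieModule.IsNilpotent g E := by
    rw [LieModule.isNilpotent_iff_forall' (R := ℂ)]
    rw [LieModule.isNilpotent_iff_forall' (R := ℂ)] at hn
    intro x
    exact hn ⟨x, by rw [perfect]; trivial⟩
  obtain ⟨k, hk⟩ := (LieModule.isNilpotent_iff ℂ g E).mp hnil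
  have hstep : ∀ k, LieModule.lowerCentralSeries ℂ g E (k + 2) = ⊥ →
      LieModule.lowerCentralSeries ℂ g E (k + 1) = ⊥ := by
    intro k hk
    rw [LieModule.lowerCentralSeries_succ, LieSubmodule.lie_eq_bot_iff]
    intro x _ m hm
    have hf := perfect_induction (LinearMap.flip ρ m) (fun x y => by
      change ⁅⁅x, y⁆, m⁆ = 0
      have hz : ∀ x y : g, ⁅x, ⁅y, m⁆⁆ = 0 := by
        intro x y
        rw [LieModule.lowerCentralSeries_succ, LieSubmodule.lie_eq_bot_iff] at hk
        apply hk x trivial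
        rw [LieModule.lowerCentralSeries_succ]
        exact LieSubmodule.lie_mem_lie trivial hm
      rw [hb, hz, hz, sub_zero])
    exact LinearMap.congr_fun hf x
  have h1 : LieModule.lowerCentralSeries ℂ g E 1 = ⊥ := by
    have : ∀ k, LieModule.lowerCentralSeries ℂ g E (k + 1) = ⊥ →
      LieModule.lowerCentralSeries ℂ g E 1 = ⊥ := by
      intro k
      induction k with
      | zero => exact id
      | succ k ih => exact fun hh => ih (hstep k hh)
    apply this k
    rw [LieModule.lowerCentralSeries_succ, hk, LieSubmodule.lie_bot]
  ext x v
  rw [LieModule.lowerCentralSeries_succ, LieSubmodule.lie_eq_bot_iff] at h1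
  exact h1 x trivial v trivial

/-- contraction with a dual basis is invariant -/
lemma dual_contract {V W ι : Type*} [AddCommGroup V] [Module ℂ V] [AddCommGroup W] [Module ℂ W]
    [Fintype ι] [DecidableEq ι] [FiniteDimensional ℂ V]
    (B : LinearMap.BilinForm ℂ V) (hB : B.Nondegenerate) (b : Basis ι ℂ V)
    (T : V →ₗ[ℂ] V) (hT : ∀ u v, B (T u) v = - B u (T v)) (β : V →ₗ[ℂ] V →ₗ[ℂ] W) :
    ∑ i, (β (T (b i)) (B.dualBasis hB b i) + β (b i) (T (B.dualBasis hB b i))) = 0 := by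
  set d := B.dualBasis hB b with hd
  have h1 : ∀ v, v = ∑ j, B (d j) v • b j := by
    intro v
    conv_lhs => rw [← b.sum_repr v]
    refine Finset.sum_congr rfl fun j _ => ?_
    congr 1
    have h3 : B (d j) (∑ i, b.repr v i • b i) = b.repr v j := by
      simp only [map_sum, map_smul, hd, LinearMap.BilinForm.apply_dualBasis_left]
      simp
    rw [b.sum_repr v] at h3
    exact h3.symm
  have h2 : ∀ v, v = ∑ j, B v (b j) • d j := by
    intro v
    conv_lhs => rw [← d.sum_repr v]
    refine Finset.sum_congr rfl fun j _ => ?_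
    simp [hd]
  have e1 : ∀ i, β (T (b i)) (d i) = ∑ j, B (d j) (T (b i)) • β (b j) (d i) := by
    intro i
    conv_lhs => rw [h1 (T (b i))]
    simp
  have e2 : ∀ i, β (b i) (T (d i)) = ∑ j, B (T (d i)) (b j) • β (b i) (d j) := by
    intro i
    conv_lhs => rw [h2 (T (d i))]
    simp
  rw [Finset.sum_add_distrib]
  simp_rw [e1, e2]
  rw [Finset.sum_comm, ← Finset.sum_add_distrib]
  apply Finset.sum_eq_zero
  intro i _
  rw [← Finset.sum_add_distrib]
  apply Finset.sum_eq_zero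
  intro j _
  rw [hT]
  simp

/-- The Casimir element: for a stable subspace `M` with nonzero action there is a commuting
operator with image of the form sum of products, not nilpotent on `M`. -/
lemma exists_casimir {g E : Type*} [LieRing g] [LieAlgebra ℂ g] [Module.Finite ℂ g]
    [LieAlgebra.IsKilling ℂ g] [AddCommGroup E] [Module ℂ E] [Module.Finite ℂ E]
    {ρ : g →ₗ[ℂ] E →ₗ[ℂ] E} (h : IsRep ρ) (M : Submodule ℂ E) (hM : ∀ x, ∀ m ∈ M, ρ x m ∈ M)
    (hne : restr ρ M hM ≠ 0) :
    ∃ C : E →ₗ[ℂ] E, (∀ x v, C (ρ x v) = ρ x (C v)) ∧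
      (∀ N : Submodule ℂ E, ∀ v, (∀ x, ∀ m ∈ N, ρ x m ∈ N) → (∀ x, ρ x v ∈ N) → C v ∈ N) ∧
      ∃ hC : ∀ m ∈ M, C m ∈ M, LinearMap.trace ℂ M (C.restrict hC) ≠ 0 := by
  classical
  have hR := h.restr M hM
  let := hR.ringModule
  have := hR.lieModule
  let B := LieModule.traceForm ℂ g M
  let k : LieIdeal ℂ g :=
    { LinearMap.ker B with
      lie_mem := by
        intro x m hm
        change m ∈ LinearMap.ker B at hm
        change ⁅x, m⁆ ∈ LinearMap.ker B
        rw [LinearMap.mem_ker] at hm ⊢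
        ext y
        have := LieModule.traceForm_apply_lie_apply ℂ g M m x y
        change B ⁅x, m⁆ y = 0
        rw [← lie_skew, map_neg, LinearMap.neg_apply]
        change - B ⁅m, x⁆ y = 0
        have h2 : B ⁅m, x⁆ y = B m ⁅x, y⁆ := this
        rw [h2, hm]; simp }
  let I : LieIdeal ℂ g := LieIdeal.killingCompl ℂ g k
  have hc : IsCompl k I := LieIdeal.isCompl_killingCompl (K := ℂ) (L := g) k
  let BI : LinearMap.BilinForm ℂ I := B.compl₁₂ I.toSubmodule.subtype I.toSubmodule.subtype
  have hBI : ∀ u v : I, BI u v = B u v := fun _ _ => rfl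
  have hsymB : ∀ u v, B u v = B v u := LieModule.traceForm_comm ℂ g M
  have hsym : BI.IsSymm := ⟨fun u v => hsymB u v⟩
  have hmemk : ∀ u, u ∈ k ↔ B u = 0 := fun u => LinearMap.mem_ker
  have hnd : BI.Nondegenerate := by
    refine (LinearMap.IsRefl.nondegenerate_iff_separatingLeft (B := BI) hsym.isRefl).mpr ?_
    intro u hu
    have huk : (u : g) ∈ k := by
      rw [hmemk]
      ext y
      have hy : y ∈ (k ⊔ I : LieIdeal ℂ g) := by rw [hc.sup_eq_top]; trivial
      obtain ⟨a, ha, c, hcI, rfl⟩ := LieSubmodule.mem_sup _ _ _ |>.mp hy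
      rw [map_add, hsymB u a, (hmemk a).mp ha]
      have := hu ⟨c, hcI⟩
      rw [hBI] at this
      simp [this]
    have : (u : g) ∈ (k ⊓ I : LieIdeal ℂ g) := ⟨huk, u.2⟩
    rw [hc.inf_eq_bot] at this
    ext
    simpa using this
  let b := Module.finBasis ℂ I
  let d := BI.dualBasis hnd b
  let C : E →ₗ[ℂ] E := ∑ i, ρ (b i : g) ∘ₗ ρ (d i : g)
  have hCv : ∀ v, C v = ∑ i, ρ (b i : g) (ρ (d i : g) v) := by
    intro v; simp [C]
  have hCM : ∀ N : Submodule ℂ E, ∀ v, (∀ x, ∀ m ∈ N, ρ x m ∈ N) → (∀ x, ρ x v ∈ N) → C v ∈ N := by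
    intro N v h1 h2
    rw [hCv]
    exact Submodule.sum_mem _ fun i _ => h1 _ _ (h2 _)
  refine ⟨C, ?_, hCM, fun m hm => hCM M m hM (fun x => hM x m hm), ?_⟩
  · intro x v
    let T : I →ₗ[ℂ] I := LieModule.toEnd ℂ g I x
    have hTc : ∀ u : I, (T u : g) = ⁅x, (u : g)⁆ := fun u => rfl
    let β : I →ₗ[ℂ] I →ₗ[ℂ] E :=
      LinearMap.mk₂ ℂ (fun u w => ρ (u : g) (ρ (w : g) v))
        (by intros; simp) (by intros; simp) (by intros; simp) (by intros; simp)
    have key := dual_contract BI hnd b T (by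
      intro u w
      rw [hBI, hBI, hTc, hTc, ← lie_skew, map_neg, LinearMap.neg_apply]
      congr 1
      exact LieModule.traceForm_apply_lie_apply ℂ g M u x w) β
    have hterm : ∀ i, β (T (b i)) (d i) + β (b i) (T (d i)) =
        ρ x (ρ (b i : g) (ρ (d i : g) v)) - ρ (b i : g) (ρ (d i : g) (ρ x v)) := by
      intro i
      simp only [β, LinearMap.mk₂_apply, hTc, h x, map_sub]
      abel
    change ∑ i, (β (T (b i)) (d i) + β (b i) (T (d i))) = 0 at key
    simp_rw [hterm, Finset.sum_sub_distrib] at key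
    rw [hCv, hCv, map_sum]
    exact (sub_eq_zero.mp key).symm
  · have hres : C.restrict (fun m hm => hCM M m hM (fun x => hM x m hm)) =
        ∑ i, restr ρ M hM (b i : g) * restr ρ M hM (d i : g) := by
      ext m
      simp [hCv]
    rw [hres, map_sum]
    have h1 : ∀ i, LinearMap.trace ℂ M (restr ρ M hM (b i : g) * restr ρ M hM (d i : g)) = 1 := by
      intro i
      have : BI (b i) (d i) = 1 := by
        simp [d, LinearMap.BilinForm.apply_dualBasis_right hnd hsym]
      exact this
    simp_rw [h1]
    simp only [Finset.sum_const, Finset.card_univ, Fintype.card_fin, nsmul_eq_mul, mul_one, ne_eq,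
      Nat.cast_eq_zero]
    intro h0
    apply hne
    apply rep_trivial_of_trace hR
    intro x y
    have hIb : I = ⊥ := by
      rw [← LieSubmodule.toSubmodule_eq_bot]
      exact Submodule.finrank_eq_zero.mp h0
    have hk : k = ⊤ := by
      have := hc.sup_eq_top
      rwa [hIb, sup_bot_eq] at this
    have hx : B x = 0 := (hmemk x).mp (by rw [hk]; trivial)
    have : B x y = 0 := by rw [hx]; rfl
    exact this

/-- Whitehead's first lemma, pointwise version. -/
theorem whitehead {g E : Type*} [LieRing g] [LieAlgebra ℂ g] [Module.Finite ℂ g]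
    [LieAlgebra.IsKilling ℂ g] [AddCommGroup E] [Module ℂ E] [Module.Finite ℂ E]
    {ρ : g →ₗ[ℂ] E →ₗ[ℂ] E} (h : IsRep ρ) (M : Submodule ℂ E) (hM : ∀ x, ∀ m ∈ M, ρ x m ∈ M)
    (e : E) (he : ∀ x, ρ x e ∈ M) : ∃ m ∈ M, ∀ x, ρ x (e - m) = 0 := by
  induction hn : finrank ℂ M using Nat.strong_induction_on generalizing M e with
  | _ n ih =>
  by_cases hne : restr ρ M hM = 0
  · refine ⟨0, M.zero_mem, fun x => ?_⟩
    have h0 : ∀ x, ∀ m ∈ M, ρ x m = 0 := by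
      intro x m hm
      have := LinearMap.congr_fun (LinearMap.congr_fun hne x) ⟨m, hm⟩
      exact congrArg Subtype.val this
    have := perfect_induction (LinearMap.flip ρ e) (fun x y => by
      simp [h x y, h0 _ _ (he _)])
    simpa using LinearMap.congr_fun this x
  · obtain ⟨C, hCρ, hCN, hC, htr⟩ := exists_casimir h M hM hne
    set S := C.restrict hC with hS
    have hSp : ∀ n (m : M), ((S ^ n) m : E) = (C ^ n) m := by
      intro n m
      induction n generalizing m with
      | zero => simp
      | succ n ih =>
        rw [pow_succ, pow_succ, Module.End.mul_apply, ih]; rfl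
    have hCp : ∀ n x v, (C ^ n) (ρ x v) = ρ x ((C ^ n) v) := by
      intro n
      induction n with
      | zero => simp
      | succ n ih => intro x v; simp [pow_succ, ih, hCρ]
    -- stabilisation of ranges
    obtain ⟨a, ha⟩ := Filter.eventually_atTop.mp (LinearMap.eventually_iInf_range_pow_eq S)
    have hCe : C e ∈ M := hCN M e hM he
    set j := a + 1 with hj
    have hCje : (C ^ j) e ∈ M := by
      have h2 := (S ^ a) ⟨C e, hCe⟩
      have : (C ^ j) e = ((S ^ a) ⟨C e, hCe⟩ : M) := by
        rw [hSp, hj, pow_succ]; simp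
      rw [this]; exact Subtype.property _
    have hrange : LinearMap.range (S ^ j) = LinearMap.range (S ^ (j + j)) := by
      rw [← ha j (by omega), ← ha (j + j) (by omega)]
    obtain ⟨m, hm⟩ : ∃ m : M, (S ^ (j + j)) m = (S ^ j) ⟨_, hCje⟩ := by
      have : (S ^ j) ⟨_, hCje⟩ ∈ LinearMap.range (S ^ j) := ⟨_, rfl⟩
      rw [hrange] at this
      exact this
    have hker : (C ^ (j + j)) (e - m) = 0 := by
      have h1 := congrArg Subtype.val hm
      rw [hSp, hSp] at h1
      rw [map_sub, h1, pow_add]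
      simp
    set K := LinearMap.ker (C ^ (j + j)) with hK
    have hlt : finrank ℂ (M ⊓ K : Submodule ℂ E) < n := by
      rw [← hn]
      apply Submodule.finrank_lt_finrank_of_lt
      refine lt_of_le_of_ne inf_le_left fun heq => htr ?_
      have hnil : IsNilpotent S := by
        refine ⟨j + j, ?_⟩
        ext m
        rw [hSp]
        have : (m : E) ∈ M ⊓ K := by rw [heq]; exact m.2
        simpa [hK] using this.2
      exact (LinearMap.isNilpotent_trace_of_isNilpotent hnil).eq_zero
    have hKst : ∀ x, ∀ v ∈ K, ρ x v ∈ K := by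
      intro x v hv
      rw [hK, LinearMap.mem_ker] at hv ⊢
      rw [hCp, hv, map_zero]
    obtain ⟨m', hm', hx⟩ := ih _ hlt (M ⊓ K)
      (fun x v hv => ⟨hM x v hv.1, hKst x v hv.2⟩) (e - m)
      (fun x => ⟨by rw [map_sub]; exact M.sub_mem (he x) (hM x _ m.2), hKst x _ hker⟩) rfl
    refine ⟨m + m', M.add_mem m.2 hm'.1, fun x => ?_⟩
    rw [← sub_sub]
    exact hx x

/-- Invariants -/
def Inv {g E : Type*} [LieRing g] [LieAlgebra ℂ g] [AddCommGroup E] [Module ℂ E]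
    (ρ : g →ₗ[ℂ] E →ₗ[ℂ] E) : Submodule ℂ E where
  carrier := {v | ∀ x, ρ x v = 0}
  add_mem' := by intro a b ha hb x; simp [ha x, hb x]
  zero_mem' := by intro x; simp
  smul_mem' := by intro c v hv x; simp [hv x]

lemma mem_Inv {g E : Type*} [LieRing g] [LieAlgebra ℂ g] [AddCommGroup E] [Module ℂ E]
    (ρ : g →ₗ[ℂ] E →ₗ[ℂ] E) (v : E) : v ∈ Inv ρ ↔ ∀ x, ρ x v = 0 := Iff.rfl

/-- The span of all `ρ x v`. -/
def Coinv {g E : Type*} [LieRing g] [LieAlgebra ℂ g] [AddCommGroup E] [Module ℂ E]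
    (ρ : g →ₗ[ℂ] E →ₗ[ℂ] E) : Submodule ℂ E := Submodule.span ℂ {w | ∃ x v, ρ x v = w}

lemma mem_Coinv {g E : Type*} [LieRing g] [LieAlgebra ℂ g] [AddCommGroup E] [Module ℂ E]
    (ρ : g →ₗ[ℂ] E →ₗ[ℂ] E) (x : g) (v : E) : ρ x v ∈ Coinv ρ :=
  Submodule.subset_span ⟨x, v, rfl⟩

lemma exists_inv_add_coinv {g E : Type*} [LieRing g] [LieAlgebra ℂ g] [Module.Finite ℂ g]
    [LieAlgebra.IsKilling ℂ g] [AddCommGroup E] [Module ℂ E] [Module.Finite ℂ E]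
    {ρ : g →ₗ[ℂ] E →ₗ[ℂ] E} (h : IsRep ρ) (e : E) :
    ∃ u ∈ Coinv ρ, e - u ∈ Inv ρ :=
  whitehead h (Coinv ρ) (fun x m _ => mem_Coinv ρ x m) e (fun x => mem_Coinv ρ x e)

/-- dual representation -/
noncomputable def dualRep {g E : Type*} [LieRing g] [LieAlgebra ℂ g] [AddCommGroup E] [Module ℂ E]
    (ρ : g →ₗ[ℂ] E →ₗ[ℂ] E) : g →ₗ[ℂ] (E →ₗ[ℂ] ℂ) →ₗ[ℂ] (E →ₗ[ℂ] ℂ) :=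
  LinearMap.mk₂ ℂ (fun x f => - f ∘ₗ ρ x)
    (by intros; ext; simp [add_comm]) (by intros; ext; simp) (by intros; ext; simp [add_comm])
    (by intros; ext; simp)

@[simp] lemma dualRep_apply {g E : Type*} [LieRing g] [LieAlgebra ℂ g] [AddCommGroup E]
    [Module ℂ E] (ρ : g →ₗ[ℂ] E →ₗ[ℂ] E) (x : g) (f : E →ₗ[ℂ] ℂ) (v : E) :
    dualRep ρ x f v = - f (ρ x v) := rfl

lemma IsRep.dual {g E : Type*} [LieRing g] [LieAlgebra ℂ g] [AddCommGroup E] [Module ℂ E]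
    {ρ : g →ₗ[ℂ] E →ₗ[ℂ] E} (h : IsRep ρ) : IsRep (dualRep ρ) := by
  intro x y f
  ext v
  simp [h x y]

lemma inv_inf_coinv {g E : Type*} [LieRing g] [LieAlgebra ℂ g] [Module.Finite ℂ g]
    [LieAlgebra.IsKilling ℂ g] [AddCommGroup E] [Module ℂ E] [Module.Finite ℂ E]
    {ρ : g →ₗ[ℂ] E →ₗ[ℂ] E} (h : IsRep ρ) (v : E) (hi : v ∈ Inv ρ) (hc : v ∈ Coinv ρ) :
    v = 0 := by
  by_contra hv
  obtain ⟨f, hf⟩ := Module.Projective.exists_dual_eq_one ℂ hv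
  obtain ⟨m, hm, hx⟩ := whitehead h.dual (LinearMap.ker (LinearMap.applyₗ (R := ℂ) (M₂ := ℂ) v))
    (fun x m _ => by simp [hi x]) f (fun x => by simp [hi x])
  have h1 : ∀ w ∈ Coinv ρ, (f - m) w = 0 := by
    intro w hw
    have : Coinv ρ ≤ LinearMap.ker (f - m) := by
      rw [Coinv, Submodule.span_le]
      rintro _ ⟨x, u, rfl⟩
      have := LinearMap.congr_fun (hx x) u
      rw [dualRep_apply] at this
      exact neg_eq_zero.mp this
    exact this hw
  have h2 := h1 v hc
  have h3 : m v = 0 := hm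
  rw [LinearMap.sub_apply, hf, h3] at h2
  simp at h2

/-- representation on linear maps -/
noncomputable def homRep {g V E : Type*} [LieRing g] [LieAlgebra ℂ g] [AddCommGroup V] [Module ℂ V]
    [AddCommGroup E] [Module ℂ E]
    (σ : g →ₗ[ℂ] V →ₗ[ℂ] V) (ρ : g →ₗ[ℂ] E →ₗ[ℂ] E) :
    g →ₗ[ℂ] (V →ₗ[ℂ] E) →ₗ[ℂ] (V →ₗ[ℂ] E) :=
  LinearMap.mk₂ ℂ (fun x f => ρ x ∘ₗ f - f ∘ₗ σ x)
    (by intros; ext; simp; abel) (by intros; ext; simp [smul_sub]) (by intros; ext; simp; abel)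
    (by intros; ext; simp [smul_sub])

@[simp] lemma homRep_apply {g V E : Type*} [LieRing g] [LieAlgebra ℂ g] [AddCommGroup V]
    [Module ℂ V] [AddCommGroup E] [Module ℂ E]
    (σ : g →ₗ[ℂ] V →ₗ[ℂ] V) (ρ : g →ₗ[ℂ] E →ₗ[ℂ] E) (x : g) (f : V →ₗ[ℂ] E) (v : V) :
    homRep σ ρ x f v = ρ x (f v) - f (σ x v) := rfl

lemma IsRep.hom {g V E : Type*} [LieRing g] [LieAlgebra ℂ g] [AddCommGroup V]
    [Module ℂ V] [AddCommGroup E] [Module ℂ E]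
    {σ : g →ₗ[ℂ] V →ₗ[ℂ] V} {ρ : g →ₗ[ℂ] E →ₗ[ℂ] E} (hσ : IsRep σ) (hρ : IsRep ρ) :
    IsRep (homRep σ ρ) := by
  intro x y f
  ext v
  simp [hσ x y, hρ x y]
  abel

/-- Weyl's complete reducibility. -/
theorem exists_compl {g E : Type*} [LieRing g] [LieAlgebra ℂ g] [Module.Finite ℂ g]
    [LieAlgebra.IsKilling ℂ g] [AddCommGroup E] [Module ℂ E] [Module.Finite ℂ E]
    {ρ : g →ₗ[ℂ] E →ₗ[ℂ] E} (h : IsRep ρ) (W : Submodule ℂ E) (hW : ∀ x, ∀ m ∈ W, ρ x m ∈ W) :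
    ∃ W' : Submodule ℂ E, (∀ x, ∀ m ∈ W', ρ x m ∈ W') ∧ IsCompl W W' := by
  obtain ⟨π, hπ⟩ := Submodule.exists_isCompl W
  let P : E →ₗ[ℂ] E := W.subtype ∘ₗ W.projectionOnto π hπ
  have hP1 : ∀ v, P v ∈ W := fun v => Subtype.property _
  have hP2 : ∀ v ∈ W, P v = v := fun v hv => by
    simpa [P] using congrArg Subtype.val (Submodule.projectionOnto_apply_left hπ ⟨v, hv⟩)
  let M : Submodule ℂ (E →ₗ[ℂ] E) :=
    { carrier := {f | (∀ v, f v ∈ W) ∧ ∀ v ∈ W, f v = 0}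
      add_mem' := by
        rintro a b ⟨h1, h2⟩ ⟨h3, h4⟩
        exact ⟨fun v => W.add_mem (h1 v) (h3 v), fun v hv => by simp [h2 v hv, h4 v hv]⟩
      zero_mem' := ⟨fun v => W.zero_mem, fun v hv => rfl⟩
      smul_mem' := by
        rintro c a ⟨h1, h2⟩
        exact ⟨fun v => W.smul_mem _ (h1 v), fun v hv => by simp [h2 v hv]⟩ }
  obtain ⟨m, hm, hx⟩ := whitehead (h.hom h) M (by
    rintro x f ⟨h1, h2⟩
    exact ⟨fun v => W.sub_mem (hW x _ (h1 _)) (h1 _), fun v hv => by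
      simp [h2 v hv, h2 _ (hW x v hv)]⟩) P (by
    intro x
    exact ⟨fun v => W.sub_mem (hW x _ (hP1 _)) (hP1 _), fun v hv => by
      simp [hP2 v hv, hP2 _ (hW x v hv)]⟩)
  set Q := P - m with hQ
  have hQ1 : ∀ v, Q v ∈ W := fun v => W.sub_mem (hP1 v) (hm.1 v)
  have hQ2 : ∀ v ∈ W, Q v = v := fun v hv => by simp [hQ, hP2 v hv, hm.2 v hv]
  refine ⟨LinearMap.ker Q, ?_, ?_⟩
  · intro x v hv
    have := LinearMap.congr_fun (hx x) v
    rw [homRep_apply, LinearMap.mem_ker.mp hv] at this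
    simpa using this
  · constructor
    · rw [Submodule.disjoint_def]
      intro v hv hv'
      rw [← hQ2 v hv]; exact hv'
    · rw [codisjoint_iff, eq_top_iff]
      intro v _
      rw [← sub_add_cancel v (Q v), add_comm]
      exact Submodule.add_mem_sup (hQ1 v) (by simp [hQ2 _ (hQ1 v)])

end PostLie

namespace PostLie
open Module

/-- post-Lie data transported to `N`. -/
structure PLData (G N : Type*) [LieRing G] [LieAlgebra ℂ G] [LieRing N] [LieAlgebra ℂ N] where
  e : G ≃ₗ[ℂ] N
  L : G →ₗ[ℂ] N →ₗ[ℂ] N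
  ax1 : ∀ x y : G, L x (e y) - L y (e x) = e ⁅x, y⁆ - ⁅e x, e y⁆
  rep : IsRep L
  der : ∀ x (Y Z : N), L x ⁅Y, Z⁆ = ⁅L x Y, Z⁆ + ⁅Y, L x Z⁆

variable {G N : Type*} [LieRing G] [LieAlgebra ℂ G] [LieRing N] [LieAlgebra ℂ N]

/-- compatible pair of representations -/
structure Compat (D : PLData G N) {E : Type*} [AddCommGroup E] [Module ℂ E]
    (l : G →ₗ[ℂ] E →ₗ[ℂ] E) (v : N →ₗ[ℂ] E →ₗ[ℂ] E) : Prop where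
  repl : IsRep l
  repv : IsRep v
  comp : ∀ x Y w, l x (v Y w) - v Y (l x w) = v (D.L x Y) w

lemma Compat.mu {D : PLData G N} {E : Type*} [AddCommGroup E] [Module ℂ E]
    {l : G →ₗ[ℂ] E →ₗ[ℂ] E} {v : N →ₗ[ℂ] E →ₗ[ℂ] E} (h : Compat D l v) :
    IsRep (v ∘ₗ D.e.toLinearMap + l) := by
  intro x y w
  have h1 := D.ax1 x y
  have h2 := h.comp x (D.e y) w
  have h3 := h.comp y (D.e x) w
  have h4 := h.repv (D.e x) (D.e y) w
  have h5 : D.e ⁅x, y⁆ = D.L x (D.e y) - D.L y (D.e x) + ⁅D.e x, D.e y⁆ := by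
    rw [h1]; abel
  simp only [LinearMap.add_apply, LinearMap.comp_apply, LinearEquiv.coe_coe, h5, map_add, map_sub,
    LinearMap.sub_apply, ← h2, ← h3, h4, h.repl x y]
  abel

/-- the adjoint action as a plain bilinear map -/
noncomputable def adL (N : Type*) [LieRing N] [LieAlgebra ℂ N] : N →ₗ[ℂ] N →ₗ[ℂ] N :=
  LinearMap.mk₂ ℂ (fun x y => ⁅x, y⁆) (by simp) (by simp) (by simp) (by simp)

@[simp] lemma adL_apply (x y : N) : adL N x y = ⁅x, y⁆ := rfl

lemma adL_rep : IsRep (adL N) := by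
  intro x y v; simp

lemma compat_ad (D : PLData G N) : Compat D D.L (adL N) :=
  ⟨D.rep, adL_rep, fun x Y w => by simp [D.der]⟩

lemma trace_R [Module.Finite ℂ G] [Module.Finite ℂ N] [LieAlgebra.IsKilling ℂ G] (D : PLData G N)
    (X : N) : LinearMap.trace ℂ N ((LinearMap.flip D.L X) ∘ₗ D.e.symm.toLinearMap) = 0 := by
  obtain ⟨x, rfl⟩ := D.e.surjective X
  have h1 : (LinearMap.flip D.L (D.e x)) ∘ₗ D.e.symm.toLinearMap =
      ((adL N) ∘ₗ D.e.toLinearMap + D.L) x - D.e.conj (adL G x) := by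
    ext Y
    obtain ⟨y, rfl⟩ := D.e.surjective Y
    have := D.ax1 x y
    have h5 : D.e ⁅x, y⁆ = D.L x (D.e y) - D.L y (D.e x) + ⁅D.e x, D.e y⁆ := by
      rw [this]; abel
    simp [LinearEquiv.conj_apply, h5]
    abel
  rw [h1, map_sub, rep_trace_zero (compat_ad D).mu, LinearMap.trace_conj',
    rep_trace_zero adL_rep, sub_zero]

theorem theoremN [Module.Finite ℂ G] [Module.Finite ℂ N] [LieAlgebra.IsKilling ℂ G]
    {D : PLData G N} {E : Type*} [AddCommGroup E] [Module ℂ E] [Module.Finite ℂ E]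
    {l : G →ₗ[ℂ] E →ₗ[ℂ] E} {v : N →ₗ[ℂ] E →ₗ[ℂ] E} (h : Compat D l v) (v1 v2 : E)
    (h1 : ∀ x, v (D.e x) v1 + l x v1 = 0) (h2 : v2 ∈ Inv l) (hu : v1 - v2 ∈ Coinv l) (X : N) :
    v X v2 = 0 := by
  have hr := D.rep.hom h.repl
  have hB : ∀ x w, homRep D.L l x (v.flip w) = v.flip (l x w) := by
    intro x w
    ext X
    simp [← h.comp]
  have hinv : v.flip v2 ∈ Inv (homRep D.L l) := by
    intro x
    rw [hB, h2 x, map_zero]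
  have hco : ∀ w ∈ Coinv l, v.flip w ∈ Coinv (homRep D.L l) := by
    intro w hw
    have : Coinv l ≤ (Coinv (homRep D.L l)).comap v.flip := by
      rw [Coinv, Submodule.span_le]
      rintro _ ⟨x, u, rfl⟩
      change v.flip (l x u) ∈ Coinv (homRep D.L l)
      rw [← hB]
      exact mem_Coinv _ _ _
    exact this hw
  have hv1 : v.flip v1 ∈ Coinv (homRep D.L l) := by
    let b := Module.finBasis ℂ N
    have hs : v.flip v1 = - ∑ i, homRep D.L l (D.e.symm (b i))
        ((b.coord i).smulRight v1) := by
      ext X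
      have ht := trace_R D X
      rw [LinearMap.trace_eq_matrix_trace ℂ b] at ht
      simp only [Matrix.trace, Matrix.diag, LinearMap.toMatrix_apply] at ht
      simp only [LinearMap.flip_apply, LinearMap.neg_apply, LinearMap.sum_apply, homRep_apply,
        LinearMap.smulRight_apply, Finset.sum_sub_distrib, ← Finset.sum_smul]
      simp only [LinearMap.comp_apply, LinearEquiv.coe_coe, LinearMap.flip_apply] at ht
      have ht2 : ∑ i, b.coord i ((D.L (D.e.symm (b i))) X) = 0 := ht
      rw [ht2, zero_smul, sub_zero]
      have hX : ∑ i, l (D.e.symm (b i)) (b.coord i X • v1) = l (D.e.symm X) v1 := by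
        have h7 : l (D.e.symm (∑ i, b.repr X i • b i)) v1 = l (D.e.symm X) v1 := by
          rw [b.sum_repr X]
        rw [← h7]
        simp only [map_sum, map_smul, LinearMap.sum_apply, LinearMap.smul_apply, Basis.coord_apply]
      rw [hX, eq_neg_iff_add_eq_zero]
      simpa using h1 (D.e.symm X)
    rw [hs]
    exact Submodule.neg_mem _ (Submodule.sum_mem _ fun i _ => mem_Coinv _ _ _)
  have hc2 : v.flip v2 ∈ Coinv (homRep D.L l) := by
    have := Submodule.sub_mem _ hv1 (hco _ hu)
    rwa [← map_sub, sub_sub_cancel] at this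
  have := inv_inf_coinv hr _ hinv hc2
  exact LinearMap.congr_fun this X

theorem corN [Module.Finite ℂ G] [Module.Finite ℂ N] [LieAlgebra.IsKilling ℂ G]
    {D : PLData G N} {E : Type*} [AddCommGroup E] [Module ℂ E] [Module.Finite ℂ E]
    {l : G →ₗ[ℂ] E →ₗ[ℂ] E} {v : N →ₗ[ℂ] E →ₗ[ℂ] E} (h : Compat D l v) (M : Submodule ℂ E)
    (hl : ∀ x, ∀ m ∈ M, l x m ∈ M) (hv : ∀ x, ∀ m ∈ M, v x m ∈ M) (w : E)
    (hwl : ∀ x, l x w ∈ M) (hwv : ∀ x, v x w ∈ M) :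
    ∃ m ∈ M, (∀ x, l x (w - m) = 0) ∧ (∀ x, v x (w - m) = 0) := by
  obtain ⟨m1, hm1, h1⟩ := whitehead h.mu M
    (fun x m hm => M.add_mem (hv _ m hm) (hl _ m hm)) w (fun x => M.add_mem (hwv _) (hwl _))
  obtain ⟨u, hu, h2⟩ := whitehead h.repl (M ⊓ Coinv l)
    (fun x m hm => ⟨hl _ _ hm.1, mem_Coinv _ _ _⟩) (w - m1)
    (fun x => ⟨by rw [map_sub]; exact M.sub_mem (hwl _) (hl _ _ hm1), mem_Coinv _ _ _⟩)
  refine ⟨m1 + u, M.add_mem hm1 hu.1, ?_, ?_⟩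
  · intro x; rw [← sub_sub]; exact h2 x
  · intro x; rw [← sub_sub]
    exact theoremN h (w - m1) _ h1 h2 (by rw [sub_sub_cancel]; exact hu.2) x

lemma D_killing [Module.Finite ℂ N] (D : PLData G N) (x : G) (Y Z : N) :
    killingForm ℂ N (D.L x Y) Z = - killingForm ℂ N Y (D.L x Z) := by
  have h1 : ∀ Y, LieAlgebra.ad ℂ N (D.L x Y) = D.L x * LieAlgebra.ad ℂ N Y -
      LieAlgebra.ad ℂ N Y * D.L x := by
    intro Y; ext Z; simp [D.der]
  simp only [killingForm_apply_apply]
  rw [h1, h1]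
  simp only [← Module.End.mul_eq_comp]
  rw [sub_mul, mul_sub, map_sub, map_sub, mul_assoc (D.L x), LinearMap.trace_mul_comm,
    ← mul_assoc, ← mul_assoc]
  rw [neg_sub]


lemma ideal_central [Module.Finite ℂ G] [Module.Finite ℂ N] [LieAlgebra.IsKilling ℂ G]
    (D : PLData G N) (A : LieIdeal ℂ N) (hA : ∀ x, ∀ a ∈ A, D.L x a ∈ A)
    (hab : ∀ a ∈ A, ∀ b ∈ A, ⁅a, b⁆ = 0) : A = ⊥ := by
  let W : Submodule ℂ N := A.toSubmodule
  have hW1 : ∀ x, ∀ a ∈ W, D.L x a ∈ W := hA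
  have hW2 : ∀ x, ∀ a ∈ W, adL N x a ∈ W := fun x a ha => A.lie_mem ha
  obtain ⟨W', hW'⟩ := Submodule.exists_isCompl W
  let P : N →ₗ[ℂ] N := W.subtype ∘ₗ W.projectionOnto W' hW'
  have hP1 : ∀ v, P v ∈ W := fun v => Subtype.property _
  have hP2 : ∀ v ∈ W, P v = v := fun v hv => by
    simpa [P] using congrArg Subtype.val (Submodule.projectionOnto_apply_left hW' ⟨v, hv⟩)
  let M : Submodule ℂ (N →ₗ[ℂ] N) :=
    { carrier := {f | (∀ v, f v ∈ W) ∧ ∀ v ∈ W, f v = 0}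
      add_mem' := by
        rintro a b ⟨h1, h2⟩ ⟨h3, h4⟩
        exact ⟨fun v => W.add_mem (h1 v) (h3 v), fun v hv => by simp [h2 v hv, h4 v hv]⟩
      zero_mem' := ⟨fun v => W.zero_mem, fun v hv => rfl⟩
      smul_mem' := by
        rintro c a ⟨h1, h2⟩
        exact ⟨fun v => W.smul_mem _ (h1 v), fun v hv => by simp [h2 v hv]⟩ }
  have hcomp : Compat D (homRep D.L D.L) (homRep (adL N) (adL N)) := by
    refine ⟨D.rep.hom D.rep, adL_rep.hom adL_rep, fun x Y f => ?_⟩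
    ext Z
    simp [D.der]
    abel
  obtain ⟨m, hm, hl, hv⟩ := corN hcomp M
    (by
      rintro x f ⟨h1, h2⟩
      exact ⟨fun v => W.sub_mem (hW1 x _ (h1 _)) (h1 _), fun v hv => by
        simp [h2 v hv, h2 _ (hW1 x v hv)]⟩)
    (by
      rintro x f ⟨h1, h2⟩
      exact ⟨fun v => W.sub_mem (hW2 x _ (h1 _)) (h1 _), fun v hv => by
        have := h2 _ (hW2 x v hv)
        rw [homRep_apply, this, h2 v hv]; simp⟩)
    P
    (by
      intro x
      exact ⟨fun v => W.sub_mem (hW1 x _ (hP1 _)) (hP1 _), fun v hv => by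
        simp [hP2 v hv, hP2 _ (hW1 x v hv)]⟩)
    (by
      intro x
      exact ⟨fun v => W.sub_mem (hW2 x _ (hP1 _)) (hP1 _), fun v hv => by
        rw [homRep_apply, hP2 v hv, hP2 _ (hW2 x v hv)]; simp⟩)
  set Q := P - m with hQ
  have hQ1 : ∀ v, Q v ∈ W := fun v => W.sub_mem (hP1 v) (hm.1 v)
  have hQ2 : ∀ v ∈ W, Q v = v := fun v hv => by simp [hQ, hP2 v hv, hm.2 v hv]
  have hQl : ∀ x v, D.L x (Q v) = Q (D.L x v) := fun x v => by
    have := LinearMap.congr_fun (hl x) v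
    rw [homRep_apply] at this
    exact sub_eq_zero.mp this
  have hQv : ∀ x v, ⁅x, Q v⁆ = Q ⁅x, v⁆ := fun x v => by
    have := LinearMap.congr_fun (hv x) v
    rw [homRep_apply] at this
    exact sub_eq_zero.mp this
  have hcent : ∀ a ∈ A, ∀ x : N, ⁅x, a⁆ = 0 := by
    intro a ha x
    have h1 : ⁅x, a⁆ ∈ A := A.lie_mem ha
    have h2 : ⁅a, x⁆ ∈ A := by rw [← lie_skew]; exact A.neg_mem h1
    have h3 := hQv a x
    rw [hab a ha _ (hQ1 x), hQ2 _ h2] at h3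
    rw [← lie_skew, ← h3, neg_zero]
  have hQbr : ∀ x y : N, Q ⁅x, y⁆ = 0 := fun x y => by
    rw [← hQv]; exact hcent _ (hQ1 y) x
  -- second step
  let l : G →ₗ[ℂ] (N × ℂ) →ₗ[ℂ] (N × ℂ) :=
    LinearMap.mk₂ ℂ (fun x w => (D.L x w.1, 0)) (by intros; simp) (by intros; simp)
      (by intros; simp) (by intros; simp)
  let v : N →ₗ[ℂ] (N × ℂ) →ₗ[ℂ] (N × ℂ) :=
    LinearMap.mk₂ ℂ (fun X w => (w.2 • Q X, 0)) (by intros; simp)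
      (by intro c x w; rw [map_smul, smul_comm w.2 c]; simp)
      (by intros; simp [add_smul]) (by intros; simp [mul_smul])
  have hlv : Compat D l v := by
    refine ⟨?_, ?_, ?_⟩
    · intro x y w
      simp [l, D.rep x y]
    · intro x y w
      simp [v, hQbr]
    · intro x y w
      simp [l, v, hQl]
  let M2 : Submodule ℂ (N × ℂ) := LinearMap.ker (LinearMap.snd ℂ N ℂ)
  obtain ⟨m, hm, -, h2⟩ := corN hlv M2 (by intro x m _; simp [M2, l]) (by intro x m _; simp [M2, v])
    (0, 1) (by intro x; simp [M2, l]) (by intro x; simp [M2, v])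
  have hm2 : m.2 = 0 := hm
  rw [eq_bot_iff]
  intro a ha
  have := congrArg Prod.fst (h2 a)
  simp only [v, LinearMap.mk₂_apply, Prod.snd_sub, hm2, sub_zero, one_smul, hQ2 a ha] at this
  simpa using this

theorem N_killing [Module.Finite ℂ G] [Module.Finite ℂ N] [LieAlgebra.IsKilling ℂ G]
    (D : PLData G N) : LieAlgebra.IsKilling ℂ N := by
  constructor
  set K := LieIdeal.killingCompl ℂ N ⊤ with hK
  have hKL : ∀ x, ∀ a ∈ K, D.L x a ∈ K := by
    intro x a ha
    rw [hK, LieIdeal.mem_killingCompl] at ha ⊢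
    intro y _
    have := D_killing D x y a
    rw [ha _ (LieSubmodule.mem_top _)] at this
    exact (neg_eq_zero.mp this.symm)
  have hsol : LieAlgebra.IsSolvable K :=
    (LieAlgebra.LieIdeal.solvable_iff_le_radical ℂ N K).mpr
      (LieAlgebra.killingCompl_top_le_radical ℂ N)
  have hDL : ∀ k, ∀ x, ∀ a ∈ LieAlgebra.derivedSeriesOfIdeal ℂ N k K,
      D.L x a ∈ LieAlgebra.derivedSeriesOfIdeal ℂ N k K := by
    intro k
    induction k with
    | zero => exact hKL
    | succ k ih =>
      intro x a ha
      rw [LieAlgebra.derivedSeriesOfIdeal_succ] at ha ⊢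
      set J := LieAlgebra.derivedSeriesOfIdeal ℂ N k K
      rw [← LieSubmodule.mem_toSubmodule, LieSubmodule.lieIdeal_oper_eq_linear_span'] at ha
      have : Submodule.span ℂ {x | ∃ y ∈ J, ∃ z ∈ J, ⁅y, z⁆ = x} ≤
          (⁅J, J⁆ : LieIdeal ℂ N).toSubmodule.comap (D.L x) := by
        rw [Submodule.span_le]
        rintro _ ⟨y, hy, z, hz, rfl⟩
        change D.L x ⁅y, z⁆ ∈ (⁅J, J⁆ : LieIdeal ℂ N)
        rw [D.der]
        exact add_mem (LieSubmodule.lie_mem_lie (ih x y hy) hz)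
          (LieSubmodule.lie_mem_lie hy (ih x z hz))
      exact this ha
  have hstep : ∀ k, LieAlgebra.derivedSeriesOfIdeal ℂ N (k + 1) K = ⊥ →
      LieAlgebra.derivedSeriesOfIdeal ℂ N k K = ⊥ := by
    intro k hk
    apply ideal_central D _ (hDL k)
    intro a ha b hb
    rw [LieAlgebra.derivedSeriesOfIdeal_succ] at hk
    have := LieSubmodule.lie_mem_lie ha hb
    rw [hk] at this
    simpa using this
  obtain ⟨k, hk⟩ := (LieAlgebra.isSolvable_iff ℂ K).mp hsol
  rw [LieIdeal.derivedSeries_eq_bot_iff] at hk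
  induction k with
  | zero => exact hk
  | succ k ih => exact ih (hstep k hk)

end PostLie

namespace PostLie
open Module

variable {G N : Type*} [LieRing G] [LieAlgebra ℂ G] [LieRing N] [LieAlgebra ℂ N]

lemma eq_of_lie_eq [Module.Finite ℂ N] [LieAlgebra.IsKilling ℂ N] (a b : N)
    (h : ∀ y : N, ⁅a, y⁆ = ⁅b, y⁆) : a = b := by
  rw [← sub_eq_zero]
  have : a - b ∈ LieAlgebra.center ℂ N := by
    rw [LieModule.mem_maxTrivSubmodule]
    intro y
    rw [← lie_skew, sub_lie, h, sub_self, neg_zero]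
  rwa [LieAlgebra.center_eq_bot] at this

theorem exists_homs [Module.Finite ℂ N] [LieAlgebra.IsKilling ℂ N] (D : PLData G N) :
    ∃ φ ψ : G →ₗ⁅ℂ⁆ N, ∀ x, ψ x - φ x = D.e x := by
  have hex : ∀ x, ∃ a : N, ∀ Y, ⁅a, Y⁆ = D.L x Y := by
    intro x
    obtain ⟨a, ha⟩ := LieDerivation.IsKilling.exists_eq_ad
      (R := ℂ) (L := N) (⟨D.L x, fun Y Z => by
        rw [D.der, ← lie_skew Z]; abel⟩ : LieDerivation ℂ N N)
    refine ⟨a, fun Y => ?_⟩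
    have := LieDerivation.congr_fun ha Y
    simpa using this
  choose f hf using hex
  let φ : G →ₗ⁅ℂ⁆ N :=
    { toFun := f
      map_add' := fun x y => eq_of_lie_eq _ _ fun Y => by simp [hf]
      map_smul' := fun t x => eq_of_lie_eq _ _ fun Y => by simp [hf]
      map_lie' := fun {x y} => eq_of_lie_eq _ _ fun Y => by
        rw [hf, D.rep, lie_lie, hf, hf, hf, hf] }
  have hφ : ∀ x Y, ⁅φ x, Y⁆ = D.L x Y := hf
  let ψ : G →ₗ⁅ℂ⁆ N :=
    { (φ : G →ₗ[ℂ] N) + D.e.toLinearMap with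
      map_lie' := fun {x y} => by
        change φ ⁅x, y⁆ + D.e ⁅x, y⁆ = ⁅φ x + D.e x, φ y + D.e y⁆
        have h1 := D.ax1 x y
        have h5 : D.e ⁅x, y⁆ = D.L x (D.e y) - D.L y (D.e x) + ⁅D.e x, D.e y⁆ := by
          rw [h1]; abel
        rw [h5, LieHom.map_lie, add_lie, lie_add, lie_add, hφ x (D.e y), ← lie_skew (D.e x) (φ y),
          hφ y]
        abel }
  refine ⟨φ, ψ, fun x => ?_⟩
  change φ x + D.e x - φ x = D.e x
  abel

/-- The reduction of the main theorem to pairs of homomorphisms. -/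
theorem reduction [Module.Finite ℂ G] [LieAlgebra.HasTrivialRadical ℂ G]
    (e : G ≃ₗ[ℂ] N)
    (p : G →ₗ[ℂ] G →ₗ[ℂ] G)
    (hax1 : ∀ x y : G, p x y - p y x = ⁅x, y⁆ - e.symm ⁅e x, e y⁆)
    (hax2 : ∀ x y z : G, p ⁅x, y⁆ z = p x (p y z) - p y (p x z))
    (hax3 : ∀ x y z : G,
      p x (e.symm ⁅e y, e z⁆) = e.symm ⁅e (p x y), e z⁆ + e.symm ⁅e y, e (p x z)⁆) :
    LieAlgebra.IsKilling ℂ N ∧ ∃ φ ψ : G →ₗ⁅ℂ⁆ N, ∀ x, ψ x - φ x = e x := by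
  have : Module.Finite ℂ N := Module.Finite.equiv e
  have : LieAlgebra.IsKilling ℂ G := inferInstance
  let D : PLData G N :=
    { e := e
      L := LinearMap.mk₂ ℂ (fun x Y => e (p x (e.symm Y))) (by intros; simp) (by intros; simp)
        (by intros; simp) (by intros; simp)
      ax1 := fun x y => by
        simp only [LinearMap.mk₂_apply, LinearEquiv.symm_apply_apply, ← map_sub, hax1]
        simp
      rep := fun x y v => by simp [hax2]
      der := fun x Y Z => by
        obtain ⟨y, rfl⟩ := e.surjective Y
        obtain ⟨z, rfl⟩ := e.surjective Z
        simp [hax3] }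
  have hK := N_killing D
  exact ⟨hK, exists_homs D⟩

end PostLie

namespace PostLie
open Module

/-- A bare-bones Lie-Rinehart structure. -/
structure LR (A X : Type*) [CommRing A] [Algebra ℂ A] [AddCommGroup X] [Module A X] where
  rho : X →ₗ[A] Derivation ℂ A A
  br : X → X → X
  br_add : ∀ x y z, br x (y + z) = br x y + br x z
  br_smul : ∀ x (f : A) y, br x (f • y) = f • br x y + rho x f • y
  br_skew : ∀ x y, br x y = - br y x

namespace LR
variable {A X : Type*} [CommRing A] [Algebra ℂ A] [AddCommGroup X] [Module A X] (S : LR A X)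

lemma add_br (x y z : X) : S.br (x + y) z = S.br x z + S.br y z := by
  rw [S.br_skew, S.br_add, S.br_skew x, S.br_skew y]; abel

lemma smul_br (f : A) (x z : X) : S.br (f • x) z = f • S.br x z - S.rho z f • x := by
  rw [S.br_skew, S.br_smul, S.br_skew x z]; module

/-- Alternating trilinear forms. -/
def Alt (z : X →ₗ[A] X →ₗ[A] X →ₗ[A] A) : Prop :=
  (∀ a b c, z a b c = - z b a c) ∧ (∀ a b c, z a b c = - z a c b)

/-- exterior differential of a 3-form -/
def d3 (z : X →ₗ[A] X →ₗ[A] X →ₗ[A] A) (a b c e : X) : A :=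
  S.rho a (z b c e) - (S.rho b (z a c e) + S.rho c (z a e b) + S.rho e (z a b c))
  - z (S.br a b) c e - z b (S.br a c) e - z b c (S.br a e)
  + (z a (S.br b c) e + z a (S.br c e) b + z a (S.br e b) c)

/-- Lie derivative of a 3-form -/
def lieD (z : X →ₗ[A] X →ₗ[A] X →ₗ[A] A) (a b c e : X) : A :=
  S.rho a (z b c e) - z (S.br a b) c e - z b (S.br a c) e - z b c (S.br a e)

variable {S} {z : X →ₗ[A] X →ₗ[A] X →ₗ[A] A}

lemma d3_cyc (hz : Alt z) (a b c e : X) : S.d3 z a b c e = S.d3 z a c e b := by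
  unfold d3
  have h1 : z b c e = z c e b := by rw [hz.1 b c, hz.2 c b, neg_neg]
  have h2 : z (S.br a b) c e = z c e (S.br a b) := by rw [hz.1 _ c, hz.2 c, neg_neg]
  have h3 : z b (S.br a c) e = z (S.br a c) e b := by rw [hz.1 b, hz.2 _ b, neg_neg]
  have h4 : z b c (S.br a e) = z c (S.br a e) b := by rw [hz.1 b, hz.2 _ b, neg_neg]
  rw [h1, h2, h3, h4]
  ring

lemma d3_add1 (a a' b c e : X) : S.d3 z (a + a') b c e = S.d3 z a b c e + S.d3 z a' b c e := by
  unfold d3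
  simp only [add_br, map_add, LinearMap.add_apply, Derivation.add_apply]
  ring

lemma d3_smul1 (hz : Alt z) (f : A) (a b c e : X) : S.d3 z (f • a) b c e = f * S.d3 z a b c e := by
  unfold d3
  simp only [smul_br, map_sub, map_smul, LinearMap.smul_apply, LinearMap.sub_apply,
    Derivation.smul_apply, smul_eq_mul, Derivation.leibniz]
  have h2 : z b a e = - z a b e := hz.1 _ _ _
  have h3 : z b c a = z a b c := by rw [hz.2 b c, hz.1 b a, neg_neg]
  rw [h2, h3, hz.2 a e b]
  ring

lemma d3_add2 (a b b' c e : X) : S.d3 z a (b + b') c e = S.d3 z a b c e + S.d3 z a b' c e := by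
  unfold d3
  simp only [add_br, br_add, map_add, LinearMap.add_apply, Derivation.add_apply]
  ring

lemma d3_smul2 (hz : Alt z) (f : A) (a b c e : X) : S.d3 z a (f • b) c e = f * S.d3 z a b c e := by
  unfold d3
  simp only [smul_br, br_smul, map_sub, map_add, map_smul, LinearMap.smul_apply,
    LinearMap.sub_apply, LinearMap.add_apply,
    Derivation.smul_apply, smul_eq_mul, Derivation.leibniz]
  rw [hz.2 a e b]
  ring

lemma d3_zero1 (b c e : X) : S.d3 z 0 b c e = 0 := by
  have := S.d3_add1 (z := z) 0 0 b c e
  simpa using this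

lemma d3_zero2 (a c e : X) : S.d3 z a 0 c e = 0 := by
  have := S.d3_add2 (z := z) a 0 0 c e
  simpa using this

lemma d3_eq_zero (hz : Alt z) (T : Set X) (hT : Submodule.span A T = ⊤)
    (h : ∀ a ∈ T, ∀ b ∈ T, ∀ c ∈ T, ∀ e ∈ T, S.d3 z a b c e = 0) (a b c e : X) :
    S.d3 z a b c e = 0 := by
  have h1 : ∀ a, ∀ b ∈ T, ∀ c ∈ T, ∀ e ∈ T, S.d3 z a b c e = 0 := by
    intro a b hb c hc e he
    have ha : a ∈ Submodule.span A T := hT ▸ Submodule.mem_top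
    induction ha using Submodule.span_induction with
    | mem a ha => exact h a ha b hb c hc e he
    | zero => exact d3_zero1 b c e
    | add x y _ _ hx hy => rw [d3_add1, hx, hy, add_zero]
    | smul f x _ hx => rw [d3_smul1 hz, hx, mul_zero]
  have key : ∀ (P Q : X → Prop), (∀ a b, ∀ c, P c → ∀ e, Q e → b ∈ T → S.d3 z a b c e = 0) →
      ∀ a b, ∀ c, P c → ∀ e, Q e → S.d3 z a b c e = 0 := by
    intro P Q h a b c hc e he
    have hb : b ∈ Submodule.span A T := hT ▸ Submodule.mem_top
    induction hb using Submodule.span_induction with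
    | mem b hb => exact h a b c hc e he hb
    | zero => exact d3_zero2 a c e
    | add x y _ _ hx hy => rw [d3_add2, hx, hy, add_zero]
    | smul f x _ hx => rw [d3_smul2 hz, hx, mul_zero]
  have h2 := key (· ∈ T) (· ∈ T) (fun a b c hc e he hb => h1 a b hb c hc e he)
  have h3 := key (· ∈ T) (fun _ => True) (fun a b c hc e _ hb => by
    rw [d3_cyc hz, d3_cyc hz]; exact h2 a e b hb c hc)
  have h4 := key (fun _ => True) (fun _ => True) (fun a b c _ e _ hb => by
    rw [d3_cyc hz, d3_cyc hz]; exact h3 a e b hb c trivial)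
  exact h4 a b c trivial e trivial

lemma lieD_cyc (hz : Alt z) (a b c e : X) : S.lieD z a b c e = S.lieD z a c e b := by
  unfold lieD
  have h1 : z b c e = z c e b := by rw [hz.1 b c, hz.2 c b, neg_neg]
  have h2 : z (S.br a b) c e = z c e (S.br a b) := by rw [hz.1 _ c, hz.2 c, neg_neg]
  have h3 : z b (S.br a c) e = z (S.br a c) e b := by rw [hz.1 b, hz.2 _ b, neg_neg]
  have h4 : z b c (S.br a e) = z c (S.br a e) b := by rw [hz.1 b, hz.2 _ b, neg_neg]
  rw [h1, h2, h3, h4]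
  ring

/-- If the Lie derivative agrees with a trilinear alternating form on a generating set,
they agree everywhere. -/
lemma lieD_eq (hz : Alt z) (T : Set X) (hT : Submodule.span A T = ⊤) (a : X)
    (w : X →ₗ[A] X →ₗ[A] X →ₗ[A] A) (hw : Alt w)
    (h : ∀ b ∈ T, ∀ c ∈ T, ∀ e ∈ T, S.lieD z a b c e = w b c e) (b c e : X) :
    S.lieD z a b c e = w b c e := by
  have hadd : ∀ b b' c e, S.lieD z a (b + b') c e = S.lieD z a b c e + S.lieD z a b' c e := by
    intros; unfold lieD
    simp only [br_add, map_add, LinearMap.add_apply]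
    ring
  have hsmul : ∀ (f : A) b c e, S.lieD z a (f • b) c e = f * S.lieD z a b c e := by
    intros; unfold lieD
    simp only [br_smul, map_add, map_smul, LinearMap.smul_apply,
      LinearMap.add_apply, smul_eq_mul, Derivation.leibniz]
    ring
  have hzero : ∀ c e, S.lieD z a 0 c e = 0 := by
    intro c e
    simpa using hadd 0 0 c e
  have hwc : ∀ b c e, w b c e = w c e b := fun b c e => by rw [hw.1 b c, hw.2 c b, neg_neg]
  have key : ∀ (P Q : X → Prop), (∀ b, ∀ c, P c → ∀ e, Q e → b ∈ T → S.lieD z a b c e = w b c e) →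
      ∀ b, ∀ c, P c → ∀ e, Q e → S.lieD z a b c e = w b c e := by
    intro P Q h b c hc e he
    have hb : b ∈ Submodule.span A T := hT ▸ Submodule.mem_top
    induction hb using Submodule.span_induction with
    | mem b hb => exact h b c hc e he hb
    | zero => simp [hzero]
    | add x y _ _ hx hy => rw [hadd, hx, hy]; simp
    | smul f x _ hx => rw [hsmul, hx]; simp
  have h2 := key (· ∈ T) (· ∈ T) (fun b c hc e he hb => h b hb c hc e he)
  have h3 := key (· ∈ T) (fun _ => True) (fun b c hc e _ hb => by
    rw [lieD_cyc hz, lieD_cyc hz, hwc, hwc]; exact h2 e b hb c hc)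
  have h4 := key (fun _ => True) (fun _ => True) (fun b c _ e _ hb => by
    rw [lieD_cyc hz, lieD_cyc hz, hwc, hwc]; exact h3 e b hb c trivial)
  exact h4 b c trivial e trivial

end LR
end PostLie

namespace PostLie
open Module TensorProduct

/-- An algebraic model for the ring of functions on the adjoint group of `N`. -/
structure Model (A N : Type*) [CommRing A] [Algebra ℂ A] [LieRing N] [LieAlgebra ℂ N] where
  D : N →ₗ[ℂ] Derivation ℂ A A
  D_lie : ∀ (a b : N) (f : A), D ⁅a, b⁆ f = D a (D b f) - D b (D a f)
  θ : N →ₗ[ℂ] A ⊗[ℂ] N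
  θ_lie : ∀ u v : N, θ ⁅u, v⁆ = ⁅θ u, θ v⁆
  θ_der : ∀ a u : N, (D a).toLinearMap.rTensor N (θ u) = - ⁅(1 : A) ⊗ₜ[ℂ] a, θ u⁆
  ε : A →ₐ[ℂ] ℂ
  θ_one : ∀ u : N, TensorProduct.lid ℂ N (ε.toLinearMap.rTensor N (θ u)) = u
  sep : ∀ f : A, (∀ l : List N, ε (l.foldr (fun a f => D a f) f) = 0) → f = 0
  gen : Algebra.adjoin ℂ {f : A | ∃ (ξ : Module.Dual ℂ N) (u : N),
    f = ((Algebra.linearMap ℂ A).comp ξ).liftBaseChange A (θ u)} = ⊤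

namespace Model
variable {A N : Type*} [CommRing A] [Algebra ℂ A] [LieRing N] [LieAlgebra ℂ N] (M : Model A N)

lemma foldr_zero (l : List N) : l.foldr (fun a f => M.D a f) (0 : A) = 0 := by
  induction l with
  | nil => rfl
  | cons a l ih => simp [ih]

lemma const (f : A) (h : ∀ a, M.D a f = 0) : f = algebraMap ℂ A (M.ε f) := by
  rw [← sub_eq_zero]
  apply M.sep
  have h0 : ∀ a, M.D a (f - algebraMap ℂ A (M.ε f)) = 0 := by
    intro a; simp [h]
  intro l
  induction l using List.reverseRecOn with
  | nil => simp
  | append_singleton l a _ =>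
    simp only [List.foldr_append, List.foldr_cons, List.foldr_nil, h0]
    rw [M.foldr_zero, map_zero]

lemma foldr_add (l : List N) (f g : A) : l.foldr (fun a f => M.D a f) (f + g)
    = l.foldr (fun a f => M.D a f) f + l.foldr (fun a f => M.D a f) g := by
  induction l with
  | nil => rfl
  | cons a l ih => simp [ih]

lemma loc (f g : A) (hf : M.ε f ≠ 0) (h : f * g = 0) : g = 0 := by
  have key : ∀ n : ℕ, ∀ f g : A, M.ε f ≠ 0 → (∀ l : List N, l.length ≤ n →
      M.ε (l.foldr (fun a f => M.D a f) (f * g)) = 0) →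
      ∀ l : List N, l.length ≤ n → M.ε (l.foldr (fun a f => M.D a f) g) = 0 := by
    intro n
    induction n with
    | zero =>
      intro f g hf h l hl
      have := h [] (by simp)
      have hl : l = [] := by simpa using hl
      subst hl
      simpa [hf] using this
    | succ n ih =>
      intro f g hf h l hl
      rcases List.eq_nil_or_concat l with rfl | ⟨l, a, rfl⟩
      · exact ih f g hf (fun l hl => h l (by omega)) [] (by simp)
      simp only [List.concat_eq_append, List.foldr_append, List.foldr_cons, List.foldr_nil]
      simp only [List.concat_eq_append, List.length_append, List.length_cons, List.length_nil,
        zero_add, add_le_add_iff_right] at hl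
      refine ih f (M.D a g) hf ?_ l hl
      intro l hl
      have h1 := h (l ++ [a]) (by simpa using hl)
      simp only [List.foldr_append, List.foldr_cons, List.foldr_nil, Derivation.leibniz,
        smul_eq_mul, foldr_add, map_add] at h1
      have h2 : ∀ l : List N, l.length ≤ n →
          M.ε (l.foldr (fun a f => M.D a f) g) = 0 :=
        ih f g hf (fun l hl => h l (by omega))
      have h3 : ∀ l : List N, ∀ g f : A, (∀ l' : List N, l'.length ≤ l.length →
          M.ε (l'.foldr (fun a f => M.D a f) g) = 0) →
          M.ε (l.foldr (fun a f => M.D a f) (g * f)) = 0 := by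
        intro l
        induction l using List.reverseRecOn with
        | nil => intro g f h'; have := h' [] (by simp); simp at this; simp [this]
        | append_singleton l b ihl =>
          intro g f h'
          simp only [List.foldr_append, List.foldr_cons, List.foldr_nil, Derivation.leibniz,
            smul_eq_mul, foldr_add, map_add]
          rw [ihl g _ (fun l' hl' => h' l' (by simp; omega)), mul_comm f, ihl (M.D b g) f, add_zero]
          intro l' hl'
          have := h' (l' ++ [b]) (by simpa using hl')
          simpa using this
      rw [h3 l g _ (fun l' hl' => h2 l' (by omega)), add_zero] at h1
      exact h1
  apply M.sep
  intro l
  refine key l.length f g hf ?_ l le_rfl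
  intro l _
  rw [h]
  rw [M.foldr_zero, map_zero]

/-- anchor -/
noncomputable def rho : A ⊗[ℂ] N →ₗ[A] Derivation ℂ A A := M.D.liftBaseChange A

@[simp] lemma rho_tmul (f : A) (a : N) : M.rho (f ⊗ₜ a) = f • M.D a := by
  simp [rho]

/-- the derivative of vector valued functions along constant fields -/
noncomputable def dN : N →ₗ[ℂ] (A ⊗[ℂ] N →ₗ[ℂ] A ⊗[ℂ] N) where
  toFun a := (M.D a).toLinearMap.rTensor N
  map_add' a b := by ext; simp
  map_smul' a b := by ext; simp [TensorProduct.smul_tmul']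

/-- the derivative of vector valued functions -/
noncomputable def nab : A ⊗[ℂ] N →ₗ[A] (A ⊗[ℂ] N →ₗ[ℂ] A ⊗[ℂ] N) := M.dN.liftBaseChange A

@[simp] lemma nab_tmul (f g : A) (a u : N) :
    M.nab (f ⊗ₜ a) (g ⊗ₜ u) = (f * M.D a g) ⊗ₜ u := by
  simp [nab, dN, TensorProduct.smul_tmul']

lemma nab_smul (X : A ⊗[ℂ] N) (f : A) (Y : A ⊗[ℂ] N) :
    M.nab X (f • Y) = f • M.nab X Y + M.rho X f • Y := by
  induction X with
  | zero => simp
  | add X X' h h' =>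
    simp only [map_add, LinearMap.add_apply, Derivation.add_apply, h, h']; module
  | tmul s a =>
    induction Y with
    | zero => simp
    | add Y Y' h h' => simp only [smul_add, map_add, h, h']; abel
    | tmul t b =>
      simp only [TensorProduct.smul_tmul', smul_eq_mul, nab_tmul, Derivation.leibniz, rho_tmul,
        Derivation.smul_apply, ← TensorProduct.add_tmul]
      congr 1; ring

lemma nab_lie (X Y Z : A ⊗[ℂ] N) :
    M.nab X ⁅Y, Z⁆ = ⁅M.nab X Y, Z⁆ + ⁅Y, M.nab X Z⁆ := by
  induction X with
  | zero => simp
  | add X X' h h' => simp only [map_add, LinearMap.add_apply, h, h', add_lie, lie_add]; abel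
  | tmul s a =>
    induction Y with
    | zero => simp
    | add Y Y' h h' => simp only [add_lie, map_add, h, h']; abel
    | tmul t b =>
      induction Z with
      | zero => simp
      | add Z Z' h h' => simp only [lie_add, map_add, h, h']; abel
      | tmul r c =>
        simp only [LieAlgebra.ExtendScalars.bracket_tmul, nab_tmul, Derivation.leibniz,
          smul_eq_mul, ← TensorProduct.add_tmul]
        congr 1; ring

/-- The Lie-Rinehart structure on vector fields. -/
noncomputable def lr : LR A (A ⊗[ℂ] N) where
  rho := M.rho
  br X Y := M.nab X Y - M.nab Y X + ⁅X, Y⁆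
  br_add X Y Z := by simp only [map_add, LinearMap.add_apply, lie_add]; abel
  br_smul X f Y := by
    simp only [nab_smul, map_smul, LinearMap.smul_apply, lie_smul]; module
  br_skew X Y := by rw [← lie_skew]; abel

@[simp] lemma lr_rho : M.lr.rho = M.rho := rfl
lemma lr_br (X Y : A ⊗[ℂ] N) : M.lr.br X Y = M.nab X Y - M.nab Y X + ⁅X, Y⁆ := rfl

lemma br_const (a b : N) : M.lr.br (1 ⊗ₜ a) (1 ⊗ₜ b) = 1 ⊗ₜ ⁅a, b⁆ := by
  simp [lr_br]

lemma rho_br (X Y : A ⊗[ℂ] N) (f : A) :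
    M.rho (M.lr.br X Y) f = M.rho X (M.rho Y f) - M.rho Y (M.rho X f) := by
  have h1 : ∀ a b : N, ∀ f, M.rho (M.lr.br (1 ⊗ₜ a) (1 ⊗ₜ b)) f =
      M.rho (1 ⊗ₜ a) (M.rho (1 ⊗ₜ b) f) - M.rho (1 ⊗ₜ b) (M.rho (1 ⊗ₜ a) f) := by
    intro a b f; simp [br_const, M.D_lie]
  induction X with
  | zero => simp [lr_br]
  | add X X' h h' =>
    rw [LR.add_br]; simp only [map_add, Derivation.add_apply, h, h']; abel
  | tmul s a =>
    induction Y with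
    | zero => simp [lr_br]
    | add Y Y' h h' =>
      rw [LR.br_add]; simp only [map_add, Derivation.add_apply, h, h']; abel
    | tmul t b =>
      have e1 : s ⊗ₜ[ℂ] a = s • ((1 : A) ⊗ₜ[ℂ] a) := by simp [TensorProduct.smul_tmul']
      have e2 : t ⊗ₜ[ℂ] b = t • ((1 : A) ⊗ₜ[ℂ] b) := by simp [TensorProduct.smul_tmul']
      rw [e1, e2, LR.smul_br, LR.br_smul]
      have := h1 a b f
      simp only [map_sub, map_add, map_smul, lr_rho, Derivation.sub_apply, Derivation.add_apply,
        Derivation.smul_apply, smul_eq_mul, Derivation.leibniz, this]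
      ring

lemma nab_const (X : A ⊗[ℂ] N) (u : N) : M.nab X (1 ⊗ₜ u) = 0 := by
  induction X with
  | zero => simp
  | add X X' h h' => simp [h, h']
  | tmul s a => simp

lemma nab_θ (X : A ⊗[ℂ] N) (u : N) : M.nab X (M.θ u) = - ⁅X, M.θ u⁆ := by
  induction X with
  | zero => simp
  | add X X' h h' => simp only [map_add, LinearMap.add_apply, h, h', add_lie]; abel
  | tmul s a =>
    have e1 : s ⊗ₜ[ℂ] a = s • ((1 : A) ⊗ₜ[ℂ] a) := by simp [TensorProduct.smul_tmul']
    rw [e1, map_smul, LinearMap.smul_apply, smul_lie, ← smul_neg]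
    congr 1
    rw [← M.θ_der]
    simp [nab, dN]

lemma br_θ_const (a u : N) : M.lr.br (M.θ a) (1 ⊗ₜ u) = 0 := by
  rw [lr_br, nab_const, nab_θ, ← lie_skew]; abel

lemma br_θ (a b : N) : M.lr.br (M.θ a) (M.θ b) = - M.θ ⁅a, b⁆ := by
  rw [lr_br, nab_θ, nab_θ, M.θ_lie, ← lie_skew (M.θ b)]; abel

/-- coordinates -/
noncomputable def cd (A : Type*) [CommRing A] [Algebra ℂ A] {V : Type*} [AddCommGroup V]
    [Module ℂ V] (ξ : Module.Dual ℂ V) : A ⊗[ℂ] V →ₗ[A] A :=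
  ((Algebra.linearMap ℂ A).comp ξ).liftBaseChange A

@[simp] lemma cd_tmul {V : Type*} [AddCommGroup V] [Module ℂ V] (ξ : Module.Dual ℂ V)
    (f : A) (v : V) : cd A ξ (f ⊗ₜ v) = f * algebraMap ℂ A (ξ v) := by
  simp [cd]

lemma rho_cd (X Y : A ⊗[ℂ] N) (ξ : Module.Dual ℂ N) :
    M.rho X (cd A ξ Y) = cd A ξ (M.nab X Y) := by
  induction X with
  | zero => simp
  | add X X' h h' => simp only [map_add, LinearMap.add_apply, Derivation.add_apply, h, h']
  | tmul s a =>
    induction Y with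
    | zero => simp
    | add Y Y' h h' => simp only [map_add, h, h']
    | tmul t b => simp; ring

end Model

/-- local finiteness for families of derivations -/
lemma loc_fin {A g : Type*} [CommRing A] [Algebra ℂ A] (R : g → Derivation ℂ A A)
    (V : Submodule ℂ A) [Module.Finite ℂ V] (hV : ∀ x, ∀ v ∈ V, R x v ∈ V)
    (hgen : Algebra.adjoin ℂ (V : Set A) = ⊤) (f : A) :
    ∃ U : Submodule ℂ A, Module.Finite ℂ U ∧ (∀ x, ∀ v ∈ U, R x v ∈ U) ∧ f ∈ U := by
  have hf : f ∈ Algebra.adjoin ℂ (V : Set A) := hgen ▸ Algebra.mem_top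
  induction hf using Algebra.adjoin_induction with
  | mem x hx => exact ⟨V, inferInstance, hV, hx⟩
  | algebraMap r =>
    refine ⟨ℂ ∙ (1 : A), inferInstance, ?_, ?_⟩
    · intro x v hv
      obtain ⟨t, rfl⟩ := Submodule.mem_span_singleton.1 hv
      simp
    · rw [Submodule.mem_span_singleton]; exact ⟨r, by rw [Algebra.algebraMap_eq_smul_one]⟩
  | add x y _ _ hx hy =>
    obtain ⟨U, h1, h2, h3⟩ := hx
    obtain ⟨U', h1', h2', h3'⟩ := hy
    refine ⟨U ⊔ U', inferInstance, ?_, ?_⟩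
    · intro x v hv
      obtain ⟨a, ha, b, hb, rfl⟩ := Submodule.mem_sup.1 hv
      rw [map_add]
      exact Submodule.add_mem_sup (h2 x a ha) (h2' x b hb)
    · exact Submodule.add_mem_sup h3 h3'
  | mul x y _ _ hx hy =>
    obtain ⟨U, h1, h2, h3⟩ := hx
    obtain ⟨U', h1', h2', h3'⟩ := hy
    refine ⟨U * U', ?_, ?_, Submodule.mul_mem_mul h3 h3'⟩
    · exact Module.Finite.iff_fg.2
        ((Module.Finite.iff_fg.1 h1).mul (Module.Finite.iff_fg.1 h1'))
    · intro x v hv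
      induction hv using Submodule.mul_induction_on' with
      | mem_mul_mem a ha b hb =>
        rw [Derivation.leibniz, smul_eq_mul, smul_eq_mul, mul_comm b]
        exact add_mem (Submodule.mul_mem_mul ha (h2' x b hb)) (Submodule.mul_mem_mul (h2 x a ha) hb)
      | add a _ b _ ha hb => rw [map_add]; exact add_mem ha hb

end PostLie

namespace PostLie
open Module TensorProduct

/-- The ring hom to dual numbers attached to a derivation. -/
noncomputable def derHom {A : Type*} [CommRing A] [Algebra ℂ A] (d : Derivation ℂ A A) :
    A →+* DualNumber A where
  toFun f := TrivSqZeroExt.inl f + TrivSqZeroExt.inr (d f)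
  map_one' := by simp
  map_zero' := by simp
  map_add' f g := by ext <;> simp
  map_mul' f g := by
    ext
    · simp
    · simp; ring

lemma der_det {A ι : Type*} [CommRing A] [Algebra ℂ A] [Fintype ι] [DecidableEq ι]
    (d : Derivation ℂ A A) (m P Q : Matrix ι ι A) (hP : P.trace = 0) (hQ : Q.trace = 0)
    (h : ∀ i j, d (m i j) = (m * P - Q * m) i j) : d m.det = 0 := by
  let c : A →+* DualNumber A := TrivSqZeroExt.inlHom A A
  have hm : (derHom d).mapMatrix m =
      (1 + (DualNumber.eps : DualNumber A) • c.mapMatrix (-Q) : Matrix ι ι (DualNumber A))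
        * c.mapMatrix m
        * (1 + (DualNumber.eps : DualNumber A) • c.mapMatrix P : Matrix ι ι (DualNumber A)) := by
    have h1 : (derHom d).mapMatrix m = c.mapMatrix m + (DualNumber.eps : DualNumber A) • c.mapMatrix (m * P - Q * m) := by
      ext i j
      · simp [derHom, c]
      · simp only [RingHom.mapMatrix_apply, Matrix.map_apply, Matrix.add_apply, Matrix.smul_apply, ← h]
        simp [derHom, c]
    have he : (DualNumber.eps : DualNumber A) * DualNumber.eps = 0 := DualNumber.eps_mul_eps
    rw [h1, map_sub, map_mul, map_mul, map_neg]
    rw [add_mul, one_mul, mul_add, mul_one, mul_smul_comm, add_mul]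
    simp only [Matrix.smul_mul, Matrix.mul_smul, smul_smul, he, zero_smul, smul_neg, neg_mul,
      smul_sub, smul_add]
    simp
    abel
  have hdet : ∀ M : Matrix ι ι A, M.trace = 0 →
      (1 + (DualNumber.eps : DualNumber A) • c.mapMatrix M).det = 1 := by
    intro M hM
    rw [Matrix.det_one_add_smul]
    have : (c.mapMatrix M).trace = c M.trace := by
      simp [Matrix.trace]
    rw [this, hM, map_zero, pow_two, DualNumber.eps_mul_eps]
    simp
  have h2 := congrArg Matrix.det hm
  rw [Matrix.det_mul, Matrix.det_mul, hdet _ (by simp [hQ]), hdet _ hP, one_mul, mul_one,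
    ← RingHom.map_det, ← RingHom.map_det] at h2
  have h3 := congrArg TrivSqZeroExt.snd h2
  simpa [derHom, c] using h3

namespace Model
variable {A N : Type*} [CommRing A] [Algebra ℂ A] [LieRing N] [LieAlgebra ℂ N] (M : Model A N)

lemma bijective_of_flow [Module.Finite ℂ N] (F : N →ₗ[ℂ] A ⊗[ℂ] N)
    (hε : ∀ u, TensorProduct.lid ℂ N (M.ε.toLinearMap.rTensor N (F u)) = u)
    (hF : ∀ n, ∃ P Q : N →ₗ[ℂ] N, LinearMap.trace ℂ N P = 0 ∧ LinearMap.trace ℂ N Q = 0 ∧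
      ∀ u, M.nab (F n) (F u) = F (P u) - Q.baseChange A (F u)) :
    Function.Bijective (F.liftBaseChange A) := by
  classical
  let b := Module.finBasis ℂ N
  let bA := Algebra.TensorProduct.basis A b
  set FA := F.liftBaseChange A with hFA
  have hcd : ∀ i Y, bA.repr Y i = cd A (b.coord i) Y := by
    intro i Y
    induction Y with
    | zero => simp
    | add Y Y' h h' => simp [h, h']
    | tmul t v => simp [bA, Algebra.smul_def, mul_comm]
  let m := LinearMap.toMatrix bA bA FA
  have hm : ∀ i j, m i j = cd A (b.coord i) (F (b j)) := by
    intro i j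
    rw [← hcd]
    simp [m, LinearMap.toMatrix_apply, FA, bA]
  have hQ : ∀ (Q : N →ₗ[ℂ] N) i Y, cd A (b.coord i) (Q.baseChange A Y) =
      ∑ k, algebraMap ℂ A (LinearMap.toMatrix b b Q i k) * cd A (b.coord k) Y := by
    intro Q i Y
    induction Y with
    | zero => simp
    | add Y Y' h h' => simp [h, h', mul_add, Finset.sum_add_distrib]
    | tmul t v =>
      have : b.coord i (Q v) = ∑ k, LinearMap.toMatrix b b Q i k * b.coord k v := by
        have := congrFun (LinearMap.toMatrix_mulVec_repr b b Q v) i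
        rw [Basis.coord_apply, ← this]
        rfl
      rw [LinearMap.baseChange_tmul, cd_tmul, this]
      simp only [map_sum, map_mul, Finset.mul_sum, cd_tmul]
      refine Finset.sum_congr rfl fun k _ => by ring
  have hdet0 : ∀ n, M.rho (F n) m.det = 0 := by
    intro n
    obtain ⟨P, Q, hP, hQ', h⟩ := hF n
    refine der_det (M.rho (F n)) m ((algebraMap ℂ A).mapMatrix (LinearMap.toMatrix b b P))
      ((algebraMap ℂ A).mapMatrix (LinearMap.toMatrix b b Q)) ?_ ?_ ?_
    · rw [LinearMap.trace_eq_matrix_trace ℂ b] at hP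
      have := congrArg (algebraMap ℂ A) hP
      simpa [Matrix.trace] using this
    · rw [LinearMap.trace_eq_matrix_trace ℂ b] at hQ'
      have := congrArg (algebraMap ℂ A) hQ'
      simpa [Matrix.trace] using this
    · intro i j
      rw [hm, rho_cd, h, map_sub, hQ, Matrix.sub_apply, Matrix.mul_apply, Matrix.mul_apply]
      congr 1
      · have : P (b j) = ∑ k, LinearMap.toMatrix b b P k j • b k := by
          rw [← b.sum_repr (P (b j))]
          simp [LinearMap.toMatrix_apply]
        rw [this]
        simp only [map_sum, map_smul, hm, RingHom.mapMatrix_apply, Matrix.map_apply]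
        refine Finset.sum_congr rfl fun k _ => ?_
        rw [LinearMap.map_smul_of_tower, Algebra.smul_def, mul_comm]
      · simp [hm]
  have hrange : ∀ Y, M.rho (FA Y) m.det = 0 := by
    intro Y
    induction Y with
    | zero => simp
    | add Y Y' h h' => simp [h, h']
    | tmul t v => simp [FA, hdet0]
  have hadj : ∀ Y, ∃ Y', FA Y' = m.det • Y := by
    intro Y
    refine ⟨Matrix.toLin bA bA m.adjugate Y, ?_⟩
    have h1 : FA = Matrix.toLin bA bA m := by simp [m]
    rw [h1, ← LinearMap.comp_apply, ← Matrix.toLin_mul, Matrix.mul_adjugate]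
    simp
  have hεm : M.ε m.det = 1 := by
    have h1 : M.ε m.det = (M.ε.toRingHom.mapMatrix m).det := by
      rw [← RingHom.map_det]; rfl
    have h2 : M.ε.toRingHom.mapMatrix m = 1 := by
      ext i j
      have h3 : ∀ Y, M.ε (cd A (b.coord i) Y) =
          b.coord i (TensorProduct.lid ℂ N (M.ε.toLinearMap.rTensor N Y)) := by
        intro Y
        induction Y with
        | zero => simp
        | add Y Y' h h' => simp only [map_add, h, h']
        | tmul t v => simp
      change M.ε (m i j) = _
      rw [hm, h3, hε]
      simp [Finsupp.single_apply, Matrix.one_apply, eq_comm]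
    rw [h1, h2, Matrix.det_one]
  have hc : ∀ a, M.D a m.det = 0 := by
    intro a
    obtain ⟨Y, hY⟩ := hadj (1 ⊗ₜ a)
    have h1 := hrange Y
    rw [hY] at h1
    refine M.loc m.det _ (by rw [hεm]; exact one_ne_zero) ?_
    simpa using h1
  have hone : m.det = 1 := by rw [M.const _ hc, hεm, map_one]
  have hu : IsUnit (LinearMap.det FA) := by
    rw [← LinearMap.det_toMatrix bA]
    change IsUnit m.det
    rw [hone]; exact isUnit_one
  have : IsUnit FA := LinearMap.isUnit_iff_isUnit_det _ |>.2 hu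
  exact (Module.End.isUnit_iff _).1 this

end Model
end PostLie

namespace PostLie
open Module TensorProduct

section construct
variable (N : Type*) [LieRing N] [LieAlgebra ℂ N] [Module.Finite ℂ N]

/-- index type of a basis -/
abbrev Ix := Fin (finrank ℂ N)
/-- coordinate ring of matrices -/
abbrev PX := MvPolynomial (Ix N × Ix N) ℂ

variable {N}

/-- matrix entries of ad -/
noncomputable def adm (a : N) (i k : Ix N) : ℂ := (finBasis ℂ N).coord i ⁅a, finBasis ℂ N k⁆

lemma adm_spec (a : N) (k : Ix N) : ⁅a, finBasis ℂ N k⁆ = ∑ i, adm a i k • finBasis ℂ N i :=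
  ((finBasis ℂ N).sum_repr _).symm

lemma adm_lie (a b : N) (i k : Ix N) :
    adm ⁅a, b⁆ i k = ∑ l, (adm a i l * adm b l k - adm b i l * adm a l k) := by
  rw [adm, lie_lie, adm_spec b, adm_spec a]
  simp only [lie_sum, lie_smul, map_sub, map_sum, map_smul, smul_eq_mul, Finset.sum_sub_distrib]
  congr 1 <;> exact Finset.sum_congr rfl fun l _ => mul_comm _ _

/-- right invariant derivations -/
noncomputable def D0 : N →ₗ[ℂ] Derivation ℂ (PX N) (PX N) where
  toFun a := MvPolynomial.mkDerivation ℂ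
    (fun p : Ix N × Ix N => - ∑ k, MvPolynomial.C (adm a p.1 k) * MvPolynomial.X (k, p.2))
  map_add' a b := by
    apply MvPolynomial.derivation_ext
    intro p
    simp [MvPolynomial.mkDerivation_X, adm, add_mul, Finset.sum_add_distrib]
    abel
  map_smul' t a := by
    apply MvPolynomial.derivation_ext
    intro p
    simp [MvPolynomial.mkDerivation_X, adm, Finset.smul_sum, MvPolynomial.smul_eq_C_mul, mul_assoc]

lemma D0_X (a : N) (i j : Ix N) : D0 a (MvPolynomial.X (i, j)) =
    - ∑ k, MvPolynomial.C (adm a i k) * MvPolynomial.X (k, j) :=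
  MvPolynomial.mkDerivation_X _ _ _

lemma D0_lie (a b : N) (f : PX N) : D0 ⁅a, b⁆ f = D0 a (D0 b f) - D0 b (D0 a f) := by
  have : D0 ⁅a, b⁆ = ⁅D0 a, D0 b⁆ := by
    apply MvPolynomial.derivation_ext
    rintro ⟨i, j⟩
    rw [Derivation.commutator_apply, D0_X, D0_X, D0_X]
    simp only [map_neg, map_sum, Derivation.leibniz, MvPolynomial.derivation_C, mul_zero, add_zero,
      D0_X, smul_eq_mul, adm_lie, map_sub, map_mul, sub_mul, Finset.sum_mul, Finset.sum_sub_distrib,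
      mul_neg, Finset.mul_sum, Finset.sum_neg_distrib]
    rw [Finset.sum_comm]
    nth_rewrite 2 [Finset.sum_comm]
    simp only [neg_neg, mul_assoc]
    rw [neg_sub]
  rw [this, Derivation.commutator_apply]

/-- evaluation at the identity -/
noncomputable def e0 : PX N →ₐ[ℂ] ℂ := MvPolynomial.aeval (fun p => if p.1 = p.2 then 1 else 0)

/-- iterated derivatives -/
noncomputable def fD (l : List N) (f : PX N) : PX N := l.foldr (fun a f => D0 a f) f

lemma fD_add (l : List N) (f g : PX N) : fD l (f + g) = fD l f + fD l g := by
  induction l with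
  | nil => rfl
  | cons a l ih => simp only [fD, List.foldr_cons] at ih ⊢; rw [ih, map_add]

lemma fD_append (l : List N) (a : N) (f : PX N) : fD (l ++ [a]) f = fD l (D0 a f) := by
  simp [fD]

/-- the vanishing ideal -/
noncomputable def I0 : Ideal (PX N) where
  carrier := {f | ∀ l : List N, e0 (fD l f) = 0}
  add_mem' := by intro f g hf hg l; rw [fD_add, map_add, hf, hg, add_zero]
  zero_mem' := by
    intro l
    have : fD l (0 : PX N) = 0 := by
      have := fD_add l (0 : PX N) 0
      simpa using this
    rw [this, map_zero]
  smul_mem' := by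
    intro c f hf l
    rw [smul_eq_mul]
    induction l using List.reverseRecOn generalizing c f with
    | nil => have := hf []; simp [fD] at this ⊢; simp [this]
    | append_singleton l a ih =>
      rw [fD_append, Derivation.leibniz, fD_add, map_add, smul_eq_mul, smul_eq_mul, mul_comm f,
        ih _ hf, ih, add_zero]
      intro l
      rw [← fD_append]; exact hf _

lemma mem_I0 (f : PX N) : f ∈ (I0 : Ideal (PX N)) ↔ ∀ l : List N, e0 (fD l f) = 0 := Iff.rfl

lemma D0_mem (a : N) {f : PX N} (hf : f ∈ (I0 : Ideal (PX N))) : D0 a f ∈ (I0 : Ideal (PX N)) := by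
  intro l
  rw [← fD_append]; exact hf _

variable (N) in
/-- the algebra -/
def AX := PX N ⧸ (I0 : Ideal (PX N))

noncomputable instance : CommRing (AX N) := inferInstanceAs (CommRing (PX N ⧸ (I0 : Ideal (PX N))))
noncomputable instance : Algebra ℂ (AX N) :=
  inferInstanceAs (Algebra ℂ (PX N ⧸ (I0 : Ideal (PX N))))

variable (N) in
/-- quotient map -/
noncomputable def mkX : PX N →ₐ[ℂ] AX N :=
  (Ideal.Quotient.mkₐ ℂ I0 : PX N →ₐ[ℂ] PX N ⧸ (I0 : Ideal (PX N)))

lemma mkX_surj : Function.Surjective (mkX N) := Ideal.Quotient.mk_surjective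

lemma mkX_eq (f g : PX N) : mkX N f = mkX N g ↔ f - g ∈ (I0 : Ideal (PX N)) :=
  Ideal.Quotient.eq

lemma mkX_D0 (a : N) {f g : PX N} (h : mkX N f = mkX N g) :
    mkX N (D0 a f) = mkX N (D0 a g) := by
  rw [mkX_eq] at h ⊢
  rw [← map_sub]
  exact D0_mem a h

/-- section of the quotient map -/
noncomputable def secX (f : AX N) : PX N := (mkX_surj f).choose
lemma mkX_secX (f : AX N) : mkX N (secX f) = f := (mkX_surj f).choose_spec

/-- descended derivation as a linear map -/
noncomputable def DXl (a : N) : AX N →ₗ[ℂ] AX N where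
  toFun f := mkX N (D0 a (secX f))
  map_add' f g := by
    rw [← map_add, ← map_add]
    apply mkX_D0
    simp [mkX_secX]
  map_smul' t f := by
    rw [RingHom.id_apply, ← map_smul, ← Derivation.map_smul]
    apply mkX_D0
    simp [mkX_secX]

lemma DXl_mk (a : N) (f : PX N) : DXl a (mkX N f) = mkX N (D0 a f) :=
  mkX_D0 a (mkX_secX _)

/-- descended derivation -/
noncomputable def DX : N →ₗ[ℂ] Derivation ℂ (AX N) (AX N) where
  toFun a := Derivation.mk' (DXl a) (by
    intro f g
    obtain ⟨f, rfl⟩ := mkX_surj f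
    obtain ⟨g, rfl⟩ := mkX_surj g
    rw [← map_mul, DXl_mk, DXl_mk, DXl_mk, Derivation.leibniz]
    simp)
  map_add' a b := by
    ext f
    obtain ⟨f, rfl⟩ := mkX_surj f
    simp [DXl_mk]
  map_smul' a b := by
    ext f
    obtain ⟨f, rfl⟩ := mkX_surj f
    simp [DXl_mk]

lemma DX_mk (a : N) (f : PX N) : DX a (mkX N f) = mkX N (D0 a f) := DXl_mk a f

/-- evaluation -/
noncomputable def eX : AX N →ₐ[ℂ] ℂ :=
  (Ideal.Quotient.liftₐ I0 e0 (fun _ hf => hf []) : PX N ⧸ (I0 : Ideal (PX N)) →ₐ[ℂ] ℂ)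

lemma eX_mk (f : PX N) : eX (mkX N f) = e0 f := rfl

/-- tautological matrix -/
noncomputable def thX : N →ₗ[ℂ] AX N ⊗[ℂ] N :=
  (finBasis ℂ N).constr ℂ (fun j => ∑ i, mkX N (MvPolynomial.X (i, j)) ⊗ₜ finBasis ℂ N i)

lemma thX_b (j : Ix N) : thX (finBasis ℂ N j) =
    ∑ i, mkX N (MvPolynomial.X (i, j)) ⊗ₜ finBasis ℂ N i := by simp [thX]

lemma thX_der (a u : N) : (DX a).toLinearMap.rTensor N (thX u) = - ⁅(1 : AX N) ⊗ₜ[ℂ] a, thX u⁆ := by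
  let f1 : N →ₗ[ℂ] AX N ⊗[ℂ] N := (DX a).toLinearMap.rTensor N ∘ₗ thX
  let f2 : N →ₗ[ℂ] AX N ⊗[ℂ] N :=
    - ((LieAlgebra.ad (AX N) (AX N ⊗[ℂ] N) ((1 : AX N) ⊗ₜ[ℂ] a)).restrictScalars ℂ) ∘ₗ thX
  have : f1 = f2 := by
    apply (finBasis ℂ N).ext
    intro j
    simp only [f1, f2, LinearMap.comp_apply, LinearMap.neg_apply, thX_b, map_sum,
      LinearMap.rTensor_tmul, LinearMap.restrictScalars_apply, LieAlgebra.ad_apply,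
      LieAlgebra.ExtendScalars.bracket_tmul, one_mul,
      Derivation.coeFn_coe, DX_mk, D0_X, map_neg, map_mul, adm_spec, TensorProduct.sum_tmul,
      TensorProduct.tmul_sum, TensorProduct.neg_tmul, Finset.sum_neg_distrib,
      TensorProduct.tmul_smul]
    rw [Finset.sum_comm]
    congr 1
    refine Finset.sum_congr rfl fun k _ => Finset.sum_congr rfl fun i _ => ?_
    rw [TensorProduct.smul_tmul', ← MvPolynomial.algebraMap_eq, AlgHom.commutes, ← Algebra.smul_def]
  exact LinearMap.congr_fun this u

lemma thX_one (u : N) : TensorProduct.lid ℂ N (eX.toLinearMap.rTensor N (thX u)) = u := by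
  have : (TensorProduct.lid ℂ N).toLinearMap ∘ₗ eX.toLinearMap.rTensor N ∘ₗ thX
      = LinearMap.id := by
    apply (finBasis ℂ N).ext
    intro j
    simp [thX_b, eX_mk, e0]
  exact LinearMap.congr_fun this u

lemma cd_ext {A V : Type*} [CommRing A] [Algebra ℂ A] [AddCommGroup V] [Module ℂ V]
    [Module.Finite ℂ V] (Y : A ⊗[ℂ] V) (h : ∀ ξ, Model.cd A ξ Y = 0) : Y = 0 := by
  let b := finBasis ℂ V
  let bA := Algebra.TensorProduct.basis A b
  have hcd : ∀ i Y, bA.repr Y i = Model.cd A (b.coord i) Y := by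
    intro i Y
    induction Y with
    | zero => simp
    | add Y Y' h h' => simp [h, h']
    | tmul t v => simp [bA, Algebra.smul_def, mul_comm]
  apply bA.repr.injective
  ext i
  rw [hcd, h]; simp

lemma sepX (f : AX N) (h : ∀ l : List N, eX (l.foldr (fun a f => DX a f) f) = 0) : f = 0 := by
  obtain ⟨f, rfl⟩ := mkX_surj f
  rw [← map_zero (mkX N), mkX_eq, sub_zero]
  intro l
  have : ∀ l : List N, l.foldr (fun a f => DX a f) (mkX N f) = mkX N (fD l f) := by
    intro l
    induction l with
    | nil => rfl
    | cons a l ih => simp only [List.foldr_cons, ih, fD, DX_mk]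
  rw [← eX_mk, ← this, h]

lemma rT_lie {A : Type*} [CommRing A] [Algebra ℂ A] (d : Derivation ℂ A A) (Y Z : A ⊗[ℂ] N) :
    d.toLinearMap.rTensor N ⁅Y, Z⁆ =
      ⁅d.toLinearMap.rTensor N Y, Z⁆ + ⁅Y, d.toLinearMap.rTensor N Z⁆ := by
  induction Y with
  | zero => simp
  | add Y Y' h h' => simp only [add_lie, map_add, h, h']; abel
  | tmul t b =>
    induction Z with
    | zero => simp
    | add Z Z' h h' => simp only [lie_add, map_add, h, h']; abel
    | tmul r c =>
      simp only [LieAlgebra.ExtendScalars.bracket_tmul, LinearMap.rTensor_tmul,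
        Derivation.coeFn_coe, Derivation.leibniz,
        smul_eq_mul, ← TensorProduct.add_tmul]
      congr 1; ring

lemma thX_lie (u v : N) : thX ⁅u, v⁆ = ⁅thX u, thX v⁆ := by
  rw [← sub_eq_zero]
  set Y := thX ⁅u, v⁆ - ⁅thX u, thX v⁆ with hY
  have hD : ∀ a, (DX a).toLinearMap.rTensor N Y = - ⁅(1 : AX N) ⊗ₜ[ℂ] a, Y⁆ := by
    intro a
    rw [hY, map_sub, rT_lie, thX_der, thX_der, thX_der, lie_sub, neg_lie, lie_neg,
      leibniz_lie ((1 : AX N) ⊗ₜ[ℂ] a) (thX u)]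
    abel
  have hcd : ∀ (ξ : Module.Dual ℂ N) a (Y : AX N ⊗[ℂ] N), DX a (Model.cd (AX N) ξ Y) =
      Model.cd (AX N) ξ ((DX a).toLinearMap.rTensor N Y) := by
    intro ξ a Y
    induction Y with
    | zero => simp
    | add Y Y' h h' => simp only [map_add, h, h']
    | tmul t b => simp; ring
  have hcd2 : ∀ (ξ : Module.Dual ℂ N) a (Y : AX N ⊗[ℂ] N), Model.cd (AX N) ξ ⁅(1 : AX N) ⊗ₜ[ℂ] a, Y⁆
      = Model.cd (AX N) (ξ ∘ₗ (LieAlgebra.ad ℂ N a)) Y := by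
    intro ξ a Y
    induction Y with
    | zero => simp
    | add Y Y' h h' => simp only [map_add, lie_add, h, h']
    | tmul t b => simp
  have hε : ∀ ξ : Module.Dual ℂ N, eX (Model.cd (AX N) ξ Y) = 0 := by
    intro ξ
    have h1 : ∀ Y : AX N ⊗[ℂ] N, eX (Model.cd (AX N) ξ Y) = ξ
        (TensorProduct.lid ℂ N (eX.toLinearMap.rTensor N Y)) := by
      intro Y
      induction Y with
      | zero => simp
      | add Y Y' h h' => simp only [map_add, h, h']
      | tmul t b => simp
    have h2 : ∀ Y Z : AX N ⊗[ℂ] N, TensorProduct.lid ℂ N (eX.toLinearMap.rTensor N ⁅Y, Z⁆) =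
        ⁅TensorProduct.lid ℂ N (eX.toLinearMap.rTensor N Y),
          TensorProduct.lid ℂ N (eX.toLinearMap.rTensor N Z)⁆ := by
      intro Y Z
      induction Y with
      | zero => simp
      | add Y Y' h h' => simp only [map_add, add_lie, h, h']
      | tmul t b =>
        induction Z with
        | zero => simp
        | add Y Y' h h' => simp only [map_add, lie_add, h, h']
        | tmul r c => simp [mul_smul]; rw [smul_comm]
    rw [h1, hY, map_sub, map_sub, h2, thX_one, thX_one, thX_one, sub_self, map_zero]
  apply cd_ext
  intro ξ
  apply sepX
  intro l
  induction l using List.reverseRecOn generalizing ξ with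
  | nil => exact hε ξ
  | append_singleton l a ih =>
    simp only [List.foldr_append, List.foldr_cons, List.foldr_nil]
    rw [hcd, hD, map_neg, hcd2, ← LinearMap.neg_apply]
    have : -Model.cd (AX N) (ξ ∘ₗ (LieAlgebra.ad ℂ N a)) =
        Model.cd (AX N) (-(ξ ∘ₗ (LieAlgebra.ad ℂ N a))) := by
      ext; simp
    rw [this]
    exact ih _

variable (N) in
lemma exists_model : ∃ (A : Type) (_ : CommRing A) (_ : Algebra ℂ A), Nonempty (Model A N) := by
  refine ⟨AX N, inferInstance, inferInstance, ⟨⟨DX, ?_, thX, thX_lie, thX_der, eX, thX_one, sepX, ?_⟩⟩⟩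
  · intro a b f
    obtain ⟨f, rfl⟩ := mkX_surj f
    simp only [DX_mk, D0_lie, map_sub]
  · rw [eq_top_iff]
    intro f _
    obtain ⟨f, rfl⟩ := mkX_surj f
    induction f using MvPolynomial.induction_on with
    | C r =>
      rw [← MvPolynomial.algebraMap_eq, AlgHom.commutes]
      exact Subalgebra.algebraMap_mem _ _
    | add f g hf hg =>
      rw [map_add]; exact add_mem (hf trivial) (hg trivial)
    | mul_X f p hf =>
      rw [map_mul]; refine mul_mem (hf trivial) (Algebra.subset_adjoin ?_)
      obtain ⟨i, j⟩ := p
      refine ⟨(finBasis ℂ N).coord i, finBasis ℂ N j, ?_⟩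
      change _ = Model.cd _ _ _
      rw [thX_b, map_sum]
      simp [Finsupp.single_apply]

end construct
end PostLie

namespace PostLie
open Module TensorProduct

/-- The data of two homomorphisms whose difference is bijective. -/
structure DD (G N : Type*) [LieRing G] [LieAlgebra ℂ G] [LieRing N] [LieAlgebra ℂ N] where
  φ : G →ₗ⁅ℂ⁆ N
  ψ : G →ₗ⁅ℂ⁆ N
  e : G ≃ₗ[ℂ] N
  he : ∀ x, ψ x - φ x = e x

namespace Model
variable {A N : Type*} [CommRing A] [Algebra ℂ A] [LieRing N] [LieAlgebra ℂ N] (M : Model A N)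
variable {G : Type*} [LieRing G] [LieAlgebra ℂ G] (S : DD G N)

/-- the frame -/
noncomputable def δ : G →ₗ[ℂ] A ⊗[ℂ] N :=
  (TensorProduct.mk ℂ A N 1) ∘ₗ S.ψ.toLinearMap - M.θ ∘ₗ S.φ.toLinearMap

lemma δ_apply (x : G) : M.δ S x = 1 ⊗ₜ S.ψ x - M.θ (S.φ x) := rfl

lemma nab_δ (x y : G) : M.nab (M.δ S x) (M.δ S y) = ⁅M.δ S x, M.θ (S.φ y)⁆ := by
  rw [δ_apply M S y, map_sub, nab_const, nab_θ, zero_sub, neg_neg]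

lemma one_lie (a b : N) : ⁅(1 : A) ⊗ₜ[ℂ] a, (1 : A) ⊗ₜ[ℂ] b⁆ = 1 ⊗ₜ ⁅a, b⁆ := by simp

lemma δ_lie (x y : G) : M.δ S ⁅x, y⁆ =
    ⁅(1 : A) ⊗ₜ[ℂ] S.ψ x, (1 : A) ⊗ₜ[ℂ] S.ψ y⁆ - ⁅M.θ (S.φ x), M.θ (S.φ y)⁆ := by
  rw [δ_apply, LieHom.map_lie, LieHom.map_lie, one_lie, M.θ_lie]

lemma nab_δ' (x y : G) : M.nab (M.δ S x) (M.δ S y) =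
    M.δ S ⁅x, y⁆ - ⁅(1 : A) ⊗ₜ[ℂ] S.ψ x, M.δ S y⁆ := by
  rw [nab_δ, δ_lie, δ_apply, δ_apply, sub_lie, lie_sub]; abel

lemma br_δ (x y : G) : M.lr.br (M.δ S x) (M.δ S y) = M.δ S ⁅x, y⁆ := by
  rw [lr_br, nab_δ, nab_δ, δ_lie, δ_apply, δ_apply]
  simp only [sub_lie, lie_sub]
  rw [← lie_skew (M.θ (S.φ y)) (M.θ (S.φ x)), ← lie_skew (M.θ (S.φ x)) (1 ⊗ₜ[ℂ] (S.ψ y))]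
  abel

lemma bc_ad (a : N) (Y : A ⊗[ℂ] N) :
    (adL N a).baseChange A Y = ⁅(1 : A) ⊗ₜ[ℂ] a, Y⁆ := by
  induction Y with
  | zero => simp
  | add Y Y' h h' => simp only [map_add, lie_add, h, h']
  | tmul t b => simp

lemma bij_θ [Module.Finite ℂ N] [LieAlgebra.IsKilling ℂ N] :
    Function.Bijective (M.θ.liftBaseChange A) := by
  refine M.bijective_of_flow M.θ M.θ_one ?_
  intro n
  refine ⟨-(adL N n), 0, ?_, by simp, ?_⟩
  · have := rep_trace_zero (adL_rep (N := N)) n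
    simp only [map_neg]
    rw [neg_eq_zero]
    exact this
  · intro u
    rw [nab_θ, ← M.θ_lie]
    simp only [LinearMap.neg_apply, adL_apply, map_neg, LinearMap.baseChange_zero,
      LinearMap.zero_apply, sub_zero]

lemma bij_δ [Module.Finite ℂ N] [LieAlgebra.IsKilling ℂ N] [Module.Finite ℂ G]
    [LieAlgebra.IsKilling ℂ G] :
    Function.Bijective ((M.δ S).liftBaseChange A) := by
  have h1 : Function.Bijective ((M.δ S ∘ₗ S.e.symm.toLinearMap).liftBaseChange A) := by
    apply M.bijective_of_flow
    · intro u
      simp only [LinearMap.comp_apply, δ_apply, map_sub, M.θ_one]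
      simpa using S.he (S.e.symm u)
    · intro n
      refine ⟨S.e.toLinearMap ∘ₗ adL G (S.e.symm n) ∘ₗ S.e.symm.toLinearMap,
        adL N (S.ψ (S.e.symm n)), ?_, ?_, ?_⟩
      · have h2 := LinearMap.trace_conj' (adL G (S.e.symm n) : G →ₗ[ℂ] G) S.e
        have h3 := rep_trace_zero (adL_rep (N := G)) (S.e.symm n)
        rw [LinearEquiv.conj_apply] at h2
        rw [← LinearMap.comp_assoc]
        rw [h2]; exact h3
      · exact rep_trace_zero (adL_rep (N := N)) _
      · intro u
        have := bc_ad (A := A) (S.ψ (S.e.symm n)) (M.δ S (S.e.symm u))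
        simp only [LinearMap.comp_apply, LinearEquiv.coe_coe, LinearEquiv.symm_apply_apply]
        rw [nab_δ', ← this]
        rfl
  have h2 : (M.δ S).liftBaseChange A = (M.δ S ∘ₗ S.e.symm.toLinearMap).liftBaseChange A ∘ₗ
      (S.e.toLinearMap.baseChange A) := by
    ext; simp
  rw [h2, LinearMap.coe_comp]
  refine h1.comp ?_
  exact (LinearEquiv.baseChange ℂ A G N S.e).bijective

lemma span_of_bij {V : Type*} [AddCommGroup V] [Module ℂ V] (F : V →ₗ[ℂ] A ⊗[ℂ] N)
    (h : Function.Surjective (F.liftBaseChange A)) : Submodule.span A (Set.range F) = ⊤ := by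
  rw [eq_top_iff]
  intro Y _
  obtain ⟨Z, rfl⟩ := h Y
  induction Z with
  | zero => simp
  | add Y Y' h h' => rw [map_add]; exact add_mem (h trivial) (h' trivial)
  | tmul t v =>
    simp only [LinearMap.liftBaseChange_tmul]
    exact Submodule.smul_mem _ _ (Submodule.subset_span ⟨v, rfl⟩)

lemma span_one : Submodule.span A (Set.range fun u : N => (1 : A) ⊗ₜ[ℂ] u) = ⊤ := by
  rw [eq_top_iff]
  intro Z _
  induction Z with
  | zero => simp
  | add Y Y' h h' => exact add_mem (h trivial) (h' trivial)
  | tmul t v =>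
    have : t ⊗ₜ[ℂ] v = t • ((1 : A) ⊗ₜ[ℂ] v) := by simp [TensorProduct.smul_tmul']
    rw [this]
    exact Submodule.smul_mem _ _ (Submodule.subset_span ⟨v, rfl⟩)

/-- entries -/
noncomputable def ent : Module.Dual ℂ N →ₗ[ℂ] N →ₗ[ℂ] A :=
  LinearMap.mk₂ ℂ (fun ξ u => cd A ξ (M.θ u))
    (by intro ξ ξ' u
        have : cd A (ξ + ξ') = cd A ξ + cd A ξ' := by ext; simp
        rw [this]; rfl)
    (by intro t ξ u
        have : cd A (t • ξ) = t • cd A ξ := by ext; simp [Algebra.smul_def]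
        rw [this]; rfl)
    (by intros; simp) (by intros; simp)

lemma ent_apply (ξ : Module.Dual ℂ N) (u : N) : M.ent ξ u = cd A ξ (M.θ u) := rfl

/-- span of the entries -/
noncomputable def entV : Submodule ℂ A := LinearMap.range (TensorProduct.lift M.ent)

lemma ent_mem (ξ : Module.Dual ℂ N) (u : N) : M.ent ξ u ∈ M.entV := ⟨ξ ⊗ₜ u, by simp⟩

lemma cd_lie_one (ξ : Module.Dual ℂ N) (a : N) (Y : A ⊗[ℂ] N) :
    cd A ξ ⁅(1 : A) ⊗ₜ[ℂ] a, Y⁆ = cd A (ξ ∘ₗ (adL N a)) Y := by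
  induction Y with
  | zero => simp
  | add Y Y' h h' => simp only [map_add, lie_add, h, h']
  | tmul t b => simp

lemma entV_gen : Algebra.adjoin ℂ (M.entV : Set A) = ⊤ := by
  rw [eq_top_iff, ← M.gen]
  apply Algebra.adjoin_mono
  rintro f ⟨ξ, u, rfl⟩
  exact M.ent_mem ξ u

lemma entV_stable (X : A ⊗[ℂ] N) (h : ∀ ξ u, M.rho X (M.ent ξ u) ∈ M.entV) :
    ∀ v ∈ M.entV, M.rho X v ∈ M.entV := by
  rintro _ ⟨t, rfl⟩
  induction t with
  | zero => simp
  | add t t' h h' => simp only [map_add]; exact add_mem h h'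
  | tmul ξ u => simpa using h ξ u

lemma loc_δ [Module.Finite ℂ N] (f : A) :
    ∃ U : Submodule ℂ A, Module.Finite ℂ U ∧ (∀ x, ∀ v ∈ U, M.rho (M.δ S x) v ∈ U) ∧ f ∈ U := by
  have : Module.Finite ℂ M.entV := by unfold entV; infer_instance
  refine loc_fin (fun x => M.rho (M.δ S x)) M.entV (fun x => M.entV_stable _ ?_) M.entV_gen f
  intro ξ u
  rw [ent_apply, rho_cd, nab_θ, δ_apply, sub_lie, ← M.θ_lie, map_neg, map_sub, cd_lie_one,
    ← ent_apply, ← ent_apply]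
  exact neg_mem (sub_mem (M.ent_mem _ _) (M.ent_mem _ _))

lemma loc_θ [Module.Finite ℂ N] (f : A) :
    ∃ U : Submodule ℂ A, Module.Finite ℂ U ∧ (∀ x, ∀ v ∈ U, M.rho (M.θ x) v ∈ U) ∧ f ∈ U := by
  have : Module.Finite ℂ M.entV := by unfold entV; infer_instance
  refine loc_fin (fun x => M.rho (M.θ x)) M.entV (fun x => M.entV_stable _ ?_) M.entV_gen f
  intro ξ u
  rw [ent_apply, rho_cd, nab_θ, ← M.θ_lie, map_neg, ← ent_apply]
  exact neg_mem (M.ent_mem _ _)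

/-- derivations as a linear map into endomorphisms -/
noncomputable def rhoL {V : Type*} [AddCommGroup V] [Module ℂ V] (F : V →ₗ[ℂ] A ⊗[ℂ] N) :
    V →ₗ[ℂ] A →ₗ[ℂ] A where
  toFun x := (M.rho (F x) : A →ₗ[ℂ] A)
  map_add' x y := by ext; simp
  map_smul' t x := by
    ext f
    have : M.rho (t • F x) = t • M.rho (F x) := LinearMap.map_smul_of_tower _ _ _
    simp [this]

@[simp] lemma rhoL_apply {V : Type*} [AddCommGroup V] [Module ℂ V] (F : V →ₗ[ℂ] A ⊗[ℂ] N) (x : V)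
    (f : A) : M.rhoL F x f = M.rho (F x) f := rfl

lemma rhoL_δ_rep : IsRep (M.rhoL (M.δ S)) := by
  intro x y f
  simp only [rhoL_apply]
  rw [← br_δ, rho_br]

lemma rhoL_θ_rep : IsRep (M.rhoL (-M.θ)) := by
  intro x y f
  simp only [rhoL_apply, LinearMap.neg_apply, map_neg, Derivation.neg_apply, neg_neg]
  rw [← Derivation.neg_apply, ← map_neg, ← br_θ, rho_br]

/-- boundaries -/
noncomputable def J : Submodule ℂ A := Coinv (M.rhoL (M.δ S))

lemma one_not_mem_J [Module.Finite ℂ N] [Module.Finite ℂ G] [LieAlgebra.IsKilling ℂ G] :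
    (1 : A) ∉ M.J S := by
  intro h1
  have key : ∀ w ∈ M.J S, ∃ U : Submodule ℂ A, Module.Finite ℂ U ∧
      (∀ x, ∀ v ∈ U, M.rhoL (M.δ S) x v ∈ U) ∧
      w ∈ Submodule.span ℂ {w | ∃ x, ∃ v ∈ U, M.rhoL (M.δ S) x v = w} := by
    intro w hw
    induction hw using Submodule.span_induction with
    | mem w hw =>
      obtain ⟨x, v, rfl⟩ := hw
      obtain ⟨U, h1, h2, h3⟩ := M.loc_δ S v
      exact ⟨U, h1, h2, Submodule.subset_span ⟨x, v, h3, rfl⟩⟩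
    | zero => exact ⟨⊥, inferInstance, by simp, zero_mem _⟩
    | add a b _ _ ha hb =>
      obtain ⟨U, h1, h2, h3⟩ := ha
      obtain ⟨U', h1', h2', h3'⟩ := hb
      refine ⟨U ⊔ U', inferInstance, ?_, add_mem (Submodule.span_mono ?_ h3)
        (Submodule.span_mono ?_ h3')⟩
      · intro x v hv
        obtain ⟨a, ha, b, hb, rfl⟩ := Submodule.mem_sup.1 hv
        rw [map_add]
        exact Submodule.add_mem_sup (h2 x a ha) (h2' x b hb)
      · rintro _ ⟨x, v, hv, rfl⟩; exact ⟨x, v, Submodule.mem_sup_left hv, rfl⟩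
      · rintro _ ⟨x, v, hv, rfl⟩; exact ⟨x, v, Submodule.mem_sup_right hv, rfl⟩
    | smul t a _ ha =>
      obtain ⟨U, h1, h2, h3⟩ := ha
      exact ⟨U, h1, h2, Submodule.smul_mem _ _ h3⟩
  obtain ⟨U, hU1, hU2, hU3⟩ := key 1 h1
  have hmem : (1 : A) ∈ U := by
    refine Submodule.span_le.2 ?_ hU3
    rintro _ ⟨x, v, hv, rfl⟩
    exact hU2 x v hv
  have hrep := (M.rhoL_δ_rep S).restr U hU2
  have h2 : (⟨1, hmem⟩ : U) ∈ Inv (restr (M.rhoL (M.δ S)) U hU2) := by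
    intro x; ext; simp
  have h3 : (⟨1, hmem⟩ : U) ∈ Coinv (restr (M.rhoL (M.δ S)) U hU2) := by
    have h4 : (1 : A) ∈ (Coinv (restr (M.rhoL (M.δ S)) U hU2)).map U.subtype := by
      rw [Coinv, Submodule.map_span]
      refine Submodule.span_mono ?_ hU3
      rintro _ ⟨x, v, hv, rfl⟩
      exact ⟨restr (M.rhoL (M.δ S)) U hU2 x ⟨v, hv⟩, ⟨x, ⟨v, hv⟩, rfl⟩, rfl⟩
    obtain ⟨u, hu, hu1⟩ := h4
    have : u = ⟨1, hmem⟩ := Subtype.ext hu1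
    exact this ▸ hu
  have := congrArg Subtype.val (inv_inf_coinv hrep _ h2 h3)
  have h5 := congrArg M.ε this
  simp at h5

lemma algebraMap_mem_J [Module.Finite ℂ N] [Module.Finite ℂ G] [LieAlgebra.IsKilling ℂ G]
    (t : ℂ) (h : algebraMap ℂ A t ∈ M.J S) : t = 0 := by
  by_contra ht
  apply M.one_not_mem_J S
  have := (M.J S).smul_mem t⁻¹ h
  rwa [Algebra.algebraMap_eq_smul_one, smul_smul, inv_mul_cancel₀ ht, one_smul] at this

end Model
end PostLie

namespace PostLie
open Module TensorProduct

section contraction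
variable (G : Type*) [LieRing G] [LieAlgebra ℂ G] [Module.Finite ℂ G] [LieAlgebra.IsKilling ℂ G]

/-- Killing form -/
noncomputable abbrev kf : LinearMap.BilinForm ℂ G := killingForm ℂ G

lemma kf_nd : (kf G).Nondegenerate := LieAlgebra.IsKilling.killingForm_nondegenerate ℂ G

/-- a basis -/
noncomputable def gb : Basis (Fin (finrank ℂ G)) ℂ G := finBasis ℂ G
/-- the dual basis -/
noncomputable def gd : Basis (Fin (finrank ℂ G)) ℂ G := (kf G).dualBasis (kf_nd G) (gb G)

variable {G}

lemma kf_symm (u v : G) : kf G u v = kf G v u := LieModule.traceForm_comm ℂ G G u v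

lemma kf_inv (u v w : G) : kf G ⁅u, v⁆ w = kf G u ⁅v, w⁆ :=
  LieModule.traceForm_apply_lie_apply ℂ G G u v w

lemma exp_b (v : G) : v = ∑ j, kf G (gd G j) v • gb G j := by
  conv_lhs => rw [← (gb G).sum_repr v]
  refine Finset.sum_congr rfl fun j _ => ?_
  congr 1
  have h3 : kf G (gd G j) (∑ i, (gb G).repr v i • gb G i) = (gb G).repr v j := by
    simp only [map_sum, map_smul, gd, LinearMap.BilinForm.apply_dualBasis_left]
    simp
  rw [(gb G).sum_repr v] at h3
  exact h3.symm

lemma exp_d (v : G) : v = ∑ j, kf G v (gb G j) • gd G j := by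
  conv_lhs => rw [← (gd G).sum_repr v]
  refine Finset.sum_congr rfl fun j _ => ?_
  simp [gd]

lemma tr_eq (T : G →ₗ[ℂ] G) : LinearMap.trace ℂ G T = ∑ i, kf G (T (gb G i)) (gd G i) := by
  rw [LinearMap.trace_eq_matrix_trace ℂ (gb G), Matrix.trace]
  refine Finset.sum_congr rfl fun i _ => ?_
  rw [Matrix.diag_apply, LinearMap.toMatrix_apply, kf_symm]
  have := congrArg (fun v => (gb G).repr v i) (exp_b (T (gb G i)))
  simp only [map_sum, map_smul, Basis.repr_self] at this
  rw [this]
  simp [Finsupp.single_apply]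

variable {W : Type*} [AddCommGroup W] [Module ℂ W]

lemma ctr_adj (β : G →ₗ[ℂ] G →ₗ[ℂ] W) (T T' : G →ₗ[ℂ] G)
    (h : ∀ u v, kf G (T u) v = kf G u (T' v)) :
    ∑ i, β (T (gb G i)) (gd G i) = ∑ i, β (gb G i) (T' (gd G i)) := by
  have e1 : ∀ i, β (T (gb G i)) (gd G i) =
      ∑ j, kf G (gd G j) (T (gb G i)) • β (gb G j) (gd G i) := by
    intro i
    conv_lhs => rw [exp_b (T (gb G i))]
    simp
  have e2 : ∀ i, β (gb G i) (T' (gd G i)) =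
      ∑ j, kf G (T' (gd G i)) (gb G j) • β (gb G i) (gd G j) := by
    intro i
    conv_lhs => rw [exp_d (T' (gd G i))]
    simp
  simp_rw [e1, e2]
  rw [Finset.sum_comm]
  refine Finset.sum_congr rfl fun i _ => Finset.sum_congr rfl fun j _ => ?_
  rw [kf_symm (T' _), ← h, kf_symm (gd G i)]

lemma ctr_swap (β : G →ₗ[ℂ] G →ₗ[ℂ] W) :
    ∑ i, β (gb G i) (gd G i) = ∑ i, β (gd G i) (gb G i) := by
  have e1 : ∀ i, β (gb G i) (gd G i) =
      ∑ j, kf G (gd G j) (gd G i) • β (gb G i) (gb G j) := by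
    intro i
    conv_lhs => rw [exp_b (gd G i)]
    simp
  have e2 : ∀ i, β (gd G i) (gb G i) =
      ∑ j, kf G (gd G j) (gd G i) • β (gb G j) (gb G i) := by
    intro i
    conv_lhs => rw [exp_b (gd G i)]
    simp
  simp_rw [e1, e2]
  rw [Finset.sum_comm]
  refine Finset.sum_congr rfl fun i _ => Finset.sum_congr rfl fun j _ => ?_
  rw [kf_symm]

lemma kf_eq (u v : G) (h : ∀ w, kf G u w = kf G v w) : u = v := by
  rw [← sub_eq_zero]
  refine (kf_nd G).1 _ ?_
  intro w
  simp [h w]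

lemma casimir (y : G) : ∑ i, ⁅gb G i, ⁅gd G i, y⁆⁆ = y := by
  apply kf_eq
  intro w
  have h1 : kf G y w = ∑ i, kf G ⁅y, ⁅w, gb G i⁆⁆ (gd G i) := by
    have : kf G y w = LinearMap.trace ℂ G (adL G y ∘ₗ adL G w) := rfl
    rw [this, tr_eq]
    rfl
  rw [h1]
  simp only [map_sum, LinearMap.sum_apply]
  refine Finset.sum_congr rfl fun i _ => ?_
  rw [← lie_skew y, map_neg, LinearMap.neg_apply, kf_inv ⁅w, _⁆, kf_inv, ← lie_skew w, map_neg,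
    LinearMap.neg_apply, neg_neg, kf_symm, kf_inv, kf_symm, ← lie_skew, ← lie_skew y (gd G i)]
  simp only [map_neg, LinearMap.neg_apply]

lemma casimir' (y : G) : ∑ i, ⁅gd G i, ⁅gb G i, y⁆⁆ = y := by
  have := ctr_swap (G := G) ((adL G).compr₂ ((LinearMap.id)) |>.compl₂ ((adL G).flip y))
  simp only [LinearMap.compl₂_apply, LinearMap.compr₂_apply, LinearMap.flip_apply, adL_apply,
    LinearMap.id_apply] at this
  rw [← this, casimir]

/-- Endomorphisms commuting with the adjoint action. -/
def Com (P : G →ₗ[ℂ] G) : Prop := ∀ x y : G, P ⁅x, y⁆ = ⁅P x, y⁆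

lemma Com.right {P : G →ₗ[ℂ] G} (h : Com P) (x y : G) : P ⁅x, y⁆ = ⁅x, P y⁆ := by
  rw [← lie_skew, map_neg, h, lie_skew]

lemma Com.adj {P : G →ₗ[ℂ] G} (h : Com P) (x y : G) : kf G (P x) y = kf G x (P y) := by
  have : (kf G).compl₁₂ P LinearMap.id - (kf G).compl₁₂ LinearMap.id P = 0 := by
    apply perfect_induction
    intro u v
    ext w
    simp only [LinearMap.sub_apply, LinearMap.compl₁₂_apply, LinearMap.id_apply,
      LinearMap.zero_apply]
    rw [h.right, kf_inv, ← h, h.right, ← kf_inv, sub_self]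
  have := LinearMap.congr_fun (LinearMap.congr_fun this x) y
  simpa [sub_eq_zero] using this

lemma c0 {P : G →ₗ[ℂ] G} (hP : Com P) (h : G →ₗ[ℂ] G →ₗ[ℂ] W) (hh : ∀ x y, h x y = - h y x) :
    ∑ i, h (P (gb G i)) (gd G i) = 0 := by
  have h1 := ctr_adj h P P hP.adj
  have h2 := ctr_swap (h.compl₂ P)
  simp only [LinearMap.compl₂_apply] at h2
  rw [h2] at h1
  have h3 : ∑ i, h (gd G i) (P (gb G i)) = - ∑ i, h (P (gb G i)) (gd G i) := by
    rw [← Finset.sum_neg_distrib]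
    exact Finset.sum_congr rfl fun i _ => hh _ _
  rw [h3] at h1
  have h4 : (2 : ℂ) • ∑ i, h (P (gb G i)) (gd G i) = 0 := by
    rw [two_smul]; exact add_eq_zero_iff_eq_neg.2 h1
  exact (smul_eq_zero.1 h4).resolve_left two_ne_zero

/-- contraction -/
noncomputable def Q (P : G →ₗ[ℂ] G) (f : G → G → G → W) : W :=
  ∑ i, ∑ j, f (P (gb G i)) (gb G j) ⁅gd G i, gd G j⁆

lemma q2 {P : G →ₗ[ℂ] G} (hP : Com P) (h : G →ₗ[ℂ] G →ₗ[ℂ] W) (hh : ∀ x y, h x y = - h y x) :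
    Q P (fun x y z => h ⁅y, z⁆ x) = 0 := by
  unfold Q
  rw [← c0 hP h hh]
  refine Finset.sum_congr rfl fun i _ => ?_
  rw [hh (P _), ← casimir (gd G i)]
  simp only [map_sum, LinearMap.sum_apply]
  rw [← Finset.sum_neg_distrib, casimir]
  refine Finset.sum_congr rfl fun j _ => ?_
  rw [← lie_skew (gd G i), lie_neg, map_neg, LinearMap.neg_apply]

lemma q3 {P : G →ₗ[ℂ] G} (hP : Com P) (h : G →ₗ[ℂ] G →ₗ[ℂ] W) (hh : ∀ x y, h x y = - h y x) :
    Q P (fun x y z => h ⁅z, x⁆ y) = 0 := by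
  unfold Q
  rw [Finset.sum_comm, ← neg_zero, ← c0 hP h hh, ← Finset.sum_neg_distrib]
  have h2 := ctr_swap (h.compl₁₂ P LinearMap.id)
  simp only [LinearMap.compl₁₂_apply, LinearMap.id_apply] at h2
  rw [Finset.sum_neg_distrib, h2, ← Finset.sum_neg_distrib]
  refine Finset.sum_congr rfl fun i _ => ?_
  conv_rhs => rw [← casimir (gd G i)]
  simp only [map_sum, LinearMap.sum_apply]
  rw [← Finset.sum_neg_distrib]
  refine Finset.sum_congr rfl fun j _ => ?_
  rw [hP, ← lie_skew, map_neg, LinearMap.neg_apply]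

lemma q1 {P : G →ₗ[ℂ] G} (hP : Com P) (h : G →ₗ[ℂ] G →ₗ[ℂ] W) (hh : ∀ x y, h x y = - h y x) :
    Q P (fun x y z => h ⁅x, y⁆ z) = 0 := by
  unfold Q
  have h1 : ∀ i, ∑ j, h ⁅P (gb G i), gb G j⁆ ⁅gd G i, gd G j⁆ =
      ∑ j, - h (gb G j) ⁅gd G i, ⁅P (gb G i), gd G j⁆⁆ := by
    intro i
    have := ctr_adj (h.compl₂ (adL G (gd G i))) (adL G (P (gb G i))) (-adL G (P (gb G i))) (by
      intro u v
      simp only [adL_apply, LinearMap.neg_apply, map_neg]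
      rw [← lie_skew, map_neg, LinearMap.neg_apply, kf_inv])
    simp only [LinearMap.compl₂_apply, adL_apply, LinearMap.neg_apply, lie_neg, map_neg] at this
    exact this
  simp_rw [h1]
  rw [Finset.sum_comm, ← neg_zero, ← c0 hP h hh, ctr_adj h P P hP.adj, ← Finset.sum_neg_distrib]
  refine Finset.sum_congr rfl fun j _ => ?_
  rw [Finset.sum_neg_distrib]
  congr 1
  conv_rhs => rw [← casimir' (gd G j)]
  simp only [map_sum]
  refine Finset.sum_congr rfl fun i _ => ?_
  rw [hP.right, hP]

lemma q4 (P : G →ₗ[ℂ] G) (h : G →ₗ[ℂ] G →ₗ[ℂ] W) :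
    Q P (fun x y z => h x ⁅y, z⁆) = - ∑ i, h (P (gb G i)) (gd G i) := by
  unfold Q
  rw [← Finset.sum_neg_distrib]
  refine Finset.sum_congr rfl fun i _ => ?_
  conv_rhs => rw [← casimir (gd G i)]
  simp only [map_sum]
  rw [← Finset.sum_neg_distrib]
  refine Finset.sum_congr rfl fun j _ => ?_
  rw [← lie_skew (gd G i), lie_neg, map_neg]


lemma Q_add (P : G →ₗ[ℂ] G) (f g : G → G → G → W) :
    Q P (fun x y z => f x y z + g x y z) = Q P f + Q P g := by
  simp [Q, Finset.sum_add_distrib]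

lemma Q_neg (P : G →ₗ[ℂ] G) (f : G → G → G → W) :
    Q P (fun x y z => - f x y z) = - Q P f := by
  simp [Q, Finset.sum_neg_distrib]

lemma Q_sub (P : G →ₗ[ℂ] G) (f g : G → G → G → W) :
    Q P (fun x y z => f x y z - g x y z) = Q P f - Q P g := by
  simp [Q, Finset.sum_sub_distrib]

lemma Q_smul (P : G →ₗ[ℂ] G) (t : ℂ) (f : G → G → G → W) :
    Q P (fun x y z => t • f x y z) = t • Q P f := by
  simp [Q, Finset.smul_sum]

end contraction
end PostLie

set_option maxSynthPendingDepth 3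
namespace PostLie
open Module TensorProduct

namespace Model
variable {A N : Type*} [CommRing A] [Algebra ℂ A] [LieRing N] [LieAlgebra ℂ N] (M : Model A N)
variable {G : Type*} [LieRing G] [LieAlgebra ℂ G] (S : DD G N)

/-- base change of a linear map -/
noncomputable def lb (A : Type*) [CommRing A] [Algebra ℂ A] {V P : Type*} [AddCommGroup V]
    [Module ℂ V] [AddCommGroup P] [Module ℂ P] [Module A P] [IsScalarTower ℂ A P] :
    (V →ₗ[ℂ] P) →ₗ[ℂ] (A ⊗[ℂ] V →ₗ[A] P) :=
  (LinearMap.liftBaseChangeEquiv A).toLinearMap.restrictScalars ℂ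

lemma lb_tmul {V P : Type*} [AddCommGroup V]
    [Module ℂ V] [AddCommGroup P] [Module ℂ P] [Module A P] [IsScalarTower ℂ A P]
    (f : V →ₗ[ℂ] P) (a : A) (v : V) : lb A f (a ⊗ₜ v) = a • f v := by
  simp [lb]

/-- extension of forms -/
noncomputable def ext3 : (N →ₗ[ℂ] N →ₗ[ℂ] N →ₗ[ℂ] A) →ₗ[ℂ]
    (A ⊗[ℂ] N →ₗ[A] A ⊗[ℂ] N →ₗ[A] A ⊗[ℂ] N →ₗ[A] A) :=
  lb A ∘ₗ LinearMap.compRight ℂ (lb A ∘ₗ LinearMap.compRight ℂ (lb A))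

lemma ext3_one (z : N →ₗ[ℂ] N →ₗ[ℂ] N →ₗ[ℂ] A) (u v w : N) :
    ext3 z (1 ⊗ₜ u) (1 ⊗ₜ v) (1 ⊗ₜ w) = z u v w := by
  simp [ext3, lb_tmul]

/-- alternating -/
def Alt3 {W : Type*} [AddCommGroup W] [Module ℂ W] (z : N →ₗ[ℂ] N →ₗ[ℂ] N →ₗ[ℂ] W) : Prop :=
  (∀ a b c, z a b c = - z b a c) ∧ (∀ a b c, z a b c = - z a c b)

lemma ext3_alt {z : N →ₗ[ℂ] N →ₗ[ℂ] N →ₗ[ℂ] A} (hz : Alt3 z) : LR.Alt (ext3 z) := by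
  have h1 : ext3 z = - (ext3 z).flip := by
    refine LinearMap.ext_on_range span_one fun u => LinearMap.ext_on_range span_one fun v =>
      LinearMap.ext_on_range span_one fun w => ?_
    simp only [LinearMap.neg_apply, LinearMap.flip_apply, ext3_one]
    exact hz.1 _ _ _
  have h2 : ∀ a, ext3 z a = - (ext3 z a).flip := by
    intro a
    have ha : a ∈ Submodule.span A (Set.range fun u : N => (1 : A) ⊗ₜ[ℂ] u) :=
      by rw [span_one]; trivial
    induction ha using Submodule.span_induction with
    | mem x hx =>
      obtain ⟨u, rfl⟩ := hx
      refine LinearMap.ext_on_range span_one fun v => LinearMap.ext_on_range span_one fun w => ?_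
      simp only [LinearMap.neg_apply, LinearMap.flip_apply, ext3_one]
      exact hz.2 _ _ _
    | zero => ext; simp
    | add x y _ _ hx hy =>
      rw [map_add]; nth_rw 1 [hx, hy]
      refine LinearMap.ext fun v => LinearMap.ext fun w => ?_
      simp only [LinearMap.neg_apply, LinearMap.flip_apply, LinearMap.add_apply]; ring
    | smul f x _ hx =>
      rw [map_smul]; nth_rw 1 [hx]
      refine LinearMap.ext fun v => LinearMap.ext fun w => ?_
      simp
  refine ⟨fun a b c => ?_, fun a b c => ?_⟩
  · conv_lhs => rw [h1]
    rfl
  · conv_lhs => rw [h2]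
    rfl

/-- closedness -/
def Clo (z : A ⊗[ℂ] N →ₗ[A] A ⊗[ℂ] N →ₗ[A] A ⊗[ℂ] N →ₗ[A] A) : Prop :=
  ∀ a b c e, M.lr.d3 z a b c e = 0

/-- closedness on constants -/
def d3c (z : N →ₗ[ℂ] N →ₗ[ℂ] N →ₗ[ℂ] A) (a b c e : N) : A :=
  M.D a (z b c e) - (M.D b (z a c e) + M.D c (z a e b) + M.D e (z a b c))
  - z ⁅a, b⁆ c e - z b ⁅a, c⁆ e - z b c ⁅a, e⁆
  + (z a ⁅b, c⁆ e + z a ⁅c, e⁆ b + z a ⁅e, b⁆ c)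

lemma d3_one (z : N →ₗ[ℂ] N →ₗ[ℂ] N →ₗ[ℂ] A) (a b c e : N) :
    M.lr.d3 (ext3 z) (1 ⊗ₜ a) (1 ⊗ₜ b) (1 ⊗ₜ c) (1 ⊗ₜ e) = M.d3c z a b c e := by
  simp only [LR.d3, br_const, ext3_one, lr_rho, rho_tmul, one_smul]
  rfl

lemma clo_iff {z : N →ₗ[ℂ] N →ₗ[ℂ] N →ₗ[ℂ] A} (hz : Alt3 z) :
    M.Clo (ext3 z) ↔ ∀ a b c e, M.d3c z a b c e = 0 := by
  constructor
  · intro h a b c e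
    rw [← d3_one]; exact h _ _ _ _
  · intro h
    refine LR.d3_eq_zero (ext3_alt hz) _ span_one ?_
    rintro _ ⟨a, rfl⟩ _ ⟨b, rfl⟩ _ ⟨c, rfl⟩ _ ⟨e, rfl⟩
    rw [d3_one, h]

section stokes
variable [Module.Finite ℂ G] [LieAlgebra.IsKilling ℂ G]

lemma Q_mem {P : G →ₗ[ℂ] G} {J : Submodule ℂ A} (f : G → G → G → A) (h : ∀ x y z, f x y z ∈ J) :
    Q P f ∈ J :=
  Submodule.sum_mem _ fun _ _ => Submodule.sum_mem _ fun _ _ => h _ _ _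

lemma stokes {z : A ⊗[ℂ] N →ₗ[A] A ⊗[ℂ] N →ₗ[A] A ⊗[ℂ] N →ₗ[A] A} (hz : LR.Alt z)
    (hc : M.Clo z) (X : A ⊗[ℂ] N) {P : G →ₗ[ℂ] G} (hP : Com P) :
    Q P (fun x y w => M.lr.lieD z X (M.δ S x) (M.δ S y) (M.δ S w)) ∈ M.J S := by
  let h : G →ₗ[ℂ] G →ₗ[ℂ] A := LinearMap.mk₂ ℂ (fun x y => z X (M.δ S x) (M.δ S y))
    (by intros; simp) (by intros; simp) (by intros; simp) (by intros; simp)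
  have hh : ∀ x y, h x y = - h y x := fun x y => hz.2 _ _ _
  have e : (fun x y w => M.lr.lieD z X (M.δ S x) (M.δ S y) (M.δ S w)) =
      fun x y w => (M.rho (M.δ S x) (h y w) + M.rho (M.δ S y) (h w x) + M.rho (M.δ S w) (h x y))
        - ((h ⁅x, y⁆ w + h ⁅y, w⁆ x) + h ⁅w, x⁆ y) := by
    funext x y w
    have := hc X (M.δ S x) (M.δ S y) (M.δ S w)
    simp only [LR.d3, br_δ, lr_rho] at this
    simp only [LR.lieD, h, LinearMap.mk₂_apply, lr_rho]
    linear_combination this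
  rw [e, Q_sub, Q_add P (fun x y w => h ⁅x, y⁆ w + h ⁅y, w⁆ x), Q_add P (fun x y w => h ⁅x, y⁆ w), q1 hP h hh, q2 hP h hh, q3 hP h hh]
  simp only [add_zero, sub_zero]
  refine Q_mem _ fun x y w => ?_
  have : ∀ x f, M.rho (M.δ S x) f ∈ M.J S := fun x f => by
    rw [← rhoL_apply]; exact mem_Coinv _ _ _
  exact add_mem (add_mem (this _ _) (this _ _)) (this _ _)

variable [Module.Finite ℂ N] [LieAlgebra.IsKilling ℂ N]

/-- rep on 3-forms -/
noncomputable abbrev ρ3 (σ : N →ₗ[ℂ] N →ₗ[ℂ] N) (X : N →ₗ[ℂ] A ⊗[ℂ] N) :=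
  homRep σ (homRep σ (homRep σ (M.rhoL X)))

lemma ρ3_apply (σ : N →ₗ[ℂ] N →ₗ[ℂ] N) (X : N →ₗ[ℂ] A ⊗[ℂ] N) (a u v w) (z) :
    M.ρ3 σ X a z u v w = M.rho (X a) (z u v w) - z u v (σ a w) - z u (σ a v) w - z (σ a u) v w := by
  simp [ρ3]

lemma ρ3_alt {σ : N →ₗ[ℂ] N →ₗ[ℂ] N} {X : N →ₗ[ℂ] A ⊗[ℂ] N} (a) {z : N →ₗ[ℂ] N →ₗ[ℂ] N →ₗ[ℂ] A}
    (hz : Alt3 z) : Alt3 (M.ρ3 σ X a z) := by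
  refine ⟨fun u v w => ?_, fun u v w => ?_⟩ <;> simp only [ρ3_apply]
  · rw [hz.1 u v w, hz.1 u v, hz.1 u _ w, hz.1 _ v w, map_neg]; ring
  · rw [hz.2 u v w, hz.2 u v, hz.2 u _ w, hz.2 _ v w, map_neg]; ring

lemma rho_comm {X : N →ₗ[ℂ] A ⊗[ℂ] N} {σ : N →ₗ[ℂ] N →ₗ[ℂ] N}
    (hbr : ∀ a u, M.lr.br (X a) (1 ⊗ₜ u) = 1 ⊗ₜ σ a u) (a b : N) (f : A) :
    M.D b (M.rho (X a) f) = M.rho (X a) (M.D b f) - M.D (σ a b) f := by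
  have := M.rho_br (X a) (1 ⊗ₜ b) f
  rw [hbr] at this
  simp only [rho_tmul, one_smul] at this
  rw [this]; ring

lemma ρ3_clo {σ : N →ₗ[ℂ] N →ₗ[ℂ] N} {X : N →ₗ[ℂ] A ⊗[ℂ] N}
    (hder : ∀ a b c : N, σ a ⁅b, c⁆ = ⁅σ a b, c⁆ + ⁅b, σ a c⁆)
    (hbr : ∀ a u, M.lr.br (X a) (1 ⊗ₜ u) = 1 ⊗ₜ σ a u) (s : N)
    {z : N →ₗ[ℂ] N →ₗ[ℂ] N →ₗ[ℂ] A} (hz : ∀ a b c e, M.d3c z a b c e = 0) (a b c e : N) :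
    M.d3c (M.ρ3 σ X s z) a b c e = 0 := by
  have h0 := congrArg (M.rho (X s)) (hz a b c e)
  have h1 := hz (σ s a) b c e
  have h2 := hz a (σ s b) c e
  have h3 := hz a b (σ s c) e
  have h4 := hz a b c (σ s e)
  simp only [d3c, map_add, map_sub, map_zero] at h0 h1 h2 h3 h4
  simp only [d3c, ρ3_apply, map_sub, hder, M.rho_comm hbr, map_add, LinearMap.add_apply]
  linear_combination h0 - h1 - h2 - h3 - h4

lemma lieD_ext {σ : N →ₗ[ℂ] N →ₗ[ℂ] N} {X : N →ₗ[ℂ] A ⊗[ℂ] N}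
    (hbr : ∀ a u, M.lr.br (X a) (1 ⊗ₜ u) = 1 ⊗ₜ σ a u) (s : N)
    {z : N →ₗ[ℂ] N →ₗ[ℂ] N →ₗ[ℂ] A} (hz : Alt3 z) (a b c : A ⊗[ℂ] N) :
    M.lr.lieD (ext3 z) (X s) a b c = ext3 (M.ρ3 σ X s z) a b c := by
  refine LR.lieD_eq (ext3_alt hz) _ span_one _ _ (ext3_alt (M.ρ3_alt s hz)) ?_ a b c
  rintro _ ⟨a, rfl⟩ _ ⟨b, rfl⟩ _ ⟨c, rfl⟩
  simp only [LR.lieD, hbr, ext3_one, ρ3_apply, lr_rho]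
  ring

/-- contraction of a form with `δ` -/
noncomputable def QE (P : G →ₗ[ℂ] G) : (N →ₗ[ℂ] N →ₗ[ℂ] N →ₗ[ℂ] A) →ₗ[ℂ] A where
  toFun z := Q P (fun x y w => ext3 z (M.δ S x) (M.δ S y) (M.δ S w))
  map_add' z z' := by simp only [map_add, LinearMap.add_apply, Q_add]
  map_smul' t z := by simp only [map_smul, LinearMap.smul_apply, Q_smul, RingHom.id_apply]

/-- forms -/
def ZZ (U : Submodule ℂ A) : Submodule ℂ (N →ₗ[ℂ] N →ₗ[ℂ] N →ₗ[ℂ] A) where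
  carrier := {z | Alt3 z ∧ (∀ a b c e, M.d3c z a b c e = 0) ∧ ∀ a b c, z a b c ∈ U}
  zero_mem' := ⟨⟨by simp, by simp⟩, by simp [d3c], by simp⟩
  add_mem' {z w} hz hw := by
    refine ⟨⟨fun a b c => ?_, fun a b c => ?_⟩, fun a b c e => ?_, fun a b c => ?_⟩
    · simp only [LinearMap.add_apply]; rw [hz.1.1, hw.1.1 a]; ring
    · simp only [LinearMap.add_apply]; rw [hz.1.2, hw.1.2 a]; ring
    · have h1 := hz.2.1 a b c e
      have h2 := hw.2.1 a b c e
      simp only [d3c, LinearMap.add_apply, map_add] at h1 h2 ⊢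
      linear_combination h1 + h2
    · exact add_mem (hz.2.2 a b c) (hw.2.2 a b c)
  smul_mem' t z hz := by
    refine ⟨⟨fun a b c => ?_, fun a b c => ?_⟩, fun a b c e => ?_, fun a b c => ?_⟩
    · simp only [LinearMap.smul_apply]; rw [hz.1.1, smul_neg]
    · simp only [LinearMap.smul_apply]; rw [hz.1.2, smul_neg]
    · have h1 := congrArg (fun f => t • f) (hz.2.1 a b c e)
      simp only [d3c, LinearMap.smul_apply, Derivation.map_smul, smul_add, smul_sub, smul_zero]
        at h1 ⊢
      exact h1
    · exact U.smul_mem t (hz.2.2 a b c)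

lemma ZZ_fin (U : Submodule ℂ A) [Module.Finite ℂ U] : Module.Finite ℂ (M.ZZ U) := by
  let b := finBasis ℂ N
  let ev : (i j k : Fin (finrank ℂ N)) → (N →ₗ[ℂ] N →ₗ[ℂ] N →ₗ[ℂ] A) →ₗ[ℂ] A := fun i j k =>
    LinearMap.applyₗ (b k) ∘ₗ LinearMap.applyₗ (b j) ∘ₗ LinearMap.applyₗ (b i)
  let L : M.ZZ U →ₗ[ℂ] (Fin (finrank ℂ N) → Fin (finrank ℂ N) → Fin (finrank ℂ N) → U) :=
    LinearMap.pi fun i => LinearMap.pi fun j => LinearMap.pi fun k =>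
      LinearMap.codRestrict U (ev i j k ∘ₗ (M.ZZ U).subtype) (fun z => z.2.2.2 _ _ _)
  refine Module.Finite.of_injective L ?_
  intro z w h
  apply Subtype.ext
  refine b.ext fun i => b.ext fun j => b.ext fun k => ?_
  have := congrArg Subtype.val (congrFun (congrFun (congrFun h i) j) k)
  exact this

lemma stage {σ : N →ₗ[ℂ] N →ₗ[ℂ] N} {X : N →ₗ[ℂ] A ⊗[ℂ] N} (hX : IsRep (M.rhoL X)) (hσ : IsRep σ)
    (hder : ∀ a b c : N, σ a ⁅b, c⁆ = ⁅σ a b, c⁆ + ⁅b, σ a c⁆)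
    (hbr : ∀ a u, M.lr.br (X a) (1 ⊗ₜ u) = 1 ⊗ₜ σ a u)
    (U : Submodule ℂ A) [Module.Finite ℂ U] (hU : ∀ a, ∀ f ∈ U, M.rho (X a) f ∈ U)
    (z : N →ₗ[ℂ] N →ₗ[ℂ] N →ₗ[ℂ] A) (hz : z ∈ M.ZZ U) :
    ∃ z0 ∈ M.ZZ U, (∀ a, M.ρ3 σ X a z0 = 0) ∧ ∀ P : G →ₗ[ℂ] G, Com P →
      M.QE S P z - M.QE S P z0 ∈ M.J S := by
  have hst : ∀ a, ∀ z ∈ M.ZZ U, M.ρ3 σ X a z ∈ M.ZZ U := by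
    intro a z hz
    refine ⟨M.ρ3_alt a hz.1, M.ρ3_clo hder hbr a hz.2.1, fun u v w => ?_⟩
    rw [ρ3_apply]
    exact sub_mem (sub_mem (sub_mem (hU _ _ (hz.2.2 _ _ _)) (hz.2.2 _ _ _)) (hz.2.2 _ _ _))
      (hz.2.2 _ _ _)
  have := M.ZZ_fin U
  have hr : IsRep (M.ρ3 σ X) := hσ.hom (hσ.hom (hσ.hom hX))
  obtain ⟨u, hu, hi⟩ := exists_inv_add_coinv (hr.restr (M.ZZ U) hst) ⟨z, hz⟩
  refine ⟨z - u.1, sub_mem hz u.2, fun a => ?_, fun P hP => ?_⟩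
  · have := congrArg Subtype.val ((mem_Inv _ _).1 hi a)
    simpa using this
  · have : M.QE S P u.1 ∈ M.J S := by
      have hle : Coinv (g := N) (E := M.ZZ U) (restr (M.ρ3 σ X) (M.ZZ U) hst) ≤
          (M.J S).comap (M.QE S P ∘ₗ (M.ZZ U).subtype) := by
        refine Submodule.span_le.2 ?_
        rintro _ ⟨a, v, rfl⟩
        show Q P (fun x y w => ext3 (M.ρ3 σ X a v.1) (M.δ S x) (M.δ S y) (M.δ S w)) ∈ M.J S
        simp only [← M.lieD_ext hbr a v.2.1]
        exact M.stokes S (ext3_alt v.2.1) ((M.clo_iff v.2.1).2 v.2.2.1) _ hP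
      exact hle hu
    rw [map_sub]
    simpa using this

end stokes
end Model
end PostLie

namespace PostLie
open Module TensorProduct

namespace Model
variable {A N : Type*} [CommRing A] [Algebra ℂ A] [LieRing N] [LieAlgebra ℂ N] (M : Model A N)
variable {G : Type*} [LieRing G] [LieAlgebra ℂ G] (S : DD G N)
variable [Module.Finite ℂ G] [LieAlgebra.IsKilling ℂ G]
variable [Module.Finite ℂ N] [LieAlgebra.IsKilling ℂ N]

lemma mem_of_basis (U : Submodule ℂ A) (f : N →ₗ[ℂ] A) (h : ∀ i, f (finBasis ℂ N i) ∈ U) (u : N) :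
    f u ∈ U := by
  rw [← (finBasis ℂ N).sum_repr u, map_sum]
  refine Submodule.sum_mem _ fun i _ => ?_
  rw [map_smul]
  exact U.smul_mem _ (h i)

lemma exists_U (z : N →ₗ[ℂ] N →ₗ[ℂ] N →ₗ[ℂ] A) : ∃ U : Submodule ℂ A, Module.Finite ℂ U ∧
    (∀ x, ∀ v ∈ U, M.rho (M.θ x) v ∈ U) ∧ ∀ u v w, z u v w ∈ U := by
  choose U hf hs hm using M.loc_θ
  let b := finBasis ℂ N
  let V : Fin (finrank ℂ N) × Fin (finrank ℂ N) × Fin (finrank ℂ N) → Submodule ℂ A :=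
    fun p => U (z (b p.1) (b p.2.1) (b p.2.2))
  have hle : ∀ p, V p ≤ ⨆ p, V p := fun p => le_iSup V p
  refine ⟨⨆ p, V p, ?_, ?_, ?_⟩
  · have : ∀ p, Module.Finite ℂ (V p) := fun p => hf _
    infer_instance
  · intro x
    have : (⨆ p, V p) ≤ (⨆ p, V p).comap (M.rhoL M.θ x) := by
      refine iSup_le fun p v hv => ?_
      exact hle p (hs _ _ _ hv)
    exact fun v hv => this hv
  · intro u v w
    refine mem_of_basis _ (z u v) (fun k => ?_) w
    refine mem_of_basis _ ((LinearMap.flip (z u)) (b k)) (fun j => ?_) v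
    refine mem_of_basis _ ((LinearMap.applyₗ (b k)) ∘ₗ (LinearMap.applyₗ (b j)) ∘ₗ z) (fun i => ?_) u
    exact hle (i, j, k) (hm _)

lemma D_zero_of_θ (f : A) (h : ∀ a, M.rho (M.θ a) f = 0) (a : N) : M.D a f = 0 := by
  have hs := span_of_bij M.θ M.bij_θ.2
  have h1 : ∀ X, M.rho X f = 0 := by
    intro X
    have hX : X ∈ Submodule.span A (Set.range M.θ) := by rw [hs]; trivial
    induction hX using Submodule.span_induction with
    | mem x hx => obtain ⟨a, rfl⟩ := hx; exact h a
    | zero => simp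
    | add x y _ _ hx hy => simp [hx, hy]
    | smul g x _ hx => simp [hx]
  simpa using h1 (1 ⊗ₜ a)

lemma two_stage (z : N →ₗ[ℂ] N →ₗ[ℂ] N →ₗ[ℂ] A) (hz : Alt3 z) (hc : ∀ a b c e, M.d3c z a b c e = 0) :
    ∃ (z1 : N →ₗ[ℂ] N →ₗ[ℂ] N →ₗ[ℂ] A) (w : N →ₗ[ℂ] N →ₗ[ℂ] N →ₗ[ℂ] ℂ), Alt3 w ∧
      (∀ a b c e : N, w ⁅a, b⁆ c e + w b ⁅a, c⁆ e + w b c ⁅a, e⁆ = 0) ∧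
      (∀ u v x, z1 u v x = algebraMap ℂ A (w u v x)) ∧
      ∀ P : G →ₗ[ℂ] G, Com P → M.QE S P z - M.QE S P z1 ∈ M.J S := by
  obtain ⟨U, hU, hs, hm⟩ := M.exists_U z
  obtain ⟨z0, hz0, hi0, hJ0⟩ := M.stage S (σ := 0) (X := - M.θ) M.rhoL_θ_rep (by intro x y v; simp)
    (by intros; simp) (by
      intro a u
      have := M.br_θ_const a u
      rw [lr_br] at this ⊢
      simp only [LinearMap.neg_apply, map_neg, LinearMap.zero_apply, tmul_zero, neg_lie]
      rw [← neg_eq_zero, ← this]; abel) U (by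
      intro a f hf
      simpa using hs a f hf) z ⟨hz, hc, hm⟩
  have hconst : ∀ u v w, z0 u v w = algebraMap ℂ A (M.ε (z0 u v w)) := by
    intro u v w
    refine M.const _ (M.D_zero_of_θ _ fun a => ?_)
    have := LinearMap.congr_fun (LinearMap.congr_fun (LinearMap.congr_fun (hi0 a) u) v) w
    rw [ρ3_apply] at this
    simpa using this
  let C : Submodule ℂ A := LinearMap.range (Algebra.linearMap ℂ A)
  have hD : ∀ (a : N), ∀ f ∈ C, M.D a f = 0 := by
    rintro a _ ⟨t, rfl⟩
    exact Derivation.map_algebraMap _ _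
  obtain ⟨z1, hz1, hi1, hJ1⟩ := M.stage S (σ := adL N) (X := TensorProduct.mk ℂ A N 1)
    (by intro a b f; simp [M.D_lie]) adL_rep (by intro a b c; simp)
    (by intro a u; simp [br_const]) C (by
      intro a f hf
      have := hD a f hf
      simp [this]) z0 ⟨hz0.1, hz0.2.1, fun u v w => ⟨_, (hconst u v w).symm⟩⟩
  have hc1 : ∀ u v w, z1 u v w = algebraMap ℂ A (M.ε (z1 u v w)) := by
    intro u v w
    exact M.const _ fun a => hD a _ (hz1.2.2 u v w)
  refine ⟨z1, LinearMap.compRight ℂ (LinearMap.compRight ℂ M.ε.toLinearMap) ∘ₗ z1,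
    ⟨fun a b c => ?_, fun a b c => ?_⟩, fun a b c e => ?_, fun u v x => hc1 u v x, fun P hP => ?_⟩
  · show M.ε (z1 a b c) = - M.ε (z1 b a c)
    rw [hz1.1.1, map_neg]
  · show M.ε (z1 a b c) = - M.ε (z1 a c b)
    rw [hz1.1.2, map_neg]
  · show M.ε (z1 ⁅a, b⁆ c e) + M.ε (z1 b ⁅a, c⁆ e) + M.ε (z1 b c ⁅a, e⁆) = 0
    have := LinearMap.congr_fun (LinearMap.congr_fun (LinearMap.congr_fun (hi1 a) b) c) e
    rw [ρ3_apply] at this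
    have h2 := hD a _ (hz1.2.2 b c e)
    simp only [TensorProduct.mk_apply, rho_tmul, one_smul, h2, adL_apply, LinearMap.zero_apply]
      at this
    have h3 := congrArg M.ε this
    simp only [map_sub, map_zero] at h3
    linear_combination -h3
  · have := add_mem (hJ0 P hP) (hJ1 P hP)
    simpa using this

/-- restriction of a form to the constants -/
noncomputable def toC (z : A ⊗[ℂ] N →ₗ[A] A ⊗[ℂ] N →ₗ[A] A ⊗[ℂ] N →ₗ[A] A) :
    N →ₗ[ℂ] N →ₗ[ℂ] N →ₗ[ℂ] A :=
  LinearMap.mk₂ ℂ (fun u v => (z (1 ⊗ₜ u) (1 ⊗ₜ v)).restrictScalars ℂ ∘ₗ TensorProduct.mk ℂ A N 1)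
    (by intros; ext; simp [tmul_add]) (by intros; ext; simp) (by intros; ext; simp [tmul_add])
    (by intros; ext; simp)

lemma ext3_toC (z : A ⊗[ℂ] N →ₗ[A] A ⊗[ℂ] N →ₗ[A] A ⊗[ℂ] N →ₗ[A] A) : ext3 (toC z) = z := by
  refine LinearMap.ext_on_range span_one fun u => LinearMap.ext_on_range span_one fun v =>
      LinearMap.ext_on_range span_one fun w => ?_
  rw [ext3_one]; rfl

variable (A) in
/-- the 3-form of an invariant bilinear form -/
noncomputable def trif (B : G →ₗ[ℂ] G →ₗ[ℂ] ℂ) : G →ₗ[ℂ] G →ₗ[ℂ] G →ₗ[ℂ] A :=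
  LinearMap.mk₂ ℂ (fun x y => Algebra.linearMap ℂ A ∘ₗ B ⁅x, y⁆)
    (by intros; ext; simp) (by intros; ext; simp [Algebra.smul_def]) (by intros; ext; simp)
    (by intros; ext; simp [Algebra.smul_def])

lemma trif_apply (B : G →ₗ[ℂ] G →ₗ[ℂ] ℂ) (x y z : G) :
    trif A B x y z = algebraMap ℂ A (B ⁅x, y⁆ z) := rfl

lemma exists_W (B : G →ₗ[ℂ] G →ₗ[ℂ] ℂ) (hs : ∀ x y, B x y = B y x)
    (hi : ∀ x y z : G, B ⁅x, y⁆ z = B x ⁅y, z⁆) :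
    ∃ (z : N →ₗ[ℂ] N →ₗ[ℂ] N →ₗ[ℂ] A), Alt3 z ∧ (∀ a b c e, M.d3c z a b c e = 0) ∧
      ∀ P : G →ₗ[ℂ] G, M.QE S P z = - ∑ i, algebraMap ℂ A (B (P (gb G i)) (gd G i)) := by
  let E := (LinearEquiv.ofBijective _ (M.bij_δ S)).symm
  have hE : ∀ x, E (M.δ S x) = 1 ⊗ₜ x := by
    intro x
    rw [LinearEquiv.symm_apply_eq]
    simp
  have ht : Alt3 (trif A B) := by
    refine ⟨fun x y z => ?_, fun x y z => ?_⟩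
    · rw [trif_apply, trif_apply, ← lie_skew x y, map_neg, LinearMap.neg_apply, map_neg]
    · rw [trif_apply, trif_apply, hi, ← lie_skew y z, map_neg, hi, map_neg]
  let z : A ⊗[ℂ] N →ₗ[A] A ⊗[ℂ] N →ₗ[A] A ⊗[ℂ] N →ₗ[A] A :=
    ((ext3 (trif A B)).compl₁₂ E.toLinearMap E.toLinearMap).compr₂ (LinearMap.lcomp A A E.toLinearMap)
  have hzδ : ∀ x y w, z (M.δ S x) (M.δ S y) (M.δ S w) = algebraMap ℂ A (B ⁅x, y⁆ w) := by
    intro x y w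
    show ext3 (trif A B) (E (M.δ S x)) (E (M.δ S y)) (E (M.δ S w)) = _
    rw [hE, hE, hE, ext3_one, trif_apply]
  have hza : LR.Alt z := ⟨fun a b c => (ext3_alt ht).1 _ _ _, fun a b c => (ext3_alt ht).2 _ _ _⟩
  have hA : Alt3 (toC z) := ⟨fun a b c => hza.1 _ _ _, fun a b c => hza.2 _ _ _⟩
  refine ⟨toC z, hA, (M.clo_iff hA).1 ?_, fun P => ?_⟩
  · rw [ext3_toC]
    refine LR.d3_eq_zero hza _ (span_of_bij (M.δ S) (M.bij_δ S).2) ?_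
    rintro _ ⟨a, rfl⟩ _ ⟨b, rfl⟩ _ ⟨c, rfl⟩ _ ⟨e, rfl⟩
    simp only [LR.d3, br_δ, hzδ, Derivation.map_algebraMap, ← map_add, ← map_sub, ← map_zero
      (algebraMap ℂ A)]
    congr 1
    have h1 : B ⁅⁅a, b⁆, c⁆ e + B ⁅b, ⁅a, c⁆⁆ e + B ⁅b, c⁆ ⁅a, e⁆ = 0 := by
      rw [← LinearMap.add_apply, ← map_add, ← leibniz_lie, ← lie_skew, map_neg,
        LinearMap.neg_apply, hi]
      simp
    have h2 : B ⁅a, ⁅b, c⁆⁆ e + B ⁅a, ⁅c, e⁆⁆ b + B ⁅a, ⁅e, b⁆⁆ c = 0 := by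
      rw [hi, hi, hi, ← map_add, ← map_add]
      have : ⁅⁅b, c⁆, e⁆ + ⁅⁅c, e⁆, b⁆ + ⁅⁅e, b⁆, c⁆ = 0 := by
        rw [← lie_skew ⁅b, c⁆, ← lie_skew ⁅c, e⁆, ← lie_skew ⁅e, b⁆]
        have := lie_jacobi b c e
        rw [← neg_eq_zero, ← this]; abel
      rw [this, map_zero]
    linear_combination -h1 + h2
  · show Q P (fun x y w => ext3 (toC z) (M.δ S x) (M.δ S y) (M.δ S w)) = _
    simp only [ext3_toC, hzδ, hi]
    exact q4 P (B.compr₂ (Algebra.linearMap ℂ A))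

end Model
end PostLie

namespace PostLie
open Module TensorProduct

section threeform
variable {N : Type*} [LieRing N] [LieAlgebra ℂ N] [Module.Finite ℂ N] [LieAlgebra.IsKilling ℂ N]

lemma T_sym (T : N → N → N → N → ℂ) (A1 : ∀ a b c d, T a b c d = - T b a c d)
    (A2 : ∀ a b c d, T a b c d = - T a b d c)
    (R : ∀ a b c d, T a b c d + T a c d b + T a d b c = 0) (a b c d : N) :
    T a b c d = T c d a b := by
  have Ra := R a b c d
  have Rb := R b a c d
  have Rc := R c a b d
  have Rd := R d a b c
  have e1 := A1 b a c d
  have e2 : T b d a c = - T d b a c := A1 _ _ _ _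
  have e3 : T b c d a = - T b c a d := A2 _ _ _ _
  have e4 : T c a b d = T a c d b := by rw [A1, A2, neg_neg]
  have e5 : T c b d a = T b c a d := by rw [A1, A2, neg_neg]
  have e6 : T d a b c = - T a d b c := A1 _ _ _ _
  have e7 : T d b c a = - T d b a c := A2 _ _ _ _
  have e8 : T d c a b = - T c d a b := A1 _ _ _ _
  grind

lemma exists_kappa (w : N →ₗ[ℂ] N →ₗ[ℂ] N →ₗ[ℂ] ℂ) (hw : Model.Alt3 w)
    (hi : ∀ a b c e : N, w ⁅a, b⁆ c e + w b ⁅a, c⁆ e + w b c ⁅a, e⁆ = 0) :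
    ∃ κ : N →ₗ[ℂ] N →ₗ[ℂ] ℂ, (∀ x y, κ x y = κ y x) ∧
      (∀ x y z : N, κ ⁅x, y⁆ z = κ x ⁅y, z⁆) ∧ ∀ u v x, w u v x = κ ⁅u, v⁆ x := by
  obtain ⟨T, hT⟩ : ∃ T : N → N → N → N → ℂ, ∀ a b c d : N, T a b c d = w ⁅a, b⁆ c d :=
    ⟨fun a b c d => w ⁅a, b⁆ c d, fun _ _ _ _ => rfl⟩
  have A1 : ∀ a b c d, T a b c d = - T b a c d := by
    intro a b c d
    rw [hT, hT, ← lie_skew a b, map_neg, LinearMap.neg_apply, LinearMap.neg_apply]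
  have A2 : ∀ a b c d, T a b c d = - T a b d c := by
    intro a b c d
    rw [hT, hT]; exact hw.2 _ _ _
  have R : ∀ a b c d, T a b c d + T a c d b + T a d b c = 0 := by
    intro a b c d
    rw [hT, hT, hT, ← hi a b c d, hw.2 ⁅a, c⁆ d b, hw.1 ⁅a, c⁆ b d, hw.2 b c, hw.1 b ⁅a, d⁆]
    ring
  have hs := T_sym T A1 A2 R
  have hcyc : ∀ a b c : N, w a b c = w b c a := fun a b c => by rw [hw.1 a b, hw.2 b a, neg_neg]
  -- functionals
  have hβ : ∀ x, ∃ s : N, ∀ u v : N, w u v x = kf N s ⁅u, v⁆ := by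
    intro x
    let F : N →ₗ[ℂ] N := ((kf N).toDual (kf_nd N)).symm.toLinearMap ∘ₗ w x
    have hF : ∀ u v, kf N (F u) v = w x u v := fun u v =>
      LinearMap.BilinForm.apply_toDual_symm_apply (B := kf N) (hB := kf_nd N) (w x u) v
    let D : LieDerivation ℂ N N := ⟨F, by
      intro u v
      apply kf_eq
      intro y
      rw [map_sub, LinearMap.sub_apply, ← lie_skew u (F v), ← lie_skew v (F u), map_neg, map_neg,
        LinearMap.neg_apply, LinearMap.neg_apply, kf_inv, kf_inv, hF, hF, hF]
      have e1 : w x ⁅u, v⁆ y = T u v y x := by rw [hT]; exact hcyc _ _ _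
      have e2 : w x v ⁅u, y⁆ = T u y x v := by rw [hT, hcyc x, hcyc v]
      have e3 : w x u ⁅v, y⁆ = T v y x u := by rw [hT, hcyc x, hcyc u]
      rw [e1, e2, e3]
      have r1 := R x u v y
      have r2 := hs u v y x
      have r3 := hs u y x v
      have r4 := hs v y x u
      have r5 := A1 y x u v
      have r6 := A2 x v u y
      grind⟩
    obtain ⟨s, hs⟩ := LieDerivation.IsKilling.exists_eq_ad D
    refine ⟨s, fun u v => ?_⟩
    have h1 : ⁅s, u⁆ = F u := by
      have := LieDerivation.congr_fun hs u
      rwa [LieDerivation.ad_apply_apply] at this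
    rw [← kf_inv, h1, hF, ← hcyc]
  choose s hs' using hβ
  have huniq : ∀ a b : N, (∀ u v : N, kf N a ⁅u, v⁆ = kf N b ⁅u, v⁆) → a = b := by
    intro a b h
    have : kf N a - kf N b = 0 := perfect_induction _ (fun u v => by
      rw [LinearMap.sub_apply, h, sub_self])
    exact kf_eq _ _ fun y => by
      have := LinearMap.congr_fun this y
      simpa [sub_eq_zero] using this
  let sl : N →ₗ[ℂ] N :=
    { toFun := s
      map_add' := fun x y => huniq _ _ fun u v => by
        rw [← hs', map_add, map_add, LinearMap.add_apply, ← hs', ← hs']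
      map_smul' := fun t x => huniq _ _ fun u v => by
        rw [← hs', map_smul, RingHom.id_apply, map_smul, LinearMap.smul_apply, ← hs'] }
  let κ : N →ₗ[ℂ] N →ₗ[ℂ] ℂ := ((kf N) ∘ₗ sl).flip
  have hκ : ∀ u v x, w u v x = κ ⁅u, v⁆ x := fun u v x => hs' x u v
  have hsym : κ - κ.flip = 0 := by
    refine perfect_induction _ fun a b => ?_
    refine perfect_induction _ fun c d => ?_
    simp only [LinearMap.sub_apply, LinearMap.flip_apply]
    rw [← hκ, ← hκ, hcyc a, hcyc b, hcyc c, hcyc d, ← hT, ← hT, hs, sub_self]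
  have hsym' : ∀ x y, κ x y = κ y x := by
    intro x y
    have := LinearMap.congr_fun (LinearMap.congr_fun hsym x) y
    simpa [sub_eq_zero] using this
  refine ⟨κ, hsym', ?_, hκ⟩
  intro x y z
  rw [hsym' x, ← hκ, ← hκ, hcyc]

end threeform

namespace Model
variable {A N : Type*} [CommRing A] [Algebra ℂ A] [LieRing N] [LieAlgebra ℂ N] (M : Model A N)
variable {G : Type*} [LieRing G] [LieAlgebra ℂ G] (S : DD G N)

variable (A) in
/-- base change of a bilinear form -/
noncomputable def KA (κ : N →ₗ[ℂ] N →ₗ[ℂ] ℂ) : A ⊗[ℂ] N →ₗ[A] A ⊗[ℂ] N →ₗ[A] A :=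
  lb A ((lb A (V := N) (P := A)) ∘ₗ (κ.compr₂ (Algebra.linearMap ℂ A)))

lemma KA_tmul (κ : N →ₗ[ℂ] N →ₗ[ℂ] ℂ) (f g : A) (u v : N) :
    KA A κ (f ⊗ₜ u) (g ⊗ₜ v) = f * (g * algebraMap ℂ A (κ u v)) := by
  simp [KA, lb_tmul]

lemma KA_symm {κ : N →ₗ[ℂ] N →ₗ[ℂ] ℂ} (hs : ∀ x y, κ x y = κ y x) (X Y : A ⊗[ℂ] N) :
    KA A κ X Y = KA A κ Y X := by
  induction X using TensorProduct.induction_on with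
  | zero => simp
  | add X X' h h' => simp [h, h']
  | tmul f u =>
    induction Y using TensorProduct.induction_on with
    | zero => simp
    | add X X' h h' => simp [h, h']
    | tmul g v => rw [KA_tmul, KA_tmul, hs]; ring

lemma KA_inv {κ : N →ₗ[ℂ] N →ₗ[ℂ] ℂ} (hi : ∀ x y z : N, κ ⁅x, y⁆ z = κ x ⁅y, z⁆)
    (X Y Z : A ⊗[ℂ] N) : KA A κ ⁅X, Y⁆ Z = KA A κ X ⁅Y, Z⁆ := by
  induction X using TensorProduct.induction_on with
  | zero => simp
  | add X X' h h' => simp [h, h']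
  | tmul f u =>
    induction Y using TensorProduct.induction_on with
    | zero => simp
    | add X X' h h' => simp only [h, h', lie_add, add_lie, map_add, LinearMap.add_apply]
    | tmul g v =>
      induction Z using TensorProduct.induction_on with
      | zero => simp
      | add X X' h h' => simp only [h, h', lie_add, map_add]
      | tmul k w =>
        rw [LieAlgebra.ExtendScalars.bracket_tmul, LieAlgebra.ExtendScalars.bracket_tmul,
          KA_tmul, KA_tmul, hi]; ring

lemma D_KA (κ : N →ₗ[ℂ] N →ₗ[ℂ] ℂ) (a : N) (X Y : A ⊗[ℂ] N) :
    M.D a (KA A κ X Y) = KA A κ (M.nab (1 ⊗ₜ a) X) Y + KA A κ X (M.nab (1 ⊗ₜ a) Y) := by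
  induction X using TensorProduct.induction_on with
  | zero => simp
  | add X X' h h' => simp only [h, h', map_add, LinearMap.add_apply]; ring
  | tmul f u =>
    induction Y using TensorProduct.induction_on with
    | zero => simp
    | add X X' h h' => simp only [h, h', map_add]; ring
    | tmul g v =>
      simp only [KA_tmul, nab_tmul, Derivation.leibniz, Derivation.map_algebraMap, smul_eq_mul]
      ring

lemma ε_KA (κ : N →ₗ[ℂ] N →ₗ[ℂ] ℂ) (X Y : A ⊗[ℂ] N) :
    M.ε (KA A κ X Y) = κ (TensorProduct.lid ℂ N (M.ε.toLinearMap.rTensor N X))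
      (TensorProduct.lid ℂ N (M.ε.toLinearMap.rTensor N Y)) := by
  induction X using TensorProduct.induction_on with
  | zero => simp
  | add X X' h h' => simp only [h, h', map_add, LinearMap.add_apply]
  | tmul f u =>
    induction Y using TensorProduct.induction_on with
    | zero => simp
    | add X X' h h' => simp only [h, h', map_add]
    | tmul g v =>
      simp [KA_tmul]
      ring

lemma KA_θ {κ : N →ₗ[ℂ] N →ₗ[ℂ] ℂ} (hi : ∀ x y z : N, κ ⁅x, y⁆ z = κ x ⁅y, z⁆)
    (u v : N) : KA A κ (M.θ u) (M.θ v) = algebraMap ℂ A (κ u v) := by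
  have := M.const (KA A κ (M.θ u) (M.θ v)) (fun a => by
    rw [D_KA, nab_θ, nab_θ, ← lie_skew (1 ⊗ₜ a : A ⊗[ℂ] N) (M.θ u), neg_neg, KA_inv hi, map_neg]
    ring)
  rw [this, ε_KA, M.θ_one, M.θ_one]

lemma ext3_KA {κ : N →ₗ[ℂ] N →ₗ[ℂ] ℂ} (z : N →ₗ[ℂ] N →ₗ[ℂ] N →ₗ[ℂ] A)
    (hz : ∀ u v x : N, z u v x = algebraMap ℂ A (κ ⁅u, v⁆ x)) (X Y Z : A ⊗[ℂ] N) :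
    ext3 z X Y Z = KA A κ ⁅X, Y⁆ Z := by
  let L : A ⊗[ℂ] N →ₗ[A] A ⊗[ℂ] N →ₗ[A] A ⊗[ℂ] N →ₗ[A] A :=
    LinearMap.mk₂ A (fun X Y => KA A κ ⁅X, Y⁆) (by intros; simp) (by intros; simp)
      (by intros; simp) (by intros; simp)
  have : ext3 z = L := by
    refine LinearMap.ext_on_range span_one fun u => LinearMap.ext_on_range span_one fun v =>
      LinearMap.ext_on_range span_one fun w => ?_
    rw [ext3_one, hz]
    show _ = KA A κ ⁅_, _⁆ _
    rw [one_lie, KA_tmul]; simp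
  rw [this]; rfl

variable [Module.Finite ℂ G] [LieAlgebra.IsKilling ℂ G]
variable [Module.Finite ℂ N] [LieAlgebra.IsKilling ℂ N]

lemma QE_kappa {κ : N →ₗ[ℂ] N →ₗ[ℂ] ℂ} (hs : ∀ x y, κ x y = κ y x)
    (hi : ∀ x y z : N, κ ⁅x, y⁆ z = κ x ⁅y, z⁆) (z : N →ₗ[ℂ] N →ₗ[ℂ] N →ₗ[ℂ] A)
    (hz : ∀ u v x : N, z u v x = algebraMap ℂ A (κ ⁅u, v⁆ x)) {P : G →ₗ[ℂ] G} (hP : Com P) :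
    M.QE S P z = - ∑ i, algebraMap ℂ A (κ (S.ψ (P (gb G i))) (S.ψ (gd G i)))
      + ∑ i, algebraMap ℂ A (κ (S.φ (P (gb G i))) (S.φ (gd G i))) := by
  let p : G →ₗ[ℂ] A ⊗[ℂ] N := TensorProduct.mk ℂ A N 1 ∘ₗ S.ψ.toLinearMap
  let t : G →ₗ[ℂ] A ⊗[ℂ] N := M.θ ∘ₗ S.φ.toLinearMap
  have hp : ∀ x y, ⁅p x, p y⁆ = p ⁅x, y⁆ := fun x y => by simp [p]
  have ht : ∀ x y, ⁅t x, t y⁆ = t ⁅x, y⁆ := fun x y => by simp [t, M.θ_lie]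
  have hδ : ∀ x, M.δ S x = p x - t x := fun x => rfl
  let h : G →ₗ[ℂ] G →ₗ[ℂ] A := LinearMap.mk₂ ℂ (fun x y => KA A κ (p x) (t y) - KA A κ (p y) (t x))
    (by intros; simp; ring) (by intros; simp [smul_sub]) (by intros; simp; ring)
    (by intros; simp [smul_sub])
  have hh : ∀ x y, h x y = - h y x := fun x y => by simp [h]
  let h1 : G →ₗ[ℂ] G →ₗ[ℂ] A :=
    (κ.compl₁₂ S.ψ.toLinearMap S.ψ.toLinearMap).compr₂ (Algebra.linearMap ℂ A)
  let h2 : G →ₗ[ℂ] G →ₗ[ℂ] A :=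
    (κ.compl₁₂ S.φ.toLinearMap S.φ.toLinearMap).compr₂ (Algebra.linearMap ℂ A)
  have e : (fun x y w => ext3 z (M.δ S x) (M.δ S y) (M.δ S w)) = fun x y w =>
      (h1 x ⁅y, w⁆ - h2 x ⁅y, w⁆) - ((h ⁅x, y⁆ w + h ⁅y, w⁆ x) + h ⁅w, x⁆ y) := by
    funext x y w
    have i1 : ∀ x y z, KA A κ ⁅p x, t y⁆ (p z) = KA A κ (p ⁅z, x⁆) (t y) := by
      intro x y z
      rw [KA_symm hs, ← KA_inv hi, hp]
    have i2 : ∀ x y z, KA A κ ⁅t x, p y⁆ (p z) = KA A κ (p ⁅y, z⁆) (t x) := by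
      intro x y z
      rw [KA_inv hi, hp, KA_symm hs]
    have i3 : ∀ x y z, KA A κ ⁅p x, t y⁆ (t z) = KA A κ (p x) (t ⁅y, z⁆) := by
      intro x y z
      rw [KA_inv hi, ht]
    have i4 : ∀ x y z, KA A κ ⁅t x, p y⁆ (t z) = KA A κ (p y) (t ⁅z, x⁆) := by
      intro x y z
      rw [KA_symm hs, ← KA_inv hi, ht, KA_symm hs]
    have i5 : KA A κ (p ⁅x, y⁆) (p w) = h1 x ⁅y, w⁆ := by
      rw [← hp, KA_inv hi, hp]
      simp [p, h1, KA_tmul]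
    have i6 : KA A κ (t ⁅x, y⁆) (t w) = h2 x ⁅y, w⁆ := by
      rw [← ht, KA_inv hi, ht]
      simp [t, h2, M.KA_θ hi]
    have i7 : KA A κ (t ⁅x, y⁆) (p w) = KA A κ (p w) (t ⁅x, y⁆) := KA_symm hs _ _
    rw [ext3_KA z hz, hδ, hδ, hδ]
    simp only [sub_lie, lie_sub, map_sub, LinearMap.sub_apply, hp, ht, i1, i2, i3, i4, i5, i6, i7]
    simp only [h, LinearMap.mk₂_apply]
    ring
  show Q P (fun x y w => ext3 z (M.δ S x) (M.δ S y) (M.δ S w)) = _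
  rw [e, Q_sub, Q_add P (fun x y w => h ⁅x, y⁆ w + h ⁅y, w⁆ x), Q_add P (fun x y w => h ⁅x, y⁆ w),
    q1 hP h hh, q2 hP h hh, q3 hP h hh, Q_sub P (fun x y w => h1 x ⁅y, w⁆), q4, q4]
  simp [h1, h2]

/-- Main identity. -/
theorem main_id (M : Model A N) (B : G →ₗ[ℂ] G →ₗ[ℂ] ℂ) (hs : ∀ x y, B x y = B y x)
    (hi : ∀ x y z : G, B ⁅x, y⁆ z = B x ⁅y, z⁆) :
    ∃ κ : N →ₗ[ℂ] N →ₗ[ℂ] ℂ, (∀ x y, κ x y = κ y x) ∧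
      (∀ x y z : N, κ ⁅x, y⁆ z = κ x ⁅y, z⁆) ∧ ∀ P : G →ₗ[ℂ] G, Com P →
      ∑ i, B (P (gb G i)) (gd G i) = ∑ i, (κ (S.ψ (P (gb G i))) (S.ψ (gd G i))
        - κ (S.φ (P (gb G i))) (S.φ (gd G i))) := by
  obtain ⟨z, hza, hzc, hQ⟩ := M.exists_W S B hs hi
  obtain ⟨z1, w, hw, hwi, hzw, hJ⟩ := M.two_stage S z hza hzc
  obtain ⟨κ, hκs, hκi, hκ⟩ := exists_kappa w hw hwi
  refine ⟨κ, hκs, hκi, fun P hP => ?_⟩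
  have h1 := hJ P hP
  rw [hQ, M.QE_kappa S hκs hκi z1 (fun u v x => by rw [hzw, hκ]) hP] at h1
  simp only [← map_sum, ← map_neg, ← map_add, ← map_sub] at h1
  have h2 := M.algebraMap_mem_J S _ h1
  rw [Finset.sum_sub_distrib]
  linear_combination -h2

end Model
end PostLie

namespace PostLie
open Module TensorProduct

section decomposition
variable {L : Type*} [LieRing L] [LieAlgebra ℂ L] [Module.Finite ℂ L] [LieAlgebra.IsKilling ℂ L]

lemma Com.comm {P Q : L →ₗ[ℂ] L} (hP : Com P) (hQ : Com Q) (x : L) : P (Q x) = Q (P x) := by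
  have := perfect_induction (P ∘ₗ Q - Q ∘ₗ P) (fun x y => by
    simp only [LinearMap.sub_apply, LinearMap.comp_apply]
    rw [hQ, hP.right, hP.right, hQ, sub_self])
  have := LinearMap.congr_fun this x
  simpa [sub_eq_zero] using this

variable (L) in
/-- index type of the simple ideals -/
abbrev Idx := {I : LieIdeal ℂ L // IsAtom I}

instance : Finite (Idx L) :=
  (WellFoundedGT.finite_of_sSupIndep
    (LieAlgebra.IsSemisimple.sSupIndep_isAtom (R := ℂ) (L := L))).to_subtype

noncomputable instance : Fintype (Idx L) := Fintype.ofFinite _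

lemma isCompl_idx (I : LieIdeal ℂ L) :
    IsCompl (I : Submodule ℂ L) (LieIdeal.killingCompl ℂ L I : Submodule ℂ L) :=
  LieSubmodule.isCompl_toSubmodule.2 (LieIdeal.isCompl_killingCompl I)

/-- projection to an ideal -/
noncomputable def prj (I : LieIdeal ℂ L) : L →ₗ[ℂ] L :=
  Submodule.projection _ _ (isCompl_idx I)

lemma prj_mem (I : LieIdeal ℂ L) (x : L) : prj I x ∈ I :=
  Submodule.projection_apply_mem (isCompl_idx I) x

lemma prj_of_mem (I : LieIdeal ℂ L) {x : L} (hx : x ∈ I) : prj I x = x :=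
  Submodule.projection_apply_left (isCompl_idx I) ⟨x, hx⟩

lemma prj_of_compl (I : LieIdeal ℂ L) {x : L} (hx : x ∈ LieIdeal.killingCompl ℂ L I) :
    prj I x = 0 :=
  Submodule.projection_apply_right (isCompl_idx I) ⟨x, hx⟩

lemma sub_prj_mem (I : LieIdeal ℂ L) (x : L) : x - prj I x ∈ LieIdeal.killingCompl ℂ L I :=
  Submodule.sub_projection_mem (isCompl_idx I) x

lemma prj_com (I : LieIdeal ℂ L) : Com (prj I) := by
  intro x y
  have h1 : ⁅x, y⁆ = ⁅prj I x, y⁆ + ⁅x - prj I x, y⁆ := by rw [← add_lie]; simp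
  rw [h1, map_add, prj_of_mem I (lie_mem_left ℂ L I _ y (prj_mem I x)),
    prj_of_compl I (lie_mem_left ℂ L _ _ y (sub_prj_mem I x)), add_zero]

lemma prj_idem (I : LieIdeal ℂ L) (x : L) : prj I (prj I x) = prj I x :=
  prj_of_mem I (prj_mem I x)

lemma prj_lie (I : LieIdeal ℂ L) (x y : L) : prj I ⁅x, y⁆ = ⁅prj I x, prj I y⁆ := by
  rw [← prj_idem, (prj_com I).right x y, prj_com I]

/-- the range of a commuting map is an ideal -/
def Com.rangeI {P : L →ₗ[ℂ] L} (hP : Com P) : LieIdeal ℂ L :=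
  { LinearMap.range P with
    lie_mem := by
      rintro x _ ⟨y, rfl⟩
      exact ⟨⁅x, y⁆, hP.right x y⟩ }

/-- the kernel of a commuting map is an ideal -/
def Com.kerI {P : L →ₗ[ℂ] L} (hP : Com P) : LieIdeal ℂ L :=
  { LinearMap.ker P with
    lie_mem := by
      intro x y (hy : P y = 0)
      change P ⁅x, y⁆ = 0
      rw [hP.right, hy, lie_zero] }

lemma Com.mem_kerI {P : L →ₗ[ℂ] L} (hP : Com P) (x : L) : x ∈ hP.kerI ↔ P x = 0 := Iff.rfl

lemma Com.mem_rangeI {P : L →ₗ[ℂ] L} (hP : Com P) (x : L) : x ∈ hP.rangeI ↔ ∃ y, P y = x :=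
  Iff.rfl

lemma prj_ortho {I J : Idx L} (h : I ≠ J) (x : L) : prj I.1 (prj J.1 x) = 0 := by
  have h1 : I.1 ⊓ J.1 = ⊥ := by
    have := I.2.disjoint_of_ne J.2 (fun h' => h (Subtype.ext h'))
    exact this.eq_bot
  have h2 : prj I.1 (prj J.1 x) ∈ I.1 ⊓ J.1 := by
    refine LieSubmodule.mem_inf _ _ _ |>.2 ⟨prj_mem _ _, ?_⟩
    rw [(prj_com I.1).comm (prj_com J.1)]
    exact prj_mem _ _
  rw [h1] at h2
  exact (LieSubmodule.mem_bot _).1 h2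

lemma sum_prj (x : L) : ∑ I : Idx L, prj I.1 x = x := by
  classical
  set E : L →ₗ[ℂ] L := LinearMap.id - ∑ I : Idx L, prj I.1 with hE
  have hEx : ∀ x, E x = x - ∑ I : Idx L, prj I.1 x := fun x => by simp [hE]
  have hc : Com E := by
    intro x y
    rw [hEx, hEx, sub_lie, sum_lie]
    congr 1
    exact Finset.sum_congr rfl fun I _ => prj_com I.1 x y
  have hJ : ∀ (J : Idx L) x, prj J.1 (E x) = 0 := by
    intro J x
    rw [hEx, map_sub, map_sum, Finset.sum_eq_single J, prj_idem, sub_self]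
    · intro K _ hK; exact prj_ortho hK.symm x
    · simp
  rcases eq_bot_or_exists_atom_le hc.rangeI with h | ⟨J, hJa, hJle⟩
  · have : E x ∈ hc.rangeI := ⟨x, rfl⟩
    rw [h, LieSubmodule.mem_bot, hEx, sub_eq_zero] at this
    exact this.symm
  · exfalso
    apply hJa.1
    rw [LieSubmodule.eq_bot_iff]
    intro z hz
    obtain ⟨y, rfl⟩ := (hc.mem_rangeI z).1 (hJle hz)
    rw [← prj_of_mem J hz, hJ ⟨J, hJa⟩]

lemma simple_alt (I : Idx L) (K : LieIdeal ℂ L) :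
    (∀ x, prj I.1 x ∈ K) ∨ ∀ x, prj I.1 x ∈ K → prj I.1 x = 0 := by
  rcases I.2.le_iff.1 (inf_le_right : K ⊓ I.1 ≤ I.1) with h | h
  · right
    intro x hx
    have : prj I.1 x ∈ K ⊓ I.1 := (LieSubmodule.mem_inf _ _ _).2 ⟨hx, prj_mem _ _⟩
    rw [h] at this
    exact (LieSubmodule.mem_bot _).1 this
  · left
    intro x
    have h2 : prj I.1 x ∈ K ⊓ I.1 := by rw [h]; exact prj_mem _ _
    exact ((LieSubmodule.mem_inf _ _ _).1 h2).1

lemma prj_ne (I : Idx L) : prj I.1 ≠ 0 := by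
  intro h
  apply I.2.1
  rw [LieSubmodule.eq_bot_iff]
  intro x hx
  rw [← prj_of_mem I.1 hx, h, LinearMap.zero_apply]

lemma schur {S : L →ₗ[ℂ] L} (hS : Com S) (I : Idx L) : ∃ t : ℂ, ∀ x, S (prj I.1 x) = t • prj I.1 x := by
  have hst : ∀ x ∈ (I.1 : Submodule ℂ L), S x ∈ (I.1 : Submodule ℂ L) := by
    intro x hx
    have : S x = prj I.1 (S x) := by
      rw [(prj_com I.1).comm hS, prj_of_mem I.1 hx]
    rw [this]; exact prj_mem _ _
  have hnt : Nontrivial (I.1 : Submodule ℂ L) := by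
    rw [Submodule.nontrivial_iff_ne_bot]
    intro h
    apply I.2.1
    exact (LieSubmodule.toSubmodule_eq_bot _).1 h
  obtain ⟨t, ht⟩ := Module.End.exists_eigenvalue (S.restrict hst)
  obtain ⟨v, hv⟩ := ht.exists_hasEigenvector
  have hv1 : S v.1 = t • v.1 := congrArg Subtype.val hv.apply_eq_smul
  have hc : Com (S - t • LinearMap.id) := by
    intro x y
    simp [hS x y]
  refine ⟨t, ?_⟩
  rcases simple_alt I hc.kerI with h | h
  · intro x
    have := (hc.mem_kerI _).1 (h x)
    simpa [sub_eq_zero] using this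
  · exfalso
    have h3 := h v.1 (by
      rw [hc.mem_kerI, prj_of_mem I.1 v.2]; simp [hv1])
    rw [prj_of_mem I.1 v.2] at h3
    exact hv.2 (Subtype.ext h3)

lemma invariant_form (κ : L →ₗ[ℂ] L →ₗ[ℂ] ℂ) (hs : ∀ x y, κ x y = κ y x)
    (hi : ∀ x y z, κ ⁅x, y⁆ z = κ x ⁅y, z⁆) :
    ∃ t : Idx L → ℂ, ∀ x y, κ x y = ∑ i : Idx L, t i * kf L (prj i.1 x) y := by
  set S : L →ₗ[ℂ] L := ((kf L).toDual (kf_nd L)).symm.toLinearMap ∘ₗ κ with hS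
  have hSx : ∀ x y, kf L (S x) y = κ x y := fun x y =>
    LinearMap.BilinForm.apply_toDual_symm_apply (B := kf L) (hB := kf_nd L) (κ x) y
  have hc : Com S := by
    intro x y
    apply kf_eq
    intro w
    rw [kf_inv, hSx, hSx, hi]
  choose t ht using schur hc
  refine ⟨t, fun x y => ?_⟩
  rw [← hSx]
  conv_lhs => rw [← sum_prj x]
  simp only [map_sum, LinearMap.sum_apply, ht, map_smul, LinearMap.smul_apply, smul_eq_mul]

end decomposition

section hall

lemma hall_matrix {I J : Type*} [Fintype I] [Fintype J] (t : J → I → ℂ) (m : I → J → ℂ) (d : J → ℂ)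
    (hd : ∀ j, d j ≠ 0) [DecidableEq J]
    (h : ∀ k j, (∑ i, t k i * m i j) = if k = j then d j else 0) :
    ∃ p : J → I, Function.Injective p ∧ ∀ j, m (p j) j ≠ 0 := by
  classical
  obtain ⟨f, hf, hf2⟩ := (Finset.all_card_le_biUnion_card_iff_exists_injective
    (fun j : J => Finset.univ.filter fun i : I => m i j ≠ 0)).1 (by
    intro s
    set U := s.biUnion (fun j : J => Finset.univ.filter fun i : I => m i j ≠ 0) with hU
    have hz : ∀ j ∈ s, ∀ i, i ∉ U → m i j = 0 := by
      intro j hj i hi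
      by_contra hne
      exact hi (Finset.mem_biUnion.2 ⟨j, hj, by simp [hne]⟩)
    have hli : LinearIndependent ℂ (fun (j : s) (i : U) => m i.1 j.1) := by
      rw [Fintype.linearIndependent_iff]
      intro c hc k
      have h1 : ∀ i : I, ∑ j : s, c j * m i j.1 = 0 := by
        intro i
        by_cases hi : i ∈ U
        · have := congrFun hc ⟨i, hi⟩
          simpa using this
        · exact Finset.sum_eq_zero fun j _ => by rw [hz j.1 j.2 i hi, mul_zero]
      have h2 : ∑ i, t k.1 i * ∑ j : s, c j * m i j.1 = c k * d k.1 := by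
        simp only [Finset.mul_sum]
        rw [Finset.sum_comm]
        have : ∀ j : s, ∑ i, t k.1 i * (c j * m i j.1) = c j * if k.1 = j.1 then d j.1 else 0 := by
          intro j
          rw [← h k.1 j.1, Finset.mul_sum]
          exact Finset.sum_congr rfl fun i _ => by ring
        simp only [this]
        rw [Finset.sum_eq_single k]
        · simp
        · intro b _ hb
          rw [if_neg (fun h' => hb (Subtype.ext h'.symm)), mul_zero]
        · simp
      simp only [h1, mul_zero, Finset.sum_const_zero] at h2
      rcases mul_eq_zero.1 h2.symm with h3 | h3
      · exact h3
      · exact absurd h3 (hd _)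
    have := hli.fintype_card_le_finrank
    simpa using this)
  exact ⟨f, hf, fun j => by simpa using hf2 j⟩

end hall

section final
variable {G N : Type*} [LieRing G] [LieAlgebra ℂ G] [LieRing N] [LieAlgebra ℂ N]
  [Module.Finite ℂ G] [LieAlgebra.IsKilling ℂ G] [Module.Finite ℂ N] [LieAlgebra.IsKilling ℂ N]

lemma exists_matching {A : Type*} [CommRing A] [Algebra ℂ A] (S : DD G N) (M : Model A N) :
    ∃ p : Idx G → Idx N, Function.Injective p ∧ ∀ j, ∃ f : G →ₗ⁅ℂ⁆ N, ∃ x : G,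
      prj (p j).1 (f (prj j.1 x)) ≠ 0 := by
  classical
  have key : ∀ k : Idx G, ∃ t : Idx N → ℂ, ∀ j : Idx G,
      ∑ i, t i * (∑ a, (kf N (prj i.1 (S.ψ (prj j.1 (gb G a)))) (S.ψ (gd G a)) -
        kf N (prj i.1 (S.φ (prj j.1 (gb G a)))) (S.φ (gd G a)))) =
      if k = j then LinearMap.trace ℂ G (prj j.1) else 0 := by
    intro k
    obtain ⟨κ, hs, hi, hm⟩ := Model.main_id S M ((kf G) ∘ₗ prj k.1)
      (fun x y => by
        change kf G (prj k.1 x) y = kf G (prj k.1 y) x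
        rw [(prj_com k.1).adj, kf_symm])
      (fun x y z => by
        change kf G (prj k.1 ⁅x, y⁆) z = kf G (prj k.1 x) ⁅y, z⁆
        rw [prj_com k.1, kf_inv])
    obtain ⟨t, ht⟩ := invariant_form κ hs hi
    refine ⟨t, fun j => ?_⟩
    have h1 := hm (prj j.1) (prj_com j.1)
    have h2 : ∑ a, ((kf G) ∘ₗ prj k.1) (prj j.1 (gb G a)) (gd G a) =
        if k = j then LinearMap.trace ℂ G (prj j.1) else 0 := by
      split_ifs with hkj
      · subst hkj
        rw [tr_eq]
        refine Finset.sum_congr rfl fun a _ => ?_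
        rw [LinearMap.comp_apply, prj_idem]
      · refine Finset.sum_eq_zero fun a _ => ?_
        rw [LinearMap.comp_apply, prj_ortho hkj, map_zero, LinearMap.zero_apply]
    rw [← h2, h1]
    simp only [ht, Finset.mul_sum, mul_sub, Finset.sum_sub_distrib]
    rw [Finset.sum_comm]
    congr 1
    rw [Finset.sum_comm]
  choose t ht using key
  obtain ⟨p, hp, hp2⟩ := hall_matrix t _ (fun j : Idx G => LinearMap.trace ℂ G (prj j.1))
    (fun j h => prj_ne j ((LinearMap.IsIdempotentElem.trace_eq_zero_iff
      (LinearMap.ext fun x => prj_idem j.1 x)).1 h)) ht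
  refine ⟨p, hp, fun j => ?_⟩
  by_contra! hcon
  apply hp2 j
  refine Finset.sum_eq_zero fun a _ => ?_
  rw [hcon S.ψ, hcon S.φ]
  simp

theorem iso_of_DD {A : Type*} [CommRing A] [Algebra ℂ A] (S : DD G N) (M : Model A N) :
    Nonempty (G ≃ₗ⁅ℂ⁆ N) := by
  classical
  obtain ⟨p, hp, hf⟩ := exists_matching S M
  choose f x0 hx0 using hf
  -- the components
  set χ : Idx G → G →ₗ[ℂ] N := fun j => prj (p j).1 ∘ₗ (f j).toLinearMap ∘ₗ prj j.1 with hχ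
  have hχa : ∀ j x, χ j x = prj (p j).1 (f j (prj j.1 x)) := fun _ _ => rfl
  have hlie : ∀ j x y, χ j ⁅x, y⁆ = ⁅χ j x, χ j y⁆ := by
    intro j x y
    rw [hχa, prj_lie, LieHom.map_lie, prj_lie, hχa, hχa]
  have hcross : ∀ j k, j ≠ k → ∀ x y, ⁅χ j x, χ k y⁆ = 0 := by
    intro j k hjk x y
    rw [hχa j, ← prj_idem, ← prj_com, hχa k, (prj_com _).right,
      prj_ortho (fun h => hjk (hp h)), lie_zero]
  let Ξ : G →ₗ⁅ℂ⁆ N :=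
    { ∑ j, χ j with
      map_lie' := by
        intro x y
        change (∑ j, χ j) ⁅x, y⁆ = ⁅(∑ j, χ j) x, (∑ j, χ j) y⁆
        simp only [LinearMap.sum_apply, hlie, sum_lie, lie_sum]
        refine Finset.sum_congr rfl fun j _ => ?_
        rw [Finset.sum_eq_single j]
        · intro k _ hk; exact hcross _ _ hk _ _
        · simp }
  have hΞ : ∀ x, Ξ x = ∑ j, χ j x := by
    intro x
    change (∑ j, χ j) x = _
    rw [LinearMap.sum_apply]
  have hinj1 : ∀ j x, χ j x = 0 → prj j.1 x = 0 := by
    intro j x hx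
    let K : LieIdeal ℂ G :=
      { LinearMap.ker (χ j) with
        lie_mem := by
          intro u v (hv : χ j v = 0)
          change χ j ⁅u, v⁆ = 0
          rw [hlie, hv, lie_zero] }
    have hK : ∀ z, z ∈ K ↔ χ j z = 0 := fun z => Iff.rfl
    have hpp : ∀ z, χ j (prj j.1 z) = χ j z := fun z => by rw [hχa, hχa, prj_idem]
    rcases simple_alt j K with h | h
    · exfalso
      apply hx0 j
      have := (hK _).1 (h (x0 j))
      rw [hpp] at this
      exact this
    · exact h x (by rw [hK, hpp, hx])
  have hinj : Function.Injective Ξ := by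
    rw [injective_iff_map_eq_zero]
    intro x hx
    rw [← sum_prj x]
    refine Finset.sum_eq_zero fun j _ => hinj1 j x ?_
    rw [hΞ] at hx
    have h1 := congrArg (prj (p j).1) hx
    rw [map_zero, map_sum, Finset.sum_eq_single j] at h1
    · rw [hχa, prj_idem] at h1; exact h1
    · intro k _ hk
      rw [hχa]
      exact prj_ortho (fun h => hk (hp h).symm) _
    · simp
  have hbij : Function.Bijective Ξ := by
    refine ⟨hinj, ?_⟩
    exact (LinearMap.injective_iff_surjective_of_finrank_eq_finrank (f := Ξ.toLinearMap)
      S.e.finrank_eq).1 hinj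
  exact ⟨LieEquiv.ofBijective Ξ hbij⟩

end final
end PostLie

/-- Let `g` and `n` be two Lie algebra structures on the same
finite-dimensional complex vector space (formalized as Lie algebras `G`, `N` together
with a linear equivalence `e : G ≃ₗ[ℂ] N` identifying the underlying vector spaces),
where `g` is semisimple (no nonzero solvable ideals). If there is a post-Lie algebra structure on the pair `(g, n)`,
i.e. a bilinear product `p` satisfying the three post-Lie axioms, then `n` is
isomorphic to `g` as a Lie algebra. -/
theorem postLie_g_semisimple_implies_iso
    {G N : Type*} [LieRing G] [LieAlgebra ℂ G] [Module.Finite ℂ G]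
    [LieRing N] [LieAlgebra ℂ N]
    (e : G ≃ₗ[ℂ] N)
    (hsemisimple : LieAlgebra.HasTrivialRadical ℂ G)
    (p : G →ₗ[ℂ] G →ₗ[ℂ] G)
    (hax1 : ∀ x y : G, p x y - p y x = ⁅x, y⁆ - e.symm ⁅e x, e y⁆)
    (hax2 : ∀ x y z : G, p ⁅x, y⁆ z = p x (p y z) - p y (p x z))
    (hax3 : ∀ x y z : G,
      p x (e.symm ⁅e y, e z⁆) = e.symm ⁅e (p x y), e z⁆ + e.symm ⁅e y, e (p x z)⁆) :
    Nonempty (G ≃ₗ⁅ℂ⁆ N) := by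
  have hred := PostLie.reduction e p hax1 hax2 hax3
  obtain ⟨hK, φ, ψ, hφψ⟩ := hred
  have hfin : Module.Finite ℂ N := Module.Finite.equiv e
  have hKG : LieAlgebra.IsKilling ℂ G := inferInstance
  obtain ⟨A, _, _, ⟨M⟩⟩ := PostLie.exists_model N
  exact PostLie.iso_of_DD ⟨φ, ψ, e, hφψ⟩ M
end

section
/- Let n ≥ 2. Let V be the underlying vector space of sl_n(ℂ) ⊕ gl_n(ℂ). Define two Lie algebra structures on V: g = sl_n(ℂ) ⊕ gl_n(ℂ) (direct Lie algebra sum with the commutator brackets on each summand) and n = sl_n(ℂ) ⊕ ℂ^{n²} (the commutator bracket on the first summand and the abelian Lie algebra structure on the second summand). Then the pair (g, n) admits a post-Lie algebra structure; in particular, there exists a pair of reductive Lie algebras admitting a post-Lie algebra structure that are not isomorphic. One such structure is the bilinear product given by (x₁, y₁)·(x₂, y₂) = (0, y₁y₂), using matrix multiplication y₁y₂ in gl_n(ℂ). -/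
noncomputable section

/-- A map `V → V → V` is ℂ-bilinear. -/
def IsBilin {V : Type*} [AddCommGroup V] [Module ℂ V] (f : V → V → V) : Prop :=
  (∀ (a : ℂ) (x y z : V), f (a • x + y) z = a • f x z + f y z) ∧
  (∀ (a : ℂ) (x y z : V), f x (a • y + z) = a • f x y + f x z)

/-- `f` is a Lie bracket on the complex vector space `V`. -/
def IsLieBracket {V : Type*} [AddCommGroup V] [Module ℂ V] (f : V → V → V) : Prop :=
  IsBilin f ∧ (∀ x, f x x = 0) ∧
  ∀ x y z, f x (f y z) + f y (f z x) + f z (f x y) = 0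

/-- `p` is a post-Lie algebra structure on the pair of Lie brackets `(g, n)` on `V`. -/
def IsPostLieStruct {V : Type*} [AddCommGroup V] [Module ℂ V]
    (g n p : V → V → V) : Prop :=
  IsBilin p ∧
  (∀ x y, p x y - p y x = g x y - n x y) ∧
  (∀ x y z, p (g x y) z = p x (p y z) - p y (p x z)) ∧
  (∀ x y z, p x (n y z) = n (p x y) z + n y (p x z))

/-- The Lie algebras `(V, g)` and `(W, h)` are isomorphic. -/
def LieBracketIso {V W : Type*} [AddCommGroup V] [Module ℂ V] [AddCommGroup W]
    [Module ℂ W] (g : V → V → V) (h : W → W → W) : Prop :=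
  ∃ e : V ≃ₗ[ℂ] W, ∀ x y, e (g x y) = h (e x) (e y)

/-- The underlying vector space of `sl_n(ℂ) ⊕ gl_n(ℂ)`. -/
abbrev slgl (n : ℕ) :=
  ↥(LieAlgebra.SpecialLinear.sl (Fin n) ℂ) × Matrix (Fin n) (Fin n) ℂ

/-- The bracket of the direct Lie algebra sum `g = sl_n(ℂ) ⊕ gl_n(ℂ)`,
with the commutator bracket on each summand. -/
def slglBracket (n : ℕ) (x y : slgl n) : slgl n :=
  (⁅x.1, y.1⁆, x.2 * y.2 - y.2 * x.2)

/-- The bracket of `n = sl_n(ℂ) ⊕ ℂ^{n²}`: the commutator bracket on the first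
summand and the abelian Lie algebra structure on the second summand. -/
def slAbelianBracket (n : ℕ) (x y : slgl n) : slgl n :=
  (⁅x.1, y.1⁆, 0)

/-- The product `(x₁, y₁) · (x₂, y₂) = (0, y₁ y₂)` (matrix multiplication). -/
def slglProduct (n : ℕ) (x y : slgl n) : slgl n :=
  (0, x.2 * y.2)

/-- For `n ≥ 2`, on the underlying space of `sl_n(ℂ) ⊕ gl_n(ℂ)`,
the brackets of `g = sl_n(ℂ) ⊕ gl_n(ℂ)` and `n = sl_n(ℂ) ⊕ ℂ^{n²}` are Lie brackets,
the product `(x₁, y₁) · (x₂, y₂) = (0, y₁ y₂)` is a post-Lie algebra structure on the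
pair `(g, n)` (so this pair of reductive Lie algebras admits a post-Lie algebra
structure), and `g` and `n` are not isomorphic. -/
theorem postLie_on_slgl_slabelian (n : ℕ) (hn : 2 ≤ n) :
    IsLieBracket (slglBracket n) ∧ IsLieBracket (slAbelianBracket n) ∧
    IsPostLieStruct (slglBracket n) (slAbelianBracket n) (slglProduct n) ∧
    ¬ LieBracketIso (slglBracket n) (slAbelianBracket n) := by
  have hs : ∀ M : Matrix (Fin n) (Fin n) ℂ,
      (∀ i j : Fin n, i ≠ j → Commute (Matrix.single i j 1) M) → ∃ c : ℂ, M = c • 1 := by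
    intro M hM
    obtain ⟨c, hc⟩ := Matrix.mem_range_scalar_of_commute_single (M := M) (fun i j h => hM i j h)
    exact ⟨c, by rw [← hc, Matrix.smul_one_eq_diagonal]; rfl⟩
  refine ⟨⟨⟨?_, ?_⟩, ?_, ?_⟩, ⟨⟨?_, ?_⟩, ?_, ?_⟩, ⟨⟨?_, ?_⟩, ?_, ?_, ?_⟩, ?_⟩
  · intro a x y z
    refine Prod.ext ?_ ?_
    · simp [slglBracket]
    · simp [slglBracket, add_mul, mul_add, smul_sub]; abel
  · intro a x y z
    refine Prod.ext ?_ ?_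
    · simp [slglBracket]
    · simp [slglBracket, add_mul, mul_add, smul_sub]; abel
  · intro x
    simp [slglBracket]
  · intro x y z
    refine Prod.ext ?_ ?_
    · exact lie_jacobi x.1 y.1 z.1
    · simp only [slglBracket, Prod.snd_add, Prod.snd_zero]; noncomm_ring
  · intro a x y z
    refine Prod.ext ?_ ?_ <;> simp [slAbelianBracket]
  · intro a x y z
    refine Prod.ext ?_ ?_ <;> simp [slAbelianBracket]
  · intro x
    simp [slAbelianBracket]
  · intro x y z
    refine Prod.ext ?_ ?_
    · exact lie_jacobi x.1 y.1 z.1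
    · simp [slAbelianBracket]
  · intro a x y z
    refine Prod.ext ?_ ?_ <;> simp [slglProduct, add_mul]
  · intro a x y z
    refine Prod.ext ?_ ?_ <;> simp [slglProduct, mul_add]
  · intro x y
    refine Prod.ext ?_ ?_ <;> simp [slglProduct, slglBracket, slAbelianBracket]
  · intro x y z
    refine Prod.ext ?_ ?_ <;> simp [slglProduct, slglBracket, sub_mul, mul_assoc]
  · intro x y z
    refine Prod.ext ?_ ?_ <;> simp [slglProduct, slAbelianBracket]
  · rintro ⟨e, he⟩
    have hn0 : (n : ℂ) ≠ 0 := by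
      have : n ≠ 0 := by omega
      exact_mod_cast this
    -- preimages of the abelian summand are central, hence of the form `(0, c • 1)`
    have key : ∀ y : Matrix (Fin n) (Fin n) ℂ, ∃ c : ℂ, e.symm (0, y) = (0, c • 1) := by
      intro y
      have hz : ∀ w, slglBracket n w (e.symm (0, y)) = 0 := by
        intro w
        apply e.injective
        rw [he, map_zero, e.apply_symm_apply]
        simp [slAbelianBracket]
      generalize e.symm (0, y) = u at hz
      obtain ⟨c, hc⟩ := hs u.2 (fun i j _ =>
        sub_eq_zero.mp (congrArg Prod.snd (hz (0, Matrix.single i j 1))))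
      obtain ⟨d, hd⟩ := hs u.1.1 (fun i j hij => by
        have ht : Matrix.single i j (1 : ℂ) ∈ LieAlgebra.SpecialLinear.sl (Fin n) ℂ := by
          change Matrix.trace (Matrix.single i j (1 : ℂ)) = 0
          exact Matrix.trace_single_eq_of_ne i j 1 hij
        have h1 : ⁅(⟨_, ht⟩ : LieAlgebra.SpecialLinear.sl (Fin n) ℂ), u.1⁆ = 0 :=
          congrArg Prod.fst (hz (⟨_, ht⟩, 0))
        have h2 := congrArg Subtype.val h1
        exact sub_eq_zero.mp h2)
      have htr : Matrix.trace u.1.1 = 0 := u.1.2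
      rw [hd] at htr
      have hd0 : d = 0 := by simpa [hn0, show n ≠ 0 by omega] using htr
      refine ⟨c, Prod.ext (Subtype.ext ?_) hc⟩
      rw [hd, hd0]; simp
    let i0 : Fin n := ⟨0, by omega⟩
    let i1 : Fin n := ⟨1, by omega⟩
    have h01 : i0 ≠ i1 := by simp [i0, i1]
    obtain ⟨c, hc⟩ := key 1
    obtain ⟨d, hd⟩ := key (Matrix.single i0 i1 1)
    have hc' := (e.symm_apply_eq).mp hc
    have hd' := (e.symm_apply_eq).mp hd
    have h : d • e (0, c • 1) = c • e (0, d • 1) := by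
      rw [← map_smul, ← map_smul]
      congr 1
      refine Prod.ext ?_ ?_
      · simp
      · simp [smul_smul, mul_comm]
    rw [← hc', ← hd'] at h
    have h2 : d • (1 : Matrix (Fin n) (Fin n) ℂ) = c • Matrix.single i0 i1 1 :=
      congrArg Prod.snd h
    have h3 : d = 0 := by
      have := congrFun (congrFun h2 i0) i0
      simpa [Matrix.single_apply, h01.symm] using this
    rw [h3] at hd'
    have h4 : ((0, Matrix.single i0 i1 1) : slgl n) = 0 := by
      rw [hd', zero_smul]; exact map_zero e
    have h5 := congrFun (congrFun (congrArg Prod.snd h4) i0) i1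
    simp at h5
end
end

section
/- Let n = sl_2(ℂ) ⊕ sl_2(ℂ) with basis e1 = E12, e2 = E21, e3 = E11 − E22 in the first summand and e4, e5, e6 the corresponding elements of the second summand, and bracket {·,·} the direct-sum commutator bracket. Let φ be the linear map determined by φ(e2) = −e2, φ(e5) = −e3 − e5, and φ(e_i) = 0 for i = 1, 3, 4, 6, and define the bilinear product x·y = {φ(x), y}. Then, with the bracket [x, y] := x·y − y·x + {x, y}, the pair (g, n) forms a pair of Lie algebras on the same 6-dimensional vector space, x·y is a post-Lie algebra structure on (g, n), and g is isomorphic as a Lie algebra to r_2(ℂ) ⊕ r_2(ℂ) ⊕ r_2(ℂ); in particular g is solvable. Hence there exists a post-Lie algebra structure on a pair (g, n) with g complete solvable and n semisimple non-simple. -/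
noncomputable section

/-- The bracket of `n = sl₂(ℂ) ⊕ sl₂(ℂ)` on `ℂ⁶` in the basis
`e₁ = E₁₂, e₂ = E₂₁, e₃ = E₁₁ - E₂₂` of the first summand (coordinates `0, 1, 2`)
and the corresponding basis `e₄, e₅, e₆` of the second summand
(coordinates `3, 4, 5`):
`{e₁,e₂} = e₃`, `{e₃,e₁} = 2e₁`, `{e₃,e₂} = -2e₂`, and similarly for the second
summand. -/
def sl2sl2Bracket (x y : Fin 6 → ℂ) : Fin 6 → ℂ :=
  let c : Fin 6 → Fin 6 → ℂ := fun i j => x i * y j - x j * y i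
  ![2 * c 2 0, -2 * c 2 1, c 0 1, 2 * c 5 3, -2 * c 5 4, c 3 4]

/-- The linear map `φ` determined by `φ(e₂) = -e₂`, `φ(e₅) = -e₃ - e₅` and
`φ(eᵢ) = 0` for `i = 1, 3, 4, 6`. -/
def sl2sl2Phi (x : Fin 6 → ℂ) : Fin 6 → ℂ :=
  ![0, -x 1, -x 4, 0, -x 4, 0]

/-- The product `x · y = {φ(x), y}`. -/
def sl2sl2Product (x y : Fin 6 → ℂ) : Fin 6 → ℂ :=
  sl2sl2Bracket (sl2sl2Phi x) y

/-- The bracket `[x, y] := x · y - y · x + {x, y}` of `g`. -/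
def gBracket12 (x y : Fin 6 → ℂ) : Fin 6 → ℂ :=
  sl2sl2Product x y - sl2sl2Product y x + sl2sl2Bracket x y

/-- The bracket of `r₂(ℂ) ⊕ r₂(ℂ) ⊕ r₂(ℂ)` on `ℂ⁶`: three commuting copies of the
`2`-dimensional non-abelian Lie algebra with bases `(a, b)` and bracket `[a,b] = b`
on the coordinate pairs `(0,1)`, `(2,3)`, `(4,5)`. -/
def r2r2r2Bracket (u v : Fin 6 → ℂ) : Fin 6 → ℂ :=
  let d : Fin 6 → Fin 6 → ℂ := fun i j => u i * v j - u j * v i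
  ![0, d 0 1, 0, d 2 3, 0, d 4 5]

set_option maxHeartbeats 4000000

/-- Let `n = sl₂(ℂ) ⊕ sl₂(ℂ)` with the basis `(e₁, …, e₆)` above,
let `φ` be the linear map with `φ(e₂) = -e₂`, `φ(e₅) = -e₃ - e₅`, `φ(eᵢ) = 0`
otherwise, and set `x · y = {φ(x), y}` and `[x, y] := x · y - y · x + {x, y}`. Then
`[·,·]` is a Lie bracket, so `(g, n)` is a pair of Lie algebras on the same
`6`-dimensional vector space, `x · y` is a post-Lie algebra structure on `(g, n)`,
and `g` is isomorphic as a Lie algebra to `r₂(ℂ) ⊕ r₂(ℂ) ⊕ r₂(ℂ)`; in particular,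
`g` is solvable. (Hence there is a post-Lie algebra structure on a pair `(g, n)`
with `g` complete solvable and `n` semisimple non-simple.) -/
theorem postLie_on_r2r2r2_sl2sl2 :
    IsLieBracket sl2sl2Bracket ∧ IsLieBracket gBracket12 ∧
    IsPostLieStruct gBracket12 sl2sl2Bracket sl2sl2Product ∧
    LieBracketIso gBracket12 r2r2r2Bracket := by
  refine ⟨⟨⟨?_, ?_⟩, ?_, ?_⟩, ⟨⟨?_, ?_⟩, ?_, ?_⟩, ⟨⟨?_, ?_⟩, ?_, ?_, ?_⟩, ?_⟩
  case refine_14 =>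
    refine ⟨{ toFun := fun x => ![2 * x 2 - 2 * x 4, x 0, 2 * x 4, x 1, 2 * x 5, x 3]
              invFun := fun u => ![u 1, u 3, (u 0 + u 2) / 2, u 5, u 2 / 2, u 4 / 2]
              map_add' := ?_
              map_smul' := ?_
              left_inv := ?_
              right_inv := ?_ }, ?_⟩
    · intro x y
      ext i
      fin_cases i <;> simp <;> ring
    · intro a x
      ext i
      fin_cases i <;> simp <;> ring
    · intro x
      ext i
      fin_cases i <;> simp
    · intro x
      ext i
      fin_cases i <;> simp <;> ring
    · intro x y
      ext i
      fin_cases i <;>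
        simp [gBracket12, sl2sl2Product, sl2sl2Phi, sl2sl2Bracket, r2r2r2Bracket] <;> ring
  all_goals
    intros
    ext i
    fin_cases i <;>
      simp [gBracket12, sl2sl2Product, sl2sl2Phi, sl2sl2Bracket] <;>
        first | ring1 | (ring_nf; simp)
end
end
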